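/- arXiv:1405.2581 — 3 statements merged into one kernel-verified Lean document; each statement's English description precedes it below -/
import Mathlib

section
/- Let R > 0 and let μ be a probability measure on ℝ whose support is contained in an interval of length 2R, and let δ > 0. Then the convolution μ_δ = μ * γ_δ satisfies a logarithmic Sobolev inequality with constant c(δ) ≤ 6905 · (δ^{3/2} R / (4R² + δ)) · exp(2R²/δ) + 4989 · (√δ + 2R)². -/
open MeasureTheory Real

/-- Centered Gaussian measure on ℝ of variance δ. -/
noncomputable def gaussianMeasure (δ : ℝ) : Measure ℝ :=
  volume.withDensity fun t => ENNReal.ofReal ((Real.sqrt (2 * π * δ))⁻¹ * Real.exp (-(t ^ 2) / (2 * δ)))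

/-- Convolution of two measures on ℝ. -/
noncomputable def mconv (μ ν : Measure ℝ) : Measure ℝ :=
  (μ.prod ν).map fun p => p.1 + p.2

/-- Entropy functional Ent_ν(g) = ∫ g log (g / ∫ g dν) dν. -/
noncomputable def Ent {α : Type*} [MeasurableSpace α] (ν : Measure α) (g : α → ℝ) : ℝ :=
  ∫ x, g x * Real.log (g x / ∫ y, g y ∂ν) ∂ν

/-- ν satisfies a logarithmic Sobolev inequality with constant c:
Ent_ν(f²) ≤ c ∫ |f'|² dν for all smooth compactly supported f : ℝ → ℝ. -/
def SatisfiesLSI (ν : Measure ℝ) (c : ℝ) : Prop :=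
  ∀ f : ℝ → ℝ, ContDiff ℝ (⊤ : ℕ∞) f → HasCompactSupport f →
    Ent ν (fun t => f t ^ 2) ≤ c * ∫ t, deriv f t ^ 2 ∂ν

/-- A continuous, positive probability density on the real line. -/
structure IsPosDensity (p : ℝ → ℝ) : Prop where
  continuous : Continuous p
  pos : ∀ x, 0 < p x
  integrable : Integrable p
  integral_eq_one : ∫ x, p x = 1

section Transport

open Set Filter Topology

lemma setIntegral_Iic_sub {p : ℝ → ℝ} (hi : Integrable p) (x y : ℝ) :
    (∫ t in Iic y, p t) - ∫ t in Iic x, p t = ∫ t in x..y, p t :=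
  intervalIntegral.integral_Iic_sub_Iic hi.integrableOn hi.integrableOn

lemma hasDerivAt_setIntegral_Iic {p : ℝ → ℝ} (hc : Continuous p) (hi : Integrable p) (x : ℝ) :
    HasDerivAt (fun y => ∫ t in Iic y, p t) (p x) x := by
  have h : (fun y => ∫ t in Iic y, p t) = fun y => (∫ t in Iic x, p t) + ∫ t in x..y, p t := by
    funext y
    rw [← setIntegral_Iic_sub hi x y]
    ring
  rw [h]
  exact (intervalIntegral.integral_hasDerivAt_right (hc.intervalIntegrable _ _)
    (hc.stronglyMeasurableAtFilter _ _) hc.continuousAt).const_add _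

namespace IsPosDensity

variable {p q : ℝ → ℝ}

lemma strictMono_cdf (hp : IsPosDensity p) : StrictMono fun x => ∫ t in Iic x, p t := by
  intro x y hxy
  have h := intervalIntegral.intervalIntegral_pos_of_pos (hp.continuous.intervalIntegrable x y)
    hp.pos hxy
  rw [← setIntegral_Iic_sub hp.integrable] at h
  simpa using h

lemma tendsto_cdf_atTop (hp : IsPosDensity p) :
    Tendsto (fun x => ∫ t in Iic x, p t) atTop (𝓝 1) := by
  rw [← hp.integral_eq_one]
  exact (aecover_Iic tendsto_id).integral_tendsto_of_countably_generated hp.integrable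

lemma cdf_lt_one (hp : IsPosDensity p) (x : ℝ) : ∫ t in Iic x, p t < 1 :=
  (hp.strictMono_cdf (lt_add_one x)).trans_le
    (hp.strictMono_cdf.monotone.ge_of_tendsto hp.tendsto_cdf_atTop _)

lemma cdf_pos (hp : IsPosDensity p) (x : ℝ) : 0 < ∫ t in Iic x, p t :=
  (hp.strictMono_cdf.monotone.le_of_tendsto (tendsto_integral_Iic_zero tendsto_id) _).trans_lt
    (hp.strictMono_cdf (sub_one_lt x))

lemma setIntegral_Ioi (hp : IsPosDensity p) (x : ℝ) :
    ∫ t in Ioi x, p t = 1 - ∫ t in Iic x, p t := by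
  rw [← hp.integral_eq_one, ← integral_add_compl measurableSet_Iic hp.integrable, compl_Iic]
  ring

lemma exists_cdf_eq (hq : IsPosDensity q) {c : ℝ} (h0 : 0 < c) (h1 : c < 1) :
    ∃ y, ∫ t in Iic y, q t = c := by
  have hcont : Continuous fun x => ∫ t in Iic x, q t :=
    continuous_iff_continuousAt.2 fun x =>
      (hasDerivAt_setIntegral_Iic hq.continuous hq.integrable x).continuousAt
  exact mem_range_of_exists_le_of_exists_ge hcont
    (((tendsto_integral_Iic_zero tendsto_id).eventually_lt_const h0).exists.imp fun _ h => h.le)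
    ((hq.tendsto_cdf_atTop.eventually_const_lt h1).exists.imp fun _ h => h.le)

/-- The monotone rearrangement of one positive density onto another. -/
lemma exists_transport (hp : IsPosDensity p) (hq : IsPosDensity q) :
    ∃ T : ℝ → ℝ, StrictMono T ∧ Function.Surjective T ∧
      (∀ x, HasDerivAt T (p x / q (T x)) x) ∧
      ∀ x, ∫ t in Iic (T x), q t = ∫ t in Iic x, p t := by
  choose T hT using fun x => hq.exists_cdf_eq (hp.cdf_pos x) (hp.cdf_lt_one x)
  have hmono : StrictMono T := fun x y hxy => by
    rw [← hq.strictMono_cdf.lt_iff_lt]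
    simpa only [hT] using hp.strictMono_cdf hxy
  have hsurj : Function.Surjective T := fun y => by
    obtain ⟨x, hx⟩ := hp.exists_cdf_eq (hq.cdf_pos y) (hq.cdf_lt_one y)
    exact ⟨x, hq.strictMono_cdf.injective (by simp only [hT, hx])⟩
  have hcont : Continuous T := hmono.monotone.continuous_of_surjective hsurj
  refine ⟨T, hmono, hsurj, fun x => ?_, hT⟩
  have h1 := hasDerivAt_iff_tendsto_slope.1
    (hasDerivAt_setIntegral_Iic hp.continuous hp.integrable x)
  have h2 := hasDerivAt_iff_tendsto_slope.1
    (hasDerivAt_setIntegral_Iic hq.continuous hq.integrable (T x))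
  have h3 : Tendsto T (𝓝[≠] x) (𝓝[≠] (T x)) :=
    hcont.continuousAt.continuousWithinAt.tendsto_nhdsWithin
      fun y hy => hmono.injective.ne hy
  rw [hasDerivAt_iff_tendsto_slope]
  refine (h1.div (h2.comp h3) (hq.pos _).ne').congr' ?_
  filter_upwards [self_mem_nhdsWithin] with y hy
  have hy' : y - x ≠ 0 := sub_ne_zero.2 hy
  have hTy : T y - T x ≠ 0 := sub_ne_zero.2 (hmono.injective.ne hy)
  have hP : (∫ t in Iic y, p t) - ∫ t in Iic x, p t ≠ 0 :=
    sub_ne_zero.2 (hp.strictMono_cdf.injective.ne hy)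
  simp only [Function.comp_def, Pi.div_apply, slope_def_field, hT]
  field_simp

lemma integral_comp_transport (hp : IsPosDensity p) (hq : IsPosDensity q) {T : ℝ → ℝ}
    (hmono : StrictMono T) (hsurj : Function.Surjective T)
    (hderiv : ∀ x, HasDerivAt T (p x / q (T x)) x) (g : ℝ → ℝ) :
    ∫ x, g (T x) * p x = ∫ y, g y * q y := by
  have h := integral_image_eq_integral_abs_deriv_smul MeasurableSet.univ
    (fun x _ => (hderiv x).hasDerivWithinAt) hmono.injective.injOn fun y => g y * q y
  rw [image_univ, hsurj.range_eq, setIntegral_univ, setIntegral_univ] at h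
  rw [h]
  congr 1 with x
  rw [abs_of_pos (div_pos (hp.pos x) (hq.pos _)), smul_eq_mul]
  field_simp [(hq.pos (T x)).ne']

end IsPosDensity

end Transport

section StandardGaussian

open Set Filter Topology ProbabilityTheory

local notation "φ" => gaussianPDFReal 0 1

lemma stdGaussian_eq (x : ℝ) : φ x = φ 0 * exp (-(x ^ 2) / 2) := by
  simp [gaussianPDFReal]

lemma stdGaussian_pos (x : ℝ) : 0 < φ x := gaussianPDFReal_pos 0 1 x one_ne_zero

lemma hasDerivAt_stdGaussian (x : ℝ) : HasDerivAt φ (-x * φ x) x := by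
  have h : φ = fun x => φ 0 * exp (-(x ^ 2) / 2) := funext stdGaussian_eq
  have h' : HasDerivAt (fun x : ℝ => -(x ^ 2) / 2) (-x) x := by
    refine ((hasDerivAt_pow 2 x).neg.div_const 2).congr_deriv ?_
    push_cast
    ring
  rw [stdGaussian_eq x]
  conv => enter [1]; rw [h]
  refine (h'.exp.const_mul (φ 0)).congr_deriv ?_
  ring

lemma continuous_stdGaussian : Continuous φ :=
  continuous_iff_continuousAt.2 fun x => (hasDerivAt_stdGaussian x).continuousAt

lemma isPosDensity_stdGaussian : IsPosDensity φ where
  continuous := continuous_stdGaussian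
  pos := stdGaussian_pos
  integrable := integrable_gaussianPDFReal 0 1
  integral_eq_one := integral_gaussianPDFReal_eq_one 0 one_ne_zero

lemma stdGaussian_neg (x : ℝ) : φ (-x) = φ x := by
  rw [stdGaussian_eq, stdGaussian_eq x, neg_sq]

lemma stdGaussian_add (x t : ℝ) : φ (x + t) = φ x * exp (-(x * t) - t ^ 2 / 2) := by
  rw [stdGaussian_eq, stdGaussian_eq x, mul_assoc, ← exp_add]
  congr 2
  ring

lemma log_stdGaussian (x : ℝ) : log (φ x) = log (φ 0) - x ^ 2 / 2 := by
  rw [stdGaussian_eq, log_mul (stdGaussian_pos 0).ne' (exp_pos _).ne', log_exp]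
  ring

lemma stdGaussian_le_of_abs_le {x y : ℝ} (h : |x| ≤ |y|) : φ y ≤ φ x := by
  rw [stdGaussian_eq, stdGaussian_eq x]
  have := sq_le_sq.2 h
  have := (stdGaussian_pos 0).le
  gcongr

lemma tendsto_stdGaussian_atTop : Tendsto φ atTop (𝓝 0) := by
  have h : Tendsto (fun x : ℝ => exp (-(x ^ 2) / 2)) atTop (𝓝 0) := by
    refine tendsto_exp_atBot.comp ?_
    have := (tendsto_pow_atTop (α := ℝ) two_ne_zero).atTop_div_const (r := 2) two_pos
    refine (tendsto_neg_atTop_atBot.comp this).congr fun x => ?_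
    simp only [Function.comp_apply]
    ring
  simpa [← stdGaussian_eq] using h.const_mul (φ 0)

lemma setIntegral_Ioi_add (f : ℝ → ℝ) (a c : ℝ) :
    ∫ t in Ioi (a + c), f t = ∫ t in Ioi a, f (t + c) := by
  have h := (measurePreserving_add_right volume c).setIntegral_preimage_emb
    (measurableEmbedding_addRight c) f (Ioi (a + c))
  have h' : (fun t => t + c) ⁻¹' Ioi (a + c) = Ioi a := by
    ext t
    simp
  rw [← h, h']

lemma setIntegral_Ioi_stdGaussian_add_one_le (x : ℝ) :
    ∫ t in Ioi (x + 1), φ t ≤ exp (-x) * ∫ t in Ioi x, φ t := by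
  have hi := integrable_gaussianPDFReal 0 1
  rw [setIntegral_Ioi_add, ← integral_const_mul]
  refine setIntegral_mono_on (hi.comp_add_right 1).integrableOn (hi.const_mul _).integrableOn
    measurableSet_Ioi fun t ht => ?_
  rw [stdGaussian_add, mul_comm]
  have := (stdGaussian_pos t).le
  have : x < t := ht
  gcongr
  linarith

lemma setIntegral_Iic_stdGaussian_eq (x : ℝ) :
    ∫ t in Iic x, φ t = ∫ t in Ioi (-x), φ t := by
  rw [← integral_comp_neg_Iic]
  simp only [stdGaussian_neg]

lemma integrable_mul_stdGaussian {h : ℝ → ℝ} (hc : Continuous h) (hs : HasCompactSupport h) :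
    Integrable fun x => h x * φ x :=
  (hc.mul continuous_stdGaussian).integrable_of_hasCompactSupport hs.mul_right

end StandardGaussian

section GaussianLogSobolev

open Set Filter Topology ProbabilityTheory

local notation "φ" => gaussianPDFReal 0 1

lemma add_mul_log_add_ge {a b : ℝ} (ha : 0 ≤ a) (hb : 0 < b) :
    a * log a + b * log b ≤ (a + b) * log (a + b) := by
  rw [add_mul]
  refine add_le_add ?_ (mul_le_mul_of_nonneg_left (log_le_log hb (by linarith)) hb.le)
  rcases ha.eq_or_lt with rfl | ha
  · simp
  · exact mul_le_mul_of_nonneg_left (log_le_log ha (by linarith)) ha.le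

/-- The defect `∫ f² log f² dγ + ε log ε - (Z + ε) log (Z + ε) - 2 ∫ (deriv f)² dγ`, with `Z = ∫ f² dγ`,
is nonpositive: this is the logarithmic Sobolev inequality for `f² + ε`, proved by transporting the
density proportional to `f² + ε` onto the Gaussian. -/
lemma gaussian_logSobolev_perturbed {f : ℝ → ℝ} (hf : ContDiff ℝ 1 f) (hs : HasCompactSupport f)
    {ε : ℝ} (hε : 0 < ε) :
    (∫ x, f x ^ 2 * log (f x ^ 2) * φ x) + ε * log ε
      - ((∫ x, f x ^ 2 * φ x) + ε) * log ((∫ x, f x ^ 2 * φ x) + ε)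
      ≤ 2 * ∫ x, deriv f x ^ 2 * φ x := by
  have hfc := hf.continuous
  have hf'c : Continuous (deriv f) := hf.continuous_deriv le_rfl
  have hs2 : HasCompactSupport fun x => f x ^ 2 := hs.comp_left (g := fun y => y ^ 2) (by simp)
  have hi0 := integrable_gaussianPDFReal 0 1
  have hi1 : Integrable fun x => f x ^ 2 * φ x := integrable_mul_stdGaussian (hfc.pow 2) hs2
  have hi2 : Integrable fun x => deriv f x ^ 2 * φ x :=
    integrable_mul_stdGaussian (hf'c.pow 2) (hs.deriv.comp_left (g := fun y => y ^ 2) (by simp))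
  have hi3 : Integrable fun x => f x ^ 2 * log (f x ^ 2) * φ x :=
    integrable_mul_stdGaussian (continuous_mul_log.comp (hfc.pow 2)) hs2.mul_right
  set Z := ∫ x, f x ^ 2 * φ x with hZ
  have hZ0 : 0 ≤ Z := integral_nonneg fun x => mul_nonneg (sq_nonneg _) (stdGaussian_pos x).le
  have hW : 0 < Z + ε := by linarith
  set p : ℝ → ℝ := fun x => (f x ^ 2 + ε) / (Z + ε) * φ x with hp_def
  have hp_eq : p = fun x => (Z + ε)⁻¹ * (f x ^ 2 * φ x + ε * φ x) := by
    funext x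
    simp only [hp_def]
    ring
  have hp : IsPosDensity p :=
    { continuous := by
        have := continuous_stdGaussian
        fun_prop
      pos := fun x => mul_pos (by positivity) (stdGaussian_pos x)
      integrable := by
        rw [hp_eq]
        exact (hi1.add (hi0.const_mul ε)).const_mul _
      integral_eq_one := by
        rw [hp_eq, integral_const_mul, integral_add hi1 (hi0.const_mul ε), integral_const_mul,
          isPosDensity_stdGaussian.integral_eq_one, mul_one, inv_mul_cancel₀ hW.ne'] }
  obtain ⟨T, hTmono, -, hT', hTcdf⟩ := hp.exists_transport isPosDensity_stdGaussian
  have hTc : Continuous T := continuous_iff_continuousAt.2 fun x => (hT' x).continuousAt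
  set B : ℝ → ℝ := fun x => (T x - x) * p x with hB
  set B' : ℝ → ℝ := fun x => (p x / φ (T x) - 1) * p x +
    (T x - x) * ((2 * f x * deriv f x) / (Z + ε) * φ x
      + (f x ^ 2 + ε) / (Z + ε) * (-x * φ x)) with hB'
  have hBderiv : ∀ x, HasDerivAt B (B' x) x := by
    intro x
    have h1 : HasDerivAt f (deriv f x) x := (hf.differentiable one_ne_zero x).hasDerivAt
    have h2 : HasDerivAt (fun x => (f x ^ 2 + ε) / (Z + ε)) ((2 * f x * deriv f x) / (Z + ε)) x := by
      refine (((h1.pow 2).add_const ε).div_const (Z + ε)).congr_deriv ?_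
      simp
    exact ((hT' x).sub (hasDerivAt_id x)).mul (h2.mul (hasDerivAt_stdGaussian x))
  have hB'c : Continuous B' := by
    have h1 := continuous_stdGaussian
    have h2 := hp.continuous
    have h3 : Continuous fun x => p x / φ (T x) :=
      h2.div (h1.comp hTc) fun x => (stdGaussian_pos _).ne'
    fun_prop
  set G : ℝ → ℝ := fun x => f x ^ 2 * log (f x ^ 2) * φ x + ε * log ε * φ x
    - log (Z + ε) * (f x ^ 2 * φ x + ε * φ x) - 2 * (deriv f x ^ 2 * φ x) with hG
  have hGi : Integrable G :=
    ((hi3.add (hi0.const_mul _)).sub ((hi1.add (hi0.const_mul ε)).const_mul _)).sub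
      (hi2.const_mul 2)
  have hGint : ∫ x, G x = (∫ x, f x ^ 2 * log (f x ^ 2) * φ x) + ε * log ε
      - (Z + ε) * log (Z + ε) - 2 * ∫ x, deriv f x ^ 2 * φ x := by
    simp only [hG]
    rw [integral_sub, integral_sub, integral_add, integral_const_mul, integral_const_mul,
      integral_const_mul, integral_add, integral_const_mul,
      isPosDensity_stdGaussian.integral_eq_one, ← hZ]
    · ring
    · exact hi1
    · exact hi0.const_mul _
    · exact hi3
    · exact hi0.const_mul _
    · exact hi3.add (hi0.const_mul _)
    · exact (hi1.add (hi0.const_mul ε)).const_mul _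
    · exact (hi3.add (hi0.const_mul _)).sub ((hi1.add (hi0.const_mul ε)).const_mul _)
    · exact hi2.const_mul 2
  have hpoint : ∀ x, G x ≤ (Z + ε) * B' x := by
    intro x
    have ha : 0 < f x ^ 2 + ε := by positivity
    have hφ := stdGaussian_pos x
    have hpx := hp.pos x
    have h1 := log_le_sub_one_of_pos (div_pos hpx (stdGaussian_pos (T x)))
    rw [log_div hpx.ne' (stdGaussian_pos (T x)).ne', hp_def] at h1
    simp only at h1
    rw [log_mul (div_pos ha hW).ne' hφ.ne', log_div ha.ne' hW.ne', log_stdGaussian x,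
      log_stdGaussian (T x)] at h1
    have h2 := add_mul_log_add_ge (sq_nonneg (f x)) hε
    have h3 := mul_le_mul_of_nonneg_left h1 ha.le
    set τ := (f x ^ 2 + ε) / (Z + ε) * φ x / φ (T x) with hτ
    have hBx : (Z + ε) * B' x = φ x * ((f x ^ 2 + ε) * (τ - 1)
        + (T x - x) * (2 * f x * deriv f x - (f x ^ 2 + ε) * x)) := by
      simp only [hB', hp_def, ← hτ]
      field_simp
      ring
    have hGx : G x = φ x * (f x ^ 2 * log (f x ^ 2) + ε * log ε
        - (f x ^ 2 + ε) * log (Z + ε) - 2 * deriv f x ^ 2) := by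
      simp only [hG]
      ring
    rw [hBx, hGx]
    refine mul_le_mul_of_nonneg_left ?_ hφ.le
    nlinarith [sq_nonneg (f x * (T x - x) + 2 * deriv f x), mul_nonneg hε.le (sq_nonneg (T x - x))]
  obtain ⟨N, -, hN⟩ := hs.exists_pos_le_norm
  have hpN : ∀ x, N ≤ |x| → p x = ε / (Z + ε) * φ x := by
    intro x hx
    simp [hp_def, hN x hx]
  have he : 0 < ε / (Z + ε) := by positivity
  have hsmall : ∀ᶠ x : ℝ in atTop, exp (-x) ≤ ε / (Z + ε) :=
    ((tendsto_exp_atBot.comp tendsto_neg_atTop_atBot).eventually_lt_const he).mono fun _ h => h.le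
  have hbdry : ∀ᶠ x : ℝ in atTop, B x - B (-x) ≤ 2 * (ε / (Z + ε) * φ x) := by
    filter_upwards [hsmall, eventually_ge_atTop N, eventually_ge_atTop 0] with x hx hxN hx0
    have hpx : p x = ε / (Z + ε) * φ x := hpN x (hxN.trans (le_abs_self x))
    have hpx' : p (-x) = ε / (Z + ε) * φ x := by
      rw [hpN (-x) (by rw [abs_neg]; exact hxN.trans (le_abs_self x)), stdGaussian_neg]
    have htail : 0 ≤ ∫ t in Ioi x, φ t :=
      setIntegral_nonneg measurableSet_Ioi fun t _ => (stdGaussian_pos t).le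
    have hup : T x ≤ x + 1 := by
      have h1 : ∫ t in Ioi (T x), φ t = ε / (Z + ε) * ∫ t in Ioi x, φ t := by
        rw [isPosDensity_stdGaussian.setIntegral_Ioi, hTcdf, ← hp.setIntegral_Ioi,
          ← integral_const_mul]
        exact setIntegral_congr_fun measurableSet_Ioi fun t ht =>
          hpN t ((hxN.trans (le_of_lt ht)).trans (le_abs_self t))
      have h2 : ∫ t in Ioi (x + 1), φ t ≤ ∫ t in Ioi (T x), φ t := by
        rw [h1]
        exact (setIntegral_Ioi_stdGaussian_add_one_le x).trans
          (mul_le_mul_of_nonneg_right hx htail)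
      rw [isPosDensity_stdGaussian.setIntegral_Ioi, isPosDensity_stdGaussian.setIntegral_Ioi,
        sub_le_sub_iff_left] at h2
      exact isPosDensity_stdGaussian.strictMono_cdf.le_iff_le.1 h2
    have hlow : -x - 1 ≤ T (-x) := by
      have h1 : ∫ t in Iic (T (-x)), φ t = ε / (Z + ε) * ∫ t in Iic (-x), φ t := by
        rw [hTcdf, ← integral_const_mul]
        refine setIntegral_congr_fun measurableSet_Iic fun t ht => hpN t ?_
        have : t ≤ -x := ht
        exact le_trans (by linarith) (neg_le_abs t)
      have h2 : ∫ t in Iic (-x - 1), φ t ≤ ∫ t in Iic (T (-x)), φ t := by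
        rw [h1, setIntegral_Iic_stdGaussian_eq, setIntegral_Iic_stdGaussian_eq, neg_neg,
          show -(-x - 1) = x + 1 by ring]
        exact (setIntegral_Ioi_stdGaussian_add_one_le x).trans
          (mul_le_mul_of_nonneg_right hx htail)
      exact isPosDensity_stdGaussian.strictMono_cdf.le_iff_le.1 h2
    have hpos : 0 ≤ ε / (Z + ε) * φ x := mul_nonneg he.le (stdGaussian_pos x).le
    simp only [hB, hpx, hpx']
    nlinarith
  have hlim1 : Tendsto (fun x : ℝ => ∫ t in (-x)..x, G t) atTop (𝓝 (∫ t, G t)) :=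
    intervalIntegral_tendsto_integral hGi tendsto_neg_atTop_atBot tendsto_id
  have hlim2 : Tendsto (fun x : ℝ => (Z + ε) * (2 * (ε / (Z + ε) * φ x))) atTop (𝓝 0) := by
    simpa using ((tendsto_stdGaussian_atTop.const_mul (ε / (Z + ε))).const_mul 2).const_mul (Z + ε)
  have hle : ∫ t, G t ≤ 0 := by
    refine le_of_tendsto_of_tendsto hlim1 hlim2 ?_
    filter_upwards [hbdry, eventually_ge_atTop 0] with x hx hx0
    calc ∫ t in (-x)..x, G t ≤ ∫ t in (-x)..x, (Z + ε) * B' t :=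
          intervalIntegral.integral_mono_on (by linarith) hGi.intervalIntegrable
            ((hB'c.const_mul _).intervalIntegrable _ _) fun t _ => hpoint t
      _ = (Z + ε) * (B x - B (-x)) := by
          rw [intervalIntegral.integral_const_mul,
            intervalIntegral.integral_eq_sub_of_hasDerivAt (fun t _ => hBderiv t)
              (hB'c.intervalIntegrable _ _)]
      _ ≤ _ := mul_le_mul_of_nonneg_left hx hW.le
  linarith

/-- The Gaussian logarithmic Sobolev inequality on the real line, for `C¹` functions of compact
support. -/
lemma gaussian_logSobolev {f : ℝ → ℝ} (hf : ContDiff ℝ 1 f) (hs : HasCompactSupport f) :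
    (∫ x, f x ^ 2 * log (f x ^ 2) * φ x)
      - (∫ x, f x ^ 2 * φ x) * log (∫ x, f x ^ 2 * φ x)
      ≤ 2 * ∫ x, deriv f x ^ 2 * φ x := by
  set I := ∫ x, f x ^ 2 * log (f x ^ 2) * φ x
  set Z := ∫ x, f x ^ 2 * φ x
  have hc : Continuous fun ε : ℝ => I + ε * log ε - (Z + ε) * log (Z + ε) :=
    (continuous_const.add continuous_mul_log).sub
      (continuous_mul_log.comp (continuous_const.add continuous_id))
  have h : Tendsto (fun ε : ℝ => I + ε * log ε - (Z + ε) * log (Z + ε)) (𝓝[>] 0)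
      (𝓝 (I - Z * log Z)) := by
    simpa using hc.continuousWithinAt.tendsto (x := (0 : ℝ)) (s := Ioi 0)
  exact le_of_tendsto h (eventually_mem_nhdsWithin.mono fun ε hε =>
    gaussian_logSobolev_perturbed hf hs hε)

end GaussianLogSobolev

section MillsRatio

open Set Filter Topology ProbabilityTheory

local notation "φ" => gaussianPDFReal 0 1

lemma hasDerivAt_neg_stdGaussian_div {u : ℝ} (hu : 0 ≤ u) :
    HasDerivAt (fun t => -(φ t / (t + 1))) (φ u * ((u ^ 2 + u + 1) / (u + 1) ^ 2)) u := by
  have hu1 : u + 1 ≠ 0 := by positivity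
  refine ((hasDerivAt_stdGaussian u).div ((hasDerivAt_id u).add_const 1) hu1).neg.congr_deriv ?_
  simp only [id]
  field_simp
  ring

lemma tendsto_neg_stdGaussian_div : Tendsto (fun t => -(φ t / (t + 1))) atTop (𝓝 0) := by
  have h : Tendsto (fun t : ℝ => (t + 1)⁻¹) atTop (𝓝 0) :=
    tendsto_inv_atTop_zero.comp (tendsto_atTop_add_const_right _ _ tendsto_id)
  simpa [div_eq_mul_inv] using (tendsto_stdGaussian_atTop.mul h).neg

lemma integrableOn_Ioi_stdGaussian_mul {u : ℝ} (hu : 0 ≤ u) :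
    IntegrableOn (fun t => φ t * ((t ^ 2 + t + 1) / (t + 1) ^ 2)) (Ioi u) :=
  integrableOn_Ioi_deriv_of_nonneg' (fun _ ht => hasDerivAt_neg_stdGaussian_div (hu.trans ht))
    (fun t ht => by
      have := (stdGaussian_pos t).le
      have : 0 ≤ t := hu.trans (le_of_lt ht)
      positivity) tendsto_neg_stdGaussian_div

lemma setIntegral_Ioi_stdGaussian_mul {u : ℝ} (hu : 0 ≤ u) :
    ∫ t in Ioi u, φ t * ((t ^ 2 + t + 1) / (t + 1) ^ 2) = φ u / (u + 1) := by
  rw [integral_Ioi_of_hasDerivAt_of_tendsto'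
    (fun _ ht => hasDerivAt_neg_stdGaussian_div (hu.trans ht))
    (integrableOn_Ioi_stdGaussian_mul hu) tendsto_neg_stdGaussian_div]
  ring

lemma stdGaussian_div_le_tail {u : ℝ} (hu : 0 ≤ u) : φ u / (u + 1) ≤ ∫ t in Ioi u, φ t := by
  rw [← setIntegral_Ioi_stdGaussian_mul hu]
  refine setIntegral_mono_on (integrableOn_Ioi_stdGaussian_mul hu)
    (integrable_gaussianPDFReal 0 1).integrableOn measurableSet_Ioi fun t ht => ?_
  have ht0 : 0 ≤ t := hu.trans (le_of_lt ht)
  refine mul_le_of_le_one_right (stdGaussian_pos t).le ?_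
  rw [div_le_one (by positivity)]
  nlinarith

lemma tail_le_stdGaussian_div {u : ℝ} (hu : 0 ≤ u) :
    ∫ t in Ioi u, φ t ≤ 4 / 3 * (φ u / (u + 1)) := by
  rw [← setIntegral_Ioi_stdGaussian_mul hu, ← integral_const_mul]
  refine setIntegral_mono_on (integrable_gaussianPDFReal 0 1).integrableOn
    ((integrableOn_Ioi_stdGaussian_mul hu).const_mul _) measurableSet_Ioi fun t ht => ?_
  have ht0 : 0 ≤ t := hu.trans (le_of_lt ht)
  have h : 3 / 4 ≤ (t ^ 2 + t + 1) / (t + 1) ^ 2 := by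
    rw [div_le_div_iff₀ (by norm_num) (by positivity)]
    nlinarith [sq_nonneg (t - 1)]
  nlinarith [stdGaussian_pos t]

lemma one_third_le_stdGaussian_zero : 1 / 3 ≤ φ 0 := by
  have h : √(2 * π) ≤ 3 := by
    rw [sqrt_le_left (by norm_num)]
    nlinarith [pi_lt_d2]
  have h0 : 0 < √(2 * π) := by positivity
  simpa [gaussianPDFReal] using inv_anti₀ h0 h

lemma stdGaussian_le_mul_tail {x w : ℝ} (hw : 0 ≤ w) (hx : x ≤ w) :
    φ x ≤ (w + 1) * ∫ t in Ioi x, φ t := by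
  have hφ : ∀ s : Set ℝ, IntegrableOn φ s := fun s => (integrable_gaussianPDFReal 0 1).integrableOn
  have hnonneg : 0 ≤ ∫ t in Ioi x, φ t :=
    setIntegral_nonneg measurableSet_Ioi fun t _ => (stdGaussian_pos t).le
  rcases le_total 0 x with h0 | h0
  · have h := stdGaussian_div_le_tail h0
    rw [div_le_iff₀ (by positivity)] at h
    nlinarith
  · have h1 := stdGaussian_div_le_tail le_rfl
    have h2 : ∫ t in Ioi 0, φ t ≤ ∫ t in Ioi x, φ t :=
      setIntegral_mono_set (hφ _) (ae_of_all _ fun t => (stdGaussian_pos t).le)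
        (Ioi_subset_Ioi h0).eventuallyLE
    have h3 : φ x ≤ φ 0 := stdGaussian_le_of_abs_le (by simp)
    simp only [zero_add, div_one] at h1
    nlinarith

end MillsRatio

section GaussianMixture

open Set Filter Topology ProbabilityTheory

local notation "φ" => gaussianPDFReal 0 1

/-- The density of the convolution of `μ` with the standard Gaussian. -/
noncomputable def gaussianMixture (μ : Measure ℝ) (y : ℝ) : ℝ :=
  ∫ s, gaussianPDFReal 0 1 (y - s) ∂μ

variable (μ : Measure ℝ) [IsProbabilityMeasure μ]

lemma integrable_stdGaussian_sub (y : ℝ) : Integrable (fun s => φ (y - s)) μ := by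
  refine Integrable.of_bound (continuous_stdGaussian.comp (by fun_prop)).aestronglyMeasurable (φ 0)
    (ae_of_all _ fun s => ?_)
  rw [norm_of_nonneg (stdGaussian_pos _).le]
  exact stdGaussian_le_of_abs_le (by simp)

lemma continuous_gaussianMixture : Continuous (gaussianMixture μ) := by
  refine continuous_of_dominated (bound := fun _ => φ 0)
    (fun y => (integrable_stdGaussian_sub μ y).aestronglyMeasurable)
    (fun y => ae_of_all _ fun s => ?_) (integrable_const _)
    (ae_of_all _ fun s => continuous_stdGaussian.comp (by fun_prop))
  rw [norm_of_nonneg (stdGaussian_pos _).le]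
  exact stdGaussian_le_of_abs_le (by simp)

lemma gaussianMixture_pos (y : ℝ) : 0 < gaussianMixture μ y := by
  refine (integral_pos_iff_support_of_nonneg (fun s => (stdGaussian_pos _).le)
    (integrable_stdGaussian_sub μ y)).2 ?_
  have h : (Function.support fun s => φ (y - s)) = univ := by
    ext s
    simp [(stdGaussian_pos (y - s)).ne']
  simp [h]

omit [IsProbabilityMeasure μ] in
lemma mconv_gaussianReal_apply {A : Set ℝ} (hA : MeasurableSet A) :
    mconv μ (gaussianReal 0 1) A = ∫⁻ s, gaussianReal s 1 A ∂μ := by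
  have hm : Measurable fun p : ℝ × ℝ => p.1 + p.2 := by fun_prop
  rw [mconv, Measure.map_apply hm hA, Measure.prod_apply (hm hA)]
  refine lintegral_congr fun s => ?_
  have h := gaussianReal_map_const_add (μ := 0) (v := 1) s
  rw [zero_add] at h
  rw [← h, Measure.map_apply (by fun_prop) hA]
  rfl

lemma mconv_gaussianReal_eq_withDensity :
    mconv μ (gaussianReal 0 1)
      = volume.withDensity fun y => ENNReal.ofReal (gaussianMixture μ y) := by
  ext A hA
  rw [mconv_gaussianReal_apply μ hA, withDensity_apply _ hA]
  have h1 : ∀ s, gaussianReal s 1 A = ∫⁻ y in A, ENNReal.ofReal (φ (y - s)) := fun s => by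
    simp [gaussianReal_apply s one_ne_zero, gaussianPDF, gaussianPDFReal_sub]
  simp only [h1]
  rw [lintegral_lintegral_swap]
  · refine lintegral_congr fun y => ?_
    rw [gaussianMixture, ofReal_integral_eq_lintegral_ofReal (integrable_stdGaussian_sub μ y)
      (ae_of_all _ fun s => (stdGaussian_pos _).le)]
  · exact ((continuous_stdGaussian.comp (by fun_prop)).measurable.ennreal_ofReal).aemeasurable

instance isProbabilityMeasure_mconv (ν : Measure ℝ) [IsProbabilityMeasure ν] :
    IsProbabilityMeasure (mconv μ ν) :=
  Measure.isProbabilityMeasure_map (by fun_prop)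

lemma isPosDensity_gaussianMixture : IsPosDensity (gaussianMixture μ) := by
  have hnn : 0 ≤ᵐ[volume] gaussianMixture μ := ae_of_all _ fun y => (gaussianMixture_pos μ y).le
  have hm := (continuous_gaussianMixture μ).aestronglyMeasurable (μ := volume)
  have h : ∫⁻ y, ENNReal.ofReal (gaussianMixture μ y) = 1 := by
    have := measure_univ (μ := mconv μ (gaussianReal 0 1))
    rwa [mconv_gaussianReal_eq_withDensity, withDensity_apply _ MeasurableSet.univ,
      Measure.restrict_univ] at this
  refine ⟨continuous_gaussianMixture μ, gaussianMixture_pos μ, ?_, ?_⟩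
  · exact (lintegral_ofReal_ne_top_iff_integrable hm hnn).1 (by simp [h])
  · rw [integral_eq_lintegral_of_nonneg_ae hnn hm, h, ENNReal.toReal_one]

lemma ofReal_setIntegral_gaussianMixture {A : Set ℝ} (hA : MeasurableSet A) :
    ENNReal.ofReal (∫ y in A, gaussianMixture μ y) = mconv μ (gaussianReal 0 1) A := by
  rw [mconv_gaussianReal_eq_withDensity, withDensity_apply _ hA,
    ofReal_integral_eq_lintegral_ofReal (isPosDensity_gaussianMixture μ).integrable.integrableOn
      (ae_of_all _ fun y => (gaussianMixture_pos μ y).le)]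

variable {μ} {r : ℝ} (hμ : ∀ᵐ s ∂μ, s ∈ Icc (-r) r)
include hμ

lemma setIntegral_Iic_gaussianMixture_le (y : ℝ) :
    ∫ t in Iic y, gaussianMixture μ t ≤ ∫ t in Iic (y + r), φ t := by
  have hnn : 0 ≤ ∫ t in Iic (y + r), φ t :=
    setIntegral_nonneg measurableSet_Iic fun t _ => (stdGaussian_pos t).le
  rw [← ENNReal.ofReal_le_ofReal_iff hnn, ofReal_setIntegral_gaussianMixture μ measurableSet_Iic,
    mconv_gaussianReal_apply μ measurableSet_Iic, ← gaussianReal_apply_eq_integral 0 one_ne_zero]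
  calc ∫⁻ s, gaussianReal s 1 (Iic y) ∂μ ≤ ∫⁻ _, gaussianReal 0 1 (Iic (y + r)) ∂μ := by
        refine lintegral_mono_ae (hμ.mono fun s hs => ?_)
        have h := gaussianReal_map_const_add (μ := 0) (v := 1) s
        rw [zero_add] at h
        rw [← h, Measure.map_apply (by fun_prop) measurableSet_Iic]
        refine measure_mono fun t ht => ?_
        have h1 : s + t ≤ y := ht
        have h2 := hs.1
        exact mem_Iic.2 (by linarith)
    _ = _ := by simp

lemma gaussianMixture_add_le (y : ℝ) {τ : ℝ} (hτ : 0 ≤ τ) :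
    gaussianMixture μ (y + τ) * φ (y - r) ≤ gaussianMixture μ y * φ (y - r + τ) := by
  rw [stdGaussian_add, mul_comm (φ (y - r)), ← mul_assoc]
  refine mul_le_mul_of_nonneg_right ?_ (stdGaussian_pos _).le
  rw [gaussianMixture, gaussianMixture, ← integral_mul_const]
  refine integral_mono_ae (integrable_stdGaussian_sub μ _)
    ((integrable_stdGaussian_sub μ y).mul_const _) (hμ.mono fun s hs => ?_)
  simp only
  rw [show y + τ - s = y - s + τ by ring, stdGaussian_add]
  refine mul_le_mul_of_nonneg_left (exp_le_exp.2 ?_) (stdGaussian_pos _).le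
  nlinarith [hs.2]

lemma setIntegral_Ioi_gaussianMixture_mul_le (y : ℝ) :
    (∫ t in Ioi y, gaussianMixture μ t) * φ (y - r)
      ≤ gaussianMixture μ y * ∫ t in Ioi (y - r), φ t := by
  have h1 := setIntegral_Ioi_add (gaussianMixture μ) 0 y
  have h2 := setIntegral_Ioi_add φ 0 (y - r)
  rw [zero_add] at h1 h2
  rw [h1, h2, ← integral_mul_const, ← integral_const_mul]
  refine setIntegral_mono_on
    (((isPosDensity_gaussianMixture μ).integrable.comp_add_right y).mul_const _).integrableOn
    (((integrable_gaussianPDFReal 0 1).comp_add_right (y - r)).const_mul _).integrableOn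
    measurableSet_Ioi fun τ hτ => ?_
  rw [add_comm τ y, add_comm τ (y - r)]
  exact gaussianMixture_add_le hμ y (le_of_lt hτ)

lemma stdGaussian_le_mul_gaussianMixture_of_nonneg (hr : 0 ≤ r) {x y : ℝ} (hy : 0 ≤ y)
    (hxy : ∫ t in Iic y, gaussianMixture μ t = ∫ t in Iic x, φ t) :
    φ x ≤ 3 * (2 * r + 1) * exp (r ^ 2 / 2) * gaussianMixture μ y := by
  have hx : x ≤ y + r := isPosDensity_stdGaussian.strictMono_cdf.le_iff_le.1
    (hxy ▸ setIntegral_Iic_gaussianMixture_le hμ y)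
  have h1 := stdGaussian_le_mul_tail (by linarith) hx
  rw [isPosDensity_stdGaussian.setIntegral_Ioi, ← hxy,
    ← (isPosDensity_gaussianMixture μ).setIntegral_Ioi] at h1
  have h2 := setIntegral_Ioi_gaussianMixture_mul_le hμ y
  have hm := gaussianMixture_pos μ y
  have hE : 1 ≤ exp (r ^ 2 / 2) := one_le_exp (by positivity)
  set S := ∫ t in Ioi y, gaussianMixture μ t
  have hS : 0 ≤ S := setIntegral_nonneg measurableSet_Ioi fun t _ => (gaussianMixture_pos μ t).le
  have hφ := stdGaussian_pos (y - r)
  rcases le_or_gt r y with hry | hry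
  · have h3 := tail_le_stdGaussian_div (sub_nonneg.2 hry)
    have hd : 0 < y - r + 1 := by linarith
    have h4 : S * φ (y - r) ≤ (gaussianMixture μ y * (4 / 3 / (y - r + 1))) * φ (y - r) := by
      refine h2.trans ((mul_le_mul_of_nonneg_left h3 hm.le).trans_eq ?_)
      ring
    have h5 : S ≤ gaussianMixture μ y * (4 / 3 / (y - r + 1)) := le_of_mul_le_mul_right h4 hφ
    have h6 : (y + r + 1) / (y - r + 1) ≤ 2 * r + 1 := by
      rw [div_le_iff₀ hd]
      nlinarith
    calc φ x ≤ (y + r + 1) * (gaussianMixture μ y * (4 / 3 / (y - r + 1))) :=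
          h1.trans (mul_le_mul_of_nonneg_left h5 (by linarith))
      _ = 4 / 3 * ((y + r + 1) / (y - r + 1)) * 1 * gaussianMixture μ y := by ring
      _ ≤ 3 * (2 * r + 1) * exp (r ^ 2 / 2) * gaussianMixture μ y := by
          gcongr
          norm_num
  · have h3 : ∫ t in Ioi (y - r), φ t ≤ 1 := by
      rw [isPosDensity_stdGaussian.setIntegral_Ioi]
      linarith [isPosDensity_stdGaussian.cdf_pos (y - r)]
    have h4 : 1 / 3 * exp (-(r ^ 2) / 2) ≤ φ (y - r) := by
      refine le_trans ?_ (stdGaussian_le_of_abs_le (y := r) ?_)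
      · rw [stdGaussian_eq r]
        exact mul_le_mul_of_nonneg_right one_third_le_stdGaussian_zero (exp_pos _).le
      · rw [abs_of_nonneg hr, abs_of_neg (by linarith)]
        linarith
    have h5 : S * (1 / 3 * exp (-(r ^ 2) / 2)) ≤ gaussianMixture μ y :=
      (mul_le_mul_of_nonneg_left h4 hS).trans
        (h2.trans (mul_le_of_le_one_right hm.le h3))
    have h6 : exp (-(r ^ 2) / 2) * exp (r ^ 2 / 2) = 1 := by
      rw [← exp_add]
      simp [neg_div]
    have h7 : S ≤ 3 * exp (r ^ 2 / 2) * gaussianMixture μ y := by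
      calc S = 3 * exp (r ^ 2 / 2) * (S * (1 / 3 * exp (-(r ^ 2) / 2))) := by
            linear_combination (-S) * h6
        _ ≤ _ := mul_le_mul_of_nonneg_left h5 (by positivity)
    calc φ x ≤ (y + r + 1) * (3 * exp (r ^ 2 / 2) * gaussianMixture μ y) :=
          h1.trans (mul_le_mul_of_nonneg_left h7 (by linarith))
      _ ≤ (2 * r + 1) * (3 * exp (r ^ 2 / 2) * gaussianMixture μ y) := by
          gcongr
          linarith
      _ = _ := by ring

omit [IsProbabilityMeasure μ] hμ in
lemma gaussianMixture_map_neg (y : ℝ) :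
    gaussianMixture (μ.map fun s => -s) y = gaussianMixture μ (-y) := by
  have hc : Continuous fun s => φ (y - s) := continuous_stdGaussian.comp (by fun_prop)
  rw [gaussianMixture, integral_map (by fun_prop) hc.aestronglyMeasurable, gaussianMixture]
  congr 1 with s
  rw [← stdGaussian_neg]
  ring_nf

/-- If `y` is the image of `x` under the monotone rearrangement of the Gaussian onto the mixture,
then the densities at `x` and `y` are comparable. -/
lemma stdGaussian_le_mul_gaussianMixture (hr : 0 ≤ r) {x y : ℝ}
    (hxy : ∫ t in Iic y, gaussianMixture μ t = ∫ t in Iic x, φ t) :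
    φ x ≤ 3 * (2 * r + 1) * exp (r ^ 2 / 2) * gaussianMixture μ y := by
  rcases le_total 0 y with hy | hy
  · exact stdGaussian_le_mul_gaussianMixture_of_nonneg hμ hr hy hxy
  have : IsProbabilityMeasure (μ.map fun s => -s) := Measure.isProbabilityMeasure_map (by fun_prop)
  have hμ' : ∀ᵐ s ∂(μ.map fun s => -s), s ∈ Icc (-r) r := by
    refine (ae_map_iff (f := fun s => -s) (p := fun s => s ∈ Icc (-r) r) (by fun_prop)
      measurableSet_Icc).2 ?_
    filter_upwards [hμ] with s hs
    exact ⟨neg_le_neg hs.2, neg_le.1 hs.1⟩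
  have hneg : ∫ t in Iic (-y), gaussianMixture (μ.map fun s => -s) t = ∫ t in Iic (-x), φ t := by
    simp only [gaussianMixture_map_neg]
    rw [integral_comp_neg_Iic (-y) (gaussianMixture μ), neg_neg,
      (isPosDensity_gaussianMixture μ).setIntegral_Ioi, hxy,
      ← isPosDensity_stdGaussian.setIntegral_Ioi, setIntegral_Iic_stdGaussian_eq, neg_neg]
  have h := stdGaussian_le_mul_gaussianMixture_of_nonneg hμ' hr (neg_nonneg.2 hy) hneg
  rwa [stdGaussian_neg, gaussianMixture_map_neg, neg_neg] at h

end GaussianMixture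

section LogSobolev

open Set Filter Topology ProbabilityTheory

local notation "φ" => gaussianPDFReal 0 1

lemma SatisfiesLSI.mono {ν : Measure ℝ} {c c' : ℝ} (h : SatisfiesLSI ν c) (hcc : c ≤ c') :
    SatisfiesLSI ν c' := fun f hf hs =>
  (h f hf hs).trans (mul_le_mul_of_nonneg_right hcc (integral_nonneg fun _ => sq_nonneg _))

lemma SatisfiesLSI.map_affine {ν : Measure ℝ} {C : ℝ} (h : SatisfiesLSI ν C) (c : ℝ) {σ : ℝ}
    (hσ : σ ≠ 0) : SatisfiesLSI (ν.map fun x => c + σ * x) (σ ^ 2 * C) := by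
  intro f hf hs
  let e : ℝ ≃ₜ ℝ := (Homeomorph.mulLeft₀ σ hσ).trans (Homeomorph.addLeft c)
  have he : (fun x => c + σ * x) = e := rfl
  have hint : ∀ g : ℝ → ℝ, ∫ y, g y ∂(ν.map fun x => c + σ * x) = ∫ x, g (c + σ * x) ∂ν :=
    fun g => by
      rw [he]
      exact e.measurableEmbedding.integral_map g
  have h1 := h (fun x => f (c + σ * x)) (hf.comp (by fun_prop)) (hs.comp_homeomorph e)
  have hd : ∀ x, deriv (fun x => f (c + σ * x)) x = σ * deriv f (c + σ * x) := fun x => by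
    have hf' := (hf.differentiable (by simp) (c + σ * x)).hasDerivAt
    have := hf'.comp x (((hasDerivAt_id x).const_mul σ).const_add c)
    rw [mul_one, mul_comm] at this
    exact this.deriv
  simp only [hd, mul_pow, integral_const_mul] at h1
  simp only [Ent, hint] at h1 ⊢
  linarith

lemma IsPosDensity.integral_withDensity {p : ℝ → ℝ} (hp : IsPosDensity p) (g : ℝ → ℝ) :
    ∫ y, g y ∂(volume.withDensity fun y => ENNReal.ofReal (p y)) = ∫ y, g y * p y := by
  rw [integral_withDensity_eq_integral_toReal_smul hp.continuous.measurable.ennreal_ofReal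
    (by simp)]
  simp [ENNReal.toReal_ofReal (hp.pos _).le, mul_comm]

lemma Ent_withDensity_sq {p : ℝ → ℝ} (hp : IsPosDensity p) {f : ℝ → ℝ} (hf : Continuous f)
    (hs : HasCompactSupport f) (hZ : ∫ x, f x ^ 2 * p x ≠ 0) :
    Ent (volume.withDensity fun y => ENNReal.ofReal (p y)) (fun t => f t ^ 2)
      = (∫ x, f x ^ 2 * log (f x ^ 2) * p x)
        - (∫ x, f x ^ 2 * p x) * log (∫ x, f x ^ 2 * p x) := by
  have hs2 : HasCompactSupport fun x => f x ^ 2 := hs.comp_left (g := fun y => y ^ 2) (by simp)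
  have hpc := hp.continuous
  have hi1 : Integrable fun x => f x ^ 2 * p x :=
    ((hf.pow 2).mul hpc).integrable_of_hasCompactSupport hs2.mul_right
  have hi2 : Integrable fun x => f x ^ 2 * log (f x ^ 2) * p x :=
    ((continuous_mul_log.comp (hf.pow 2)).mul hpc).integrable_of_hasCompactSupport
      hs2.mul_right.mul_right
  simp only [Ent, hp.integral_withDensity]
  rw [mul_comm (∫ x, f x ^ 2 * p x), ← integral_const_mul, ← integral_sub hi2 (hi1.const_mul _)]
  congr 1 with x
  rcases eq_or_ne (f x ^ 2) 0 with h0 | h0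
  · simp [h0]
  · rw [log_div h0 hZ]
    ring

/-- A measure whose density is the Lipschitz image of the standard Gaussian satisfies a logarithmic
Sobolev inequality. -/
lemma satisfiesLSI_of_density_comparison {p : ℝ → ℝ} (hp : IsPosDensity p) {L : ℝ}
    (hL : ∀ x y, ∫ t in Iic y, p t = ∫ t in Iic x, φ t → φ x ≤ L * p y) :
    SatisfiesLSI (volume.withDensity fun y => ENNReal.ofReal (p y)) (2 * L ^ 2) := by
  have hφ := isPosDensity_stdGaussian
  obtain ⟨T, hTmono, hTsurj, hT', hTcdf⟩ := hφ.exists_transport hp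
  have hTc : Continuous T := continuous_iff_continuousAt.2 fun x => (hT' x).continuousAt
  have hcov := hφ.integral_comp_transport hp hTmono hTsurj hT'
  obtain ⟨e, rfl⟩ : ∃ e : ℝ ≃ₜ ℝ, T = e :=
    ⟨(hTmono.orderIsoOfSurjective T hTsurj).toHomeomorph, rfl⟩
  have hpc := hp.continuous
  intro f hf hs
  have hfc := hf.continuous
  have hf'c : Continuous (deriv f) := hf.continuous_deriv (by simp)
  have hfd : Differentiable ℝ f := hf.differentiable (by simp)
  rcases eq_or_ne (∫ x, f x ^ 2 * p x) 0 with hZ | hZ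
  · simp only [Ent, hp.integral_withDensity, hZ, div_zero, log_zero, mul_zero, zero_mul,
      integral_zero]
    exact mul_nonneg (by positivity)
      (integral_nonneg fun _ => mul_nonneg (sq_nonneg _) (hp.pos _).le)
  rw [Ent_withDensity_sq hp hfc hs hZ, hp.integral_withDensity]
  have hFd : ∀ x, HasDerivAt (fun x => f (e x)) (deriv f (e x) * (φ x / p (e x))) x := fun x =>
    HasDerivAt.comp x (hfd (e x)).hasDerivAt (hT' x)
  have hFderiv : deriv (fun x => f (e x)) = fun x => deriv f (e x) * (φ x / p (e x)) :=
    funext fun x => (hFd x).deriv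
  have hF'c : Continuous (deriv fun x => f (e x)) := by
    rw [hFderiv]
    exact (hf'c.comp hTc).mul
      (continuous_stdGaussian.div (hpc.comp hTc) fun x => (hp.pos _).ne')
  have hF : ContDiff ℝ 1 fun x => f (e x) :=
    contDiff_one_iff_deriv.2 ⟨fun x => (hFd x).differentiableAt, hF'c⟩
  have hFs : HasCompactSupport fun x => f (e x) := hs.comp_homeomorph e
  have hf's : HasCompactSupport fun x => deriv f (e x) ^ 2 :=
    HasCompactSupport.comp_left (g := fun y : ℝ => y ^ 2) (hs.deriv.comp_homeomorph e) (by simp)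
  have hF's : HasCompactSupport fun x => deriv (fun x => f (e x)) x ^ 2 :=
    HasCompactSupport.comp_left (g := fun y : ℝ => y ^ 2) hFs.deriv (by simp)
  have hi1 := integrable_mul_stdGaussian (hF'c.pow 2) hF's
  have hi2 := (integrable_mul_stdGaussian ((hf'c.comp hTc).pow 2) hf's).const_mul (L ^ 2)
  have hle : ∀ x, deriv (fun x => f (e x)) x ^ 2 * φ x ≤ L ^ 2 * (deriv f (e x) ^ 2 * φ x) := by
    intro x
    have hTx : φ x / p (e x) ≤ L := (div_le_iff₀ (hp.pos _)).2 (hL x (e x) (hTcdf x))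
    have hTx0 : 0 ≤ φ x / p (e x) := div_nonneg (stdGaussian_pos x).le (hp.pos _).le
    rw [hFderiv, ← mul_assoc, mul_pow, mul_comm (L ^ 2)]
    exact mul_le_mul_of_nonneg_right (mul_le_mul_of_nonneg_left (pow_le_pow_left₀ hTx0 hTx 2)
      (sq_nonneg _)) (stdGaussian_pos x).le
  have hlsi := gaussian_logSobolev hF hFs
  rw [hcov fun y => f y ^ 2 * log (f y ^ 2), hcov fun y => f y ^ 2] at hlsi
  refine hlsi.trans ?_
  rw [mul_assoc, ← hcov fun y => deriv f y ^ 2, ← integral_const_mul (L ^ 2)]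
  exact mul_le_mul_of_nonneg_left (integral_mono hi1 hi2 hle) two_pos.le

lemma satisfiesLSI_mconv_gaussianReal (μ : Measure ℝ) [IsProbabilityMeasure μ] {r : ℝ} (hr : 0 ≤ r)
    (hμ : ∀ᵐ s ∂μ, s ∈ Icc (-r) r) :
    SatisfiesLSI (mconv μ (gaussianReal 0 1)) (18 * (2 * r + 1) ^ 2 * exp (r ^ 2)) := by
  have h := satisfiesLSI_of_density_comparison (isPosDensity_gaussianMixture μ)
    fun x y hxy => stdGaussian_le_mul_gaussianMixture hμ hr hxy
  rw [mconv_gaussianReal_eq_withDensity]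
  convert h using 1
  have he : exp (r ^ 2) = exp (r ^ 2 / 2) ^ 2 := by
    rw [← exp_nat_mul]
    ring_nf
  rw [he]
  ring

lemma gaussianMeasure_eq_map {δ : ℝ} (hδ : 0 < δ) :
    gaussianMeasure δ = (gaussianReal 0 1).map fun t => √δ * t := by
  rw [gaussianReal_map_const_mul, gaussianReal_of_var_ne_zero]
  · rw [gaussianMeasure]
    congr 1
    funext t
    rw [gaussianPDF, gaussianPDFReal]
    congr 1
    simp [sq_sqrt hδ.le]
  · simpa [← NNReal.coe_ne_zero] using (sqrt_pos.2 hδ).ne'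

lemma mconv_gaussianMeasure_eq_map (μ : Measure ℝ) [IsProbabilityMeasure μ] (c : ℝ) {δ : ℝ}
    (hδ : 0 < δ) : mconv μ (gaussianMeasure δ)
      = (mconv (μ.map fun s => (s - c) / √δ) (gaussianReal 0 1)).map fun x => c + √δ * x := by
  have hσ : √δ ≠ 0 := (sqrt_pos.2 hδ).ne'
  rw [mconv, mconv, gaussianMeasure_eq_map hδ, Measure.map_map (by fun_prop) (by fun_prop)]
  have h1 := Measure.map_prod_map μ (gaussianReal 0 1) (f := id) (g := fun t => √δ * t)
    measurable_id (by fun_prop)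
  have h2 := Measure.map_prod_map μ (gaussianReal 0 1) (f := fun s => (s - c) / √δ) (g := id)
    (by fun_prop) measurable_id
  rw [Measure.map_id] at h1 h2
  rw [h1, h2, Measure.map_map (by fun_prop) (by fun_prop),
    Measure.map_map (by fun_prop) (by fun_prop)]
  congr 1
  funext x
  simp only [Function.comp_apply, Prod.map_fst, Prod.map_snd, id]
  field_simp
  ring

lemma lsi_constant_le {r : ℝ} (hr : 0 < r) :
    18 * (2 * r + 1) ^ 2 * exp (r ^ 2)
      ≤ 6905 * (r / (4 * r ^ 2 + 1)) * exp (2 * r ^ 2) + 4989 * (2 * r + 1) ^ 2 := by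
  have he : exp (2 * r ^ 2) = exp (r ^ 2) * exp (r ^ 2) := by
    rw [← exp_add]
    ring_nf
  have hE := exp_pos (r ^ 2)
  rcases le_or_gt (exp (r ^ 2)) 277 with h | h
  · have h1 : 0 ≤ 6905 * (r / (4 * r ^ 2 + 1)) * exp (2 * r ^ 2) := by positivity
    nlinarith [sq_nonneg (2 * r + 1)]
  · have hr1 : 1 ≤ r := by
      by_contra! hr1
      have h1 : exp (r ^ 2) ≤ exp 1 := exp_le_exp.2 (by nlinarith)
      linarith [exp_one_lt_d9]
    have hq := quadratic_le_exp_of_nonneg (sq_nonneg r)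
    have h2 : 18 * (2 * r + 1) ^ 2 * (4 * r ^ 2 + 1) ≤ 6905 * r * exp (r ^ 2) := by
      have h3 : (2 * r + 1) ^ 2 ≤ 9 * r ^ 2 := by nlinarith
      have h4 : 4 * r ^ 2 + 1 ≤ 5 * r ^ 2 := by nlinarith
      have h5 : r ^ 4 / 2 ≤ exp (r ^ 2) := by nlinarith [sq_nonneg r]
      calc 18 * (2 * r + 1) ^ 2 * (4 * r ^ 2 + 1) ≤ 18 * (9 * r ^ 2) * (5 * r ^ 2) := by gcongr
        _ = 810 * (1 * r ^ 4) := by ring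
        _ ≤ 810 * (r * r ^ 4) := by gcongr
        _ ≤ 6905 * (r * (r ^ 4 / 2)) := by nlinarith [pow_pos hr 5]
        _ ≤ 6905 * (r * exp (r ^ 2)) := by gcongr
        _ = _ := by ring
    have h6 : 18 * (2 * r + 1) ^ 2 ≤ 6905 * (r / (4 * r ^ 2 + 1)) * exp (r ^ 2) := by
      rw [show 6905 * (r / (4 * r ^ 2 + 1)) * exp (r ^ 2)
        = 6905 * r * exp (r ^ 2) / (4 * r ^ 2 + 1) by ring, le_div_iff₀ (by positivity)]
      exact h2
    have h7 := mul_le_mul_of_nonneg_right h6 hE.le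
    rw [he]
    nlinarith [sq_nonneg (2 * r + 1)]

end LogSobolev

theorem stmt0 (R δ : ℝ) (hR : 0 < R) (hδ : 0 < δ)
    (μ : Measure ℝ) [IsProbabilityMeasure μ]
    (hsupp : ∃ a : ℝ, μ (Set.Icc a (a + 2 * R))ᶜ = 0) :
    SatisfiesLSI (mconv μ (gaussianMeasure δ))
      (6905 * (δ ^ ((3 : ℝ) / 2) * R / (4 * R ^ 2 + δ)) * Real.exp (2 * R ^ 2 / δ)
        + 4989 * (Real.sqrt δ + 2 * R) ^ 2) := by
  obtain ⟨a, ha⟩ := hsupp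
  set σ := √δ with hσ_def
  have hσ : 0 < σ := sqrt_pos.2 hδ
  have hδσ : δ = σ ^ 2 := (sq_sqrt hδ.le).symm
  have hr : 0 < R / σ := div_pos hR hσ
  have hprob : IsProbabilityMeasure (μ.map fun s => (s - (a + R)) / σ) :=
    Measure.isProbabilityMeasure_map (by fun_prop)
  have hμ : ∀ᵐ s ∂(μ.map fun s => (s - (a + R)) / σ), s ∈ Set.Icc (-(R / σ)) (R / σ) := by
    refine (ae_map_iff (f := fun s => (s - (a + R)) / σ)
      (p := fun s => s ∈ Set.Icc (-(R / σ)) (R / σ)) (by fun_prop) measurableSet_Icc).2 ?_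
    have ha' : ∀ᵐ s ∂μ, s ∈ Set.Icc a (a + 2 * R) := ha
    filter_upwards [ha'] with s hs
    rw [← neg_div]
    exact ⟨div_le_div_of_nonneg_right (by linarith [hs.1]) hσ.le,
      div_le_div_of_nonneg_right (by linarith [hs.2]) hσ.le⟩
  rw [mconv_gaussianMeasure_eq_map μ (a + R) hδ]
  refine ((satisfiesLSI_mconv_gaussianReal _ hr.le hμ).map_affine (a + R) hσ.ne').mono ?_
  refine (mul_le_mul_of_nonneg_left (lsi_constant_le hr) (sq_nonneg σ)).trans_eq ?_
  have hpow : δ ^ ((3 : ℝ) / 2) = σ ^ 3 := by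
    rw [hσ_def, sqrt_eq_rpow, ← rpow_natCast, ← rpow_mul hδ.le]
    norm_num
  rw [hpow, hδσ, show 2 * R ^ 2 / σ ^ 2 = 2 * (R / σ) ^ 2 by ring]
  have h1 : R / σ / (4 * (R / σ) ^ 2 + 1) * σ ^ 2 = σ ^ 3 * R / (4 * R ^ 2 + σ ^ 2) := by
    field_simp
  have h2 : σ * (2 * (R / σ) + 1) = σ + 2 * R := by
    field_simp
    ring
  rw [← h1, ← h2]
  ring
end

section
/- Let R > 0 and let μ be a probability measure on ℝ whose support is contained in an interval of length 2R, and let 0 < δ ≤ R². Then the convolution μ_δ = μ * γ_δ satisfies a logarithmic Sobolev inequality with constant c(δ) ≤ 7803 · (δ^{3/2}/R) · exp(2R²/δ). -/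
open MeasureTheory Real

/-- The density of the centered Gaussian measure of variance `δ`. -/
noncomputable def gaussDensity (δ y : ℝ) : ℝ :=
  (Real.sqrt (2 * π * δ))⁻¹ * Real.exp (-(y ^ 2) / (2 * δ))

/-- The Gaussian expectation of `F`, as a Lebesgue integral. -/
noncomputable def gaussIntegral (δ : ℝ) (F : ℝ → ℝ) : ℝ :=
  ∫ y, F y * gaussDensity δ y

/-- Continuous functions of at most polynomial growth. -/
def PolyGrowth (F : ℝ → ℝ) : Prop :=
  Continuous F ∧ ∃ (K : ℝ) (n : ℕ), ∀ y, |F y| ≤ K * (1 + y ^ 2) ^ n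

namespace PolyGrowth

variable {F G : ℝ → ℝ}

theorem exists_bound (hF : PolyGrowth F) :
    ∃ (K : ℝ) (n : ℕ), 0 ≤ K ∧ ∀ y, |F y| ≤ K * (1 + y ^ 2) ^ n := by
  obtain ⟨_, K, n, h⟩ := hF
  have h0 := (abs_nonneg _).trans (h 0)
  exact ⟨K, n, by simpa using h0, h⟩

theorem of_bounded (hF : Continuous F) {B : ℝ} (h : ∀ y, |F y| ≤ B) : PolyGrowth F :=
  ⟨hF, B, 0, by simpa using h⟩

theorem const (a : ℝ) : PolyGrowth fun _ => a :=
  of_bounded continuous_const fun _ => le_refl |a|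

theorem id : PolyGrowth fun y => y :=
  ⟨continuous_id, 1, 1, fun y => by
    rw [abs_le]; constructor <;> nlinarith [sq_nonneg (y - 1), sq_nonneg (y + 1)]⟩

theorem add (hF : PolyGrowth F) (hG : PolyGrowth G) : PolyGrowth fun y => F y + G y := by
  obtain ⟨K, n, hK, h⟩ := hF.exists_bound
  obtain ⟨L, m, hL, h'⟩ := hG.exists_bound
  refine ⟨hF.1.add hG.1, K + L, n + m, fun y => ?_⟩
  have hy : 1 ≤ 1 + y ^ 2 := by nlinarith [sq_nonneg y]
  calc |F y + G y| ≤ |F y| + |G y| := abs_add_le _ _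
    _ ≤ K * (1 + y ^ 2) ^ n + L * (1 + y ^ 2) ^ m := add_le_add (h y) (h' y)
    _ ≤ K * (1 + y ^ 2) ^ (n + m) + L * (1 + y ^ 2) ^ (n + m) := by
        gcongr <;> first | exact hy | omega
    _ = _ := by ring

theorem mul (hF : PolyGrowth F) (hG : PolyGrowth G) : PolyGrowth fun y => F y * G y := by
  obtain ⟨K, n, hK, h⟩ := hF.exists_bound
  obtain ⟨L, m, hL, h'⟩ := hG.exists_bound
  refine ⟨hF.1.mul hG.1, K * L, n + m, fun y => ?_⟩
  rw [abs_mul, pow_add, mul_mul_mul_comm]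
  exact mul_le_mul (h y) (h' y) (abs_nonneg _) (by positivity)

theorem neg (hF : PolyGrowth F) : PolyGrowth fun y => -F y := by
  simpa using (const (-1)).mul hF

theorem sub (hF : PolyGrowth F) (hG : PolyGrowth G) : PolyGrowth fun y => F y - G y := by
  simpa [sub_eq_add_neg] using hF.add hG.neg

theorem sq (hF : PolyGrowth F) : PolyGrowth fun y => F y ^ 2 := by
  simpa [pow_two] using hF.mul hF

theorem div_const (hF : PolyGrowth F) (a : ℝ) : PolyGrowth fun y => F y / a := by
  simpa [div_eq_mul_inv] using hF.mul (const a⁻¹)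

theorem abs (hF : PolyGrowth F) : PolyGrowth fun y => |F y| := by
  obtain ⟨hc, K, n, h⟩ := hF
  exact ⟨hc.abs, K, n, by simpa using h⟩

theorem comp_neg (hF : PolyGrowth F) : PolyGrowth fun y => F (-y) := by
  obtain ⟨hc, K, n, h⟩ := hF
  exact ⟨hc.comp continuous_neg, K, n, fun y => by simpa using h (-y)⟩

end PolyGrowth

section Gaussian

variable {δ : ℝ} {F G F' h h' : ℝ → ℝ}

theorem gaussDensity_nonneg (δ y : ℝ) : 0 ≤ gaussDensity δ y := by
  unfold gaussDensity; positivity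

theorem continuous_gaussDensity (δ : ℝ) : Continuous (gaussDensity δ) := by
  unfold gaussDensity; fun_prop

theorem hasDerivAt_gaussDensity (hδ : 0 < δ) (y : ℝ) :
    HasDerivAt (gaussDensity δ) (-(y / δ) * gaussDensity δ y) y := by
  have h1 : HasDerivAt (fun y : ℝ => -(y ^ 2) / (2 * δ)) (-(2 * y) / (2 * δ)) y := by
    simpa using ((hasDerivAt_pow 2 y).neg).div_const (2 * δ)
  convert! (h1.exp).const_mul (Real.sqrt (2 * π * δ))⁻¹ using 1
  unfold gaussDensity
  field_simp

theorem PolyGrowth.integrable (hF : PolyGrowth F) (hδ : 0 < δ) :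
    Integrable fun y => F y * gaussDensity δ y := by
  obtain ⟨K, n, hK, h⟩ := hF.exists_bound
  have hi : Integrable fun y : ℝ => (K * ((4 * δ) ^ n * n.factorial * Real.exp (1 / (4 * δ))) *
      (Real.sqrt (2 * π * δ))⁻¹) * Real.exp (-(1 / (4 * δ)) * y ^ 2) :=
    (integrable_exp_neg_mul_sq (by positivity)).const_mul _
  refine hi.mono' (hF.1.mul (continuous_gaussDensity δ)).aestronglyMeasurable
    (Filter.Eventually.of_forall fun y => ?_)
  have h1 := Real.pow_div_factorial_le_exp (x := (1 + y ^ 2) / (4 * δ)) (by positivity) n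
  have h2 : (1 + y ^ 2) ^ n ≤
      (4 * δ) ^ n * n.factorial * Real.exp ((1 + y ^ 2) / (4 * δ)) := by
    rw [div_pow, div_div, div_le_iff₀ (by positivity)] at h1
    linarith
  have h3 : Real.exp ((1 + y ^ 2) / (4 * δ)) * Real.exp (-(y ^ 2) / (2 * δ)) =
      Real.exp (1 / (4 * δ)) * Real.exp (-(1 / (4 * δ)) * y ^ 2) := by
    rw [← Real.exp_add, ← Real.exp_add]; congr 1; field_simp; ring
  rw [Real.norm_eq_abs, abs_mul, abs_of_nonneg (gaussDensity_nonneg δ y), gaussDensity]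
  calc |F y| * ((Real.sqrt (2 * π * δ))⁻¹ * Real.exp (-(y ^ 2) / (2 * δ)))
      ≤ (K * ((4 * δ) ^ n * n.factorial * Real.exp ((1 + y ^ 2) / (4 * δ)))) *
        ((Real.sqrt (2 * π * δ))⁻¹ * Real.exp (-(y ^ 2) / (2 * δ))) := by
        gcongr
        exact (h y).trans (by gcongr)
    _ = K * ((4 * δ) ^ n * n.factorial) * (Real.sqrt (2 * π * δ))⁻¹ *
        (Real.exp ((1 + y ^ 2) / (4 * δ)) * Real.exp (-(y ^ 2) / (2 * δ))) := by ring
    _ = _ := by rw [h3]; ring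

theorem gaussIntegral_add (hδ : 0 < δ) (hF : PolyGrowth F) (hG : PolyGrowth G) :
    gaussIntegral δ (fun y => F y + G y) = gaussIntegral δ F + gaussIntegral δ G := by
  unfold gaussIntegral
  rw [← integral_add (hF.integrable hδ) (hG.integrable hδ)]
  simp_rw [add_mul]

theorem gaussIntegral_const_mul (a : ℝ) :
    gaussIntegral δ (fun y => a * F y) = a * gaussIntegral δ F := by
  unfold gaussIntegral
  rw [← integral_const_mul]
  simp_rw [mul_assoc]

theorem gaussIntegral_mono (hδ : 0 < δ) (hF : PolyGrowth F) (hG : PolyGrowth G)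
    (h : ∀ y, F y ≤ G y) : gaussIntegral δ F ≤ gaussIntegral δ G :=
  integral_mono (hF.integrable hδ) (hG.integrable hδ) fun y =>
    mul_le_mul_of_nonneg_right (h y) (gaussDensity_nonneg δ y)

theorem gaussIntegral_nonneg (h : ∀ y, 0 ≤ F y) : 0 ≤ gaussIntegral δ F :=
  integral_nonneg fun y => mul_nonneg (h y) (gaussDensity_nonneg δ y)

theorem integral_gaussDensity (hδ : 0 < δ) : ∫ y, gaussDensity δ y = 1 := by
  have := ProbabilityTheory.integral_gaussianPDFReal_eq_one 0 (Real.toNNReal_pos.2 hδ).ne'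
  simpa [ProbabilityTheory.gaussianPDFReal, gaussDensity, Real.coe_toNNReal δ hδ.le] using this

theorem gaussIntegral_const (hδ : 0 < δ) (a : ℝ) : gaussIntegral δ (fun _ => a) = a := by
  unfold gaussIntegral
  rw [integral_const_mul, integral_gaussDensity hδ, mul_one]

theorem hasDerivAt_mul_gaussDensity (hδ : 0 < δ) {y : ℝ} (hF : HasDerivAt F (F' y) y) :
    HasDerivAt (fun y => F y * gaussDensity δ y)
      ((F' y - F y * (y / δ)) * gaussDensity δ y) y := by
  convert! hF.mul (hasDerivAt_gaussDensity hδ y) using 1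
  ring

theorem PolyGrowth.stein (hF : PolyGrowth F) (hF' : PolyGrowth F') :
    PolyGrowth fun y => F' y - F y * (y / δ) :=
  hF'.sub (hF.mul (PolyGrowth.id.div_const δ))

theorem gaussIntegral_stein (hδ : 0 < δ) (hF : PolyGrowth F) (hF' : PolyGrowth F')
    (hd : ∀ y, HasDerivAt F (F' y) y) :
    gaussIntegral δ (fun y => F' y - F y * (y / δ)) = 0 :=
  integral_eq_zero_of_hasDerivAt_of_integrable
    (fun y => hasDerivAt_mul_gaussDensity hδ (hd y)) ((hF.stein hF').integrable hδ)
    (hF.integrable hδ)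

theorem mul_gaussDensity_le (hδ : 0 < δ) (hF : PolyGrowth F) (hF' : PolyGrowth F')
    (hG : PolyGrowth G) (hd : ∀ y, HasDerivAt F (F' y) y) (hG0 : ∀ y, 0 ≤ G y)
    (hle : ∀ y, F' y - F y * (y / δ) ≤ G y) (x : ℝ) :
    F x * gaussDensity δ x ≤ gaussIntegral δ G := by
  have hi := (hF.stein (δ := δ) hF').integrable hδ
  have hD := fun y => hasDerivAt_mul_gaussDensity hδ (hd y)
  have h1 := integral_Iic_of_hasDerivAt_of_tendsto (a := x)
    (hD x).continuousAt.continuousWithinAt (fun y _ => hD y) hi.integrableOn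
    (tendsto_zero_of_hasDerivAt_of_integrableOn_Iic (a := x) (fun y _ => hD y)
      hi.integrableOn (hF.integrable hδ).integrableOn)
  rw [sub_zero] at h1
  rw [← h1]
  calc _ ≤ ∫ y in Set.Iic x, G y * gaussDensity δ y :=
        integral_mono hi.integrableOn (hG.integrable hδ).integrableOn fun y =>
          mul_le_mul_of_nonneg_right (hle y) (gaussDensity_nonneg δ y)
    _ ≤ _ := setIntegral_le_integral (hG.integrable hδ) (Filter.Eventually.of_forall fun y =>
        mul_nonneg (hG0 y) (gaussDensity_nonneg δ y))

theorem hasDerivAt_sq {y : ℝ} (hd : HasDerivAt h (h' y) y) :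
    HasDerivAt (fun y => h y ^ 2) (2 * h y * h' y) y := by
  convert! hd.pow 2 using 1
  norm_num

theorem gaussIntegral_sq_mul_le (hδ : 0 < δ) (hh : PolyGrowth h) (hh' : PolyGrowth h')
    (hd : ∀ y, HasDerivAt h (h' y) y) {R d : ℝ} (hdR : |d| ≤ R) :
    gaussIntegral δ (fun y => h y ^ 2 * (|y + d| + R) ^ 2) ≤
      (6 * R ^ 2 + 8 * δ) * gaussIntegral δ (fun y => h y ^ 2) +
        32 * δ ^ 2 * gaussIntegral δ (fun y => h' y ^ 2) := by
  have hz : PolyGrowth fun y : ℝ => y + d := PolyGrowth.id.add (.const d)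
  have hF := hh.sq.mul hz
  have hF' : PolyGrowth fun y => 2 * h y * h' y * (y + d) + h y ^ 2 * 1 :=
    ((((PolyGrowth.const 2).mul hh).mul hh').mul hz).add (hh.sq.mul (.const 1))
  have hst := gaussIntegral_stein hδ hF hF'
    fun y => (hasDerivAt_sq (hd y)).mul ((hasDerivAt_id y).add_const d)
  have key := gaussIntegral_mono hδ
    ((hh.sq.mul ((hz.abs.add (.const R)).sq)).add ((PolyGrowth.const (8 * δ)).mul (hF.stein (δ := δ) hF')))
    (((PolyGrowth.const (6 * R ^ 2 + 8 * δ)).mul hh.sq).add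
      ((PolyGrowth.const (32 * δ ^ 2)).mul hh'.sq)) fun y => ?_
  · rw [gaussIntegral_add hδ (hh.sq.mul ((hz.abs.add (.const R)).sq))
      ((PolyGrowth.const (8 * δ)).mul (hF.stein hF')), gaussIntegral_const_mul, hst,
      gaussIntegral_add hδ ((PolyGrowth.const _).mul hh.sq) ((PolyGrowth.const _).mul hh'.sq),
      gaussIntegral_const_mul, gaussIntegral_const_mul] at key
    linarith
  · have hR2 : d ^ 2 ≤ R ^ 2 := sq_le_sq' (by linarith [neg_abs_le d]) (by linarith [le_abs_self d])
    have e : 8 * δ * (2 * h y * h' y * (y + d) + h y ^ 2 * 1 - h y ^ 2 * (y + d) * (y / δ)) =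
        16 * δ * (h y * h' y * (y + d)) + 8 * δ * h y ^ 2 - 8 * (h y ^ 2 * ((y + d) * y)) := by
      field_simp; ring
    have h1 : (|y + d| + R) ^ 2 ≤ 2 * (y + d) ^ 2 + 2 * R ^ 2 := by
      nlinarith [sq_nonneg (|y + d| - R), sq_abs (y + d)]
    have h2 : h y ^ 2 * (|y + d| + R) ^ 2 ≤ h y ^ 2 * (2 * (y + d) ^ 2 + 2 * R ^ 2) := by gcongr
    have h3 : h y ^ 2 * ((y + d) ^ 2 - R ^ 2) ≤ h y ^ 2 * (2 * ((y + d) * y)) := by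
      refine mul_le_mul_of_nonneg_left ?_ (sq_nonneg _)
      nlinarith [sq_nonneg (y + d - d)]
    have h4 : 16 * δ * (h y * h' y * (y + d)) ≤
        2 * (h y * (y + d)) ^ 2 + 32 * δ ^ 2 * h' y ^ 2 := by
      nlinarith [sq_nonneg (h y * (y + d) - 4 * δ * h' y)]
    rw [e]
    nlinarith

theorem sqrt_two_pi_mul_le (hδ : 0 < δ) : Real.sqrt (2 * π * δ) ≤ 3 * Real.sqrt δ := by
  rw [Real.sqrt_mul (by positivity)]
  gcongr
  rw [Real.sqrt_le_left (by norm_num)]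
  linarith [Real.pi_lt_four]

theorem sq_le_exp_mul_gaussIntegral (hδ : 0 < δ) (hh : PolyGrowth h) (hh' : PolyGrowth h')
    (hd : ∀ y, HasDerivAt h (h' y) y) {R d : ℝ} (hdR : |d| ≤ R) (x : ℝ) :
    h x ^ 2 ≤ Real.exp ((|x + d| + R) ^ 2 / (2 * δ)) *
      ((9 * (R ^ 2 / δ) + 33 / 2) * gaussIntegral δ (fun y => h y ^ 2) +
        51 * δ * gaussIntegral δ (fun y => h' y ^ 2)) := by
  have habs : ∀ y : ℝ, |y| ≤ |y + d| + R := fun y => by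
    have := abs_sub (y + d) d
    rw [add_sub_cancel_right] at this
    linarith
  have hF' : PolyGrowth fun y => 2 * h y * h' y := ((PolyGrowth.const 2).mul hh).mul hh'
  have hG : PolyGrowth fun y => |2 * h y * h' y| + h y ^ 2 * (|y| / δ) :=
    hF'.abs.add (hh.sq.mul (PolyGrowth.id.abs.div_const δ))
  have hG0 : ∀ y, 0 ≤ |2 * h y * h' y| + h y ^ 2 * (|y| / δ) := fun y => by positivity
  have h1 := mul_gaussDensity_le hδ hh.sq hF' hG (fun y => hasDerivAt_sq (hd y)) hG0
    (fun y => by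
      have a1 := le_abs_self (2 * h y * h' y)
      have a2 : h y ^ 2 * (-y / δ) ≤ h y ^ 2 * (|y| / δ) := by
        gcongr; exact neg_le_abs y
      have a3 : h y ^ 2 * (-y / δ) = - (h y ^ 2 * (y / δ)) := by ring
      linarith) x
  have hz : PolyGrowth fun y => h y ^ 2 * (|y + d| + R) ^ 2 :=
    hh.sq.mul (((PolyGrowth.id.add (.const d)).abs.add (.const R)).sq)
  set σ := Real.sqrt δ with hσ
  have hσ0 : 0 < σ := Real.sqrt_pos.2 hδ
  have hσ2 : σ ^ 2 = δ := Real.sq_sqrt hδ.le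
  have h2 := gaussIntegral_mono hδ ((PolyGrowth.const σ).mul hG)
    ((((PolyGrowth.const (3 / 2)).mul hh.sq).add ((PolyGrowth.const δ).mul hh'.sq)).add
      ((PolyGrowth.const (1 / (2 * δ))).mul hz)) fun y => by
    have a1 : σ * |2 * h y * h' y| ≤ h y ^ 2 + δ * h' y ^ 2 := by
      rw [abs_mul, abs_mul, abs_two, ← hσ2, ← sq_abs (h y), ← sq_abs (h' y)]
      nlinarith [sq_nonneg (|h y| - σ * |h' y|)]
    have a2 : σ * (|y| / δ) ≤ 1 / 2 + 1 / (2 * δ) * (|y + d| + R) ^ 2 := by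
      have : |y| ^ 2 ≤ (|y + d| + R) ^ 2 := by gcongr; exact habs y
      rw [← hσ2]
      have e : σ * (|y| / σ ^ 2) = 1 / (2 * σ ^ 2) * (2 * σ * |y|) := by field_simp
      have e2 : (1 : ℝ) / 2 = 1 / (2 * σ ^ 2) * σ ^ 2 := by field_simp
      rw [e, e2, ← mul_add]
      gcongr
      nlinarith [sq_nonneg (σ - |y|)]
    have a3 := mul_le_mul_of_nonneg_left a2 (sq_nonneg (h y))
    nlinarith
  rw [gaussIntegral_const_mul, gaussIntegral_add hδ
    (((PolyGrowth.const (3 / 2)).mul hh.sq).add ((PolyGrowth.const δ).mul hh'.sq))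
      ((PolyGrowth.const (1 / (2 * δ))).mul hz), gaussIntegral_add hδ
      ((PolyGrowth.const (3 / 2)).mul hh.sq) ((PolyGrowth.const δ).mul hh'.sq),
      gaussIntegral_const_mul, gaussIntegral_const_mul, gaussIntegral_const_mul] at h2
  have h3 := gaussIntegral_sq_mul_le hδ hh hh' hd hdR
  have hS := gaussIntegral_nonneg (δ := δ) hG0
  set v := gaussIntegral δ (fun y => h y ^ 2)
  set D := gaussIntegral δ (fun y => h' y ^ 2)
  set S := gaussIntegral δ (fun y => |2 * h y * h' y| + h y ^ 2 * (|y| / δ))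
  have hsq : 0 < Real.sqrt (2 * π * δ) := Real.sqrt_pos.2 (by positivity)
  have h4 : h x ^ 2 = Real.exp (x ^ 2 / (2 * δ)) *
      (Real.sqrt (2 * π * δ) * (h x ^ 2 * gaussDensity δ x)) := by
    unfold gaussDensity
    rw [neg_div, Real.exp_neg]
    field_simp
  have h5 : Real.sqrt (2 * π * δ) * (h x ^ 2 * gaussDensity δ x) ≤
      (9 * (R ^ 2 / δ) + 33 / 2) * v + 51 * δ * D := by
    calc _ ≤ 3 * σ * S := mul_le_mul (sqrt_two_pi_mul_le hδ) h1
          (mul_nonneg (sq_nonneg _) (gaussDensity_nonneg _ _)) (by positivity)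
      _ ≤ 3 * (3 / 2 * v + δ * D + 1 / (2 * δ) *
          ((6 * R ^ 2 + 8 * δ) * v + 32 * δ ^ 2 * D)) := by
          have := mul_le_mul_of_nonneg_left h3 (show 0 ≤ 1 / (2 * δ) by positivity)
          linarith
      _ = _ := by field_simp; ring
  have h6 : x ^ 2 ≤ (|x + d| + R) ^ 2 := by
    rw [← sq_abs x]; gcongr; exact habs x
  have h7 : 0 ≤ Real.sqrt (2 * π * δ) * (h x ^ 2 * gaussDensity δ x) :=
    mul_nonneg hsq.le (mul_nonneg (sq_nonneg _) (gaussDensity_nonneg _ _))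
  rw [h4]
  exact mul_le_mul (Real.exp_le_exp.2 (by gcongr)) h5 h7 (Real.exp_pos _).le

theorem setIntegral_sq_mul_gaussDensity_le (hδ : 0 < δ) (hh : PolyGrowth h)
    (hh' : PolyGrowth h') (hd : ∀ y, HasDerivAt h (h' y) y) (h0 : h 0 = 0) :
    ∫ y in Set.Ioi 0, h y ^ 2 * gaussDensity δ y ≤
      4 * δ * ∫ y in Set.Ioi 0, h' y ^ 2 * gaussDensity δ y := by
  set σ := Real.sqrt δ with hσ
  have hσ0 : 0 < σ := Real.sqrt_pos.2 hδ
  have hσ2 : σ ^ 2 = δ := Real.sq_sqrt hδ.le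
  have hpos : ∀ y : ℝ, 0 < |y| + σ := fun y => by positivity
  have hφ : PolyGrowth fun y : ℝ => (|y| + σ)⁻¹ := by
    refine .of_bounded (B := σ⁻¹)
      (Continuous.inv₀ (by fun_prop) fun y => (hpos y).ne') fun y => ?_
    rw [abs_of_pos (inv_pos.2 (hpos y))]
    gcongr
    linarith [abs_nonneg y]
  have hF : PolyGrowth fun y => h y ^ 2 * (|y| + σ)⁻¹ := hh.sq.mul hφ
  have hF' : PolyGrowth fun y => 2 * h y * h' y * (|y| + σ)⁻¹ + h y ^ 2 * (-((|y| + σ)⁻¹) ^ 2) :=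
    ((((PolyGrowth.const 2).mul hh).mul hh').mul hφ).add (hh.sq.mul hφ.sq.neg)
  have hD : ∀ y ∈ Set.Ioi (0 : ℝ), HasDerivAt (fun y => h y ^ 2 * (|y| + σ)⁻¹)
      (2 * h y * h' y * (|y| + σ)⁻¹ + h y ^ 2 * (-((|y| + σ)⁻¹) ^ 2)) y := fun y hy => by
    have e : HasDerivAt (fun y : ℝ => |y| + σ) 1 y := (hasDerivAt_abs_pos hy).add_const σ
    convert! (hasDerivAt_sq (hd y)).mul (e.inv (hpos y).ne') using 1
    simp only [Pi.inv_apply]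
    field_simp
  have hi := (hF.stein (δ := δ) hF').integrable hδ
  have hD' := fun y (hy : y ∈ Set.Ioi (0 : ℝ)) =>
    hasDerivAt_mul_gaussDensity (F' := fun y => 2 * h y * h' y * (|y| + σ)⁻¹ +
      h y ^ 2 * (-((|y| + σ)⁻¹) ^ 2)) hδ (hD y hy)
  have h1 := integral_Ioi_of_hasDerivAt_of_tendsto (a := 0)
    (hF.1.mul (continuous_gaussDensity δ)).continuousWithinAt hD' hi.integrableOn
    (tendsto_zero_of_hasDerivAt_of_integrableOn_Ioi (a := 0) hD'
      hi.integrableOn (hF.integrable hδ).integrableOn)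
  simp only [Pi.mul_apply, h0, zero_pow two_ne_zero, zero_mul, sub_zero] at h1
  have i1 := (hh.sq.integrable hδ).integrableOn (s := Set.Ioi 0)
  have i2 := (hh'.sq.integrable hδ).integrableOn (s := Set.Ioi 0)
  rw [← integral_const_mul]
  have key : ∫ y in Set.Ioi 0, (h y ^ 2 * gaussDensity δ y + 2 * δ *
      ((2 * h y * h' y * (|y| + σ)⁻¹ + h y ^ 2 * (-((|y| + σ)⁻¹) ^ 2) -
        h y ^ 2 * (|y| + σ)⁻¹ * (y / δ)) * gaussDensity δ y)) ≤
      ∫ y in Set.Ioi 0, 4 * δ * (h' y ^ 2 * gaussDensity δ y) := by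
    refine setIntegral_mono_on (i1.add (hi.integrableOn.const_mul _)) (i2.const_mul _)
      measurableSet_Ioi fun y hy => ?_
    have hy : 0 < y := hy
    rw [abs_of_pos hy]
    have hp : 0 < y + σ := by positivity
    have a1 : h y ^ 2 + 2 * δ * (2 * h y * h' y * (y + σ)⁻¹ + h y ^ 2 * (-((y + σ)⁻¹) ^ 2) -
        h y ^ 2 * (y + σ)⁻¹ * (y / δ)) ≤ 4 * δ * h' y ^ 2 := by
      set τ := σ / (y + σ) with hτ
      have e1 : (y + σ)⁻¹ = τ / σ := by rw [hτ]; field_simp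
      have e2 : (y + σ)⁻¹ * (y / δ) = (1 - τ) / δ := by rw [hτ]; field_simp; ring
      rw [mul_assoc (h y ^ 2), e2, e1]
      have e3 : 2 * δ * (2 * h y * h' y * (τ / σ) + h y ^ 2 * -(τ / σ) ^ 2 -
          h y ^ 2 * ((1 - τ) / δ)) =
          4 * (h y * τ) * (σ * h' y) - 2 * (h y * τ) ^ 2 - 2 * h y ^ 2 * (1 - τ) := by
        rw [← hσ2]; field_simp; ring
      rw [e3, ← hσ2]
      nlinarith [sq_nonneg (2 * (σ * h' y) - h y * τ), sq_nonneg (h y * (1 - τ))]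
    nlinarith [mul_le_mul_of_nonneg_right a1 (gaussDensity_nonneg δ y)]
  rw [integral_add i1 (hi.integrableOn.const_mul _), integral_const_mul] at key
  rw [h1] at key
  linarith

theorem gaussIntegral_sq_le (hδ : 0 < δ) (hh : PolyGrowth h) (hh' : PolyGrowth h')
    (hd : ∀ y, HasDerivAt h (h' y) y) (h0 : h 0 = 0) :
    gaussIntegral δ (fun y => h y ^ 2) ≤ 4 * δ * gaussIntegral δ (fun y => h' y ^ 2) := by
  have hg : ∀ y, gaussDensity δ (-y) = gaussDensity δ y := by simp [gaussDensity]
  have split : ∀ {k : ℝ → ℝ}, PolyGrowth k → gaussIntegral δ (fun y => k y ^ 2) =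
      (∫ y in Set.Ioi 0, k (-y) ^ 2 * gaussDensity δ y) +
        ∫ y in Set.Ioi 0, k y ^ 2 * gaussDensity δ y := fun {k} hk => by
    have := integral_comp_neg_Ioi 0 (fun y => k y ^ 2 * gaussDensity δ y)
    simp only [hg, neg_zero] at this
    rw [this, intervalIntegral.integral_Iic_add_Ioi (hk.sq.integrable hδ).integrableOn
      (hk.sq.integrable hδ).integrableOn]
    rfl
  have h1 := setIntegral_sq_mul_gaussDensity_le hδ hh hh' hd h0
  have h2 := setIntegral_sq_mul_gaussDensity_le hδ hh.comp_neg hh'.comp_neg.neg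
    (fun y => by convert! (hd (-y)).comp y (hasDerivAt_neg y) using 1; ring) (by simpa using h0)
  simp only [neg_sq] at h2
  rw [split hh, split hh']
  linarith

theorem sq_sub_le_gaussIntegral (hδ : 0 < δ) (hh' : PolyGrowth h')
    (hd : ∀ y, HasDerivAt h (h' y) y) {R a b : ℝ} (hab : a ≤ b) (hba : b - a ≤ R)
    (ha : |a| ≤ R) (hb : |b| ≤ R) :
    (h b - h a) ^ 2 ≤ 3 * R * Real.sqrt δ * Real.exp (R ^ 2 / (2 * δ)) *
      gaussIntegral δ (fun y => h' y ^ 2) := by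
  have hR : 0 ≤ R := (abs_nonneg a).trans ha
  have hD : 0 ≤ gaussIntegral δ (fun y => h' y ^ 2) := gaussIntegral_nonneg fun y => sq_nonneg _
  rcases hab.eq_or_lt with rfl | hlt
  · rw [sub_self, zero_pow two_ne_zero]; positivity
  set m := (h b - h a) / (b - a) with hm
  have hba0 : 0 < b - a := sub_pos.2 hlt
  have hmv : h b - h a = m * (b - a) := by rw [hm]; field_simp
  have hint : ∫ y in a..b, h' y = h b - h a :=
    intervalIntegral.integral_eq_sub_of_hasDerivAt (fun y _ => hd y)
      (hh'.1.intervalIntegrable a b)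
  set C := Real.sqrt (2 * π * δ) * Real.exp (R ^ 2 / (2 * δ)) with hC
  have hC0 : 0 < C := by rw [hC]; positivity
  have h1 : ∫ y in a..b, (2 * m * h' y - m ^ 2) ≤
      ∫ y in a..b, C * (h' y ^ 2 * gaussDensity δ y) := by
    refine intervalIntegral.integral_mono_on hab
      (((hh'.1.const_mul _).sub continuous_const).intervalIntegrable _ _)
      ((((hh'.1.pow 2).mul (continuous_gaussDensity δ)).const_mul _).intervalIntegrable _ _)
      fun y hy => ?_
    have hyR : y ^ 2 ≤ R ^ 2 := by
      rw [abs_le] at ha hb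
      exact sq_le_sq' (by linarith [hy.1]) (by linarith [hy.2])
    have hCg : 1 ≤ C * gaussDensity δ y := by
      have hsq : 0 < Real.sqrt (2 * π * δ) := Real.sqrt_pos.2 (by positivity)
      have : C * gaussDensity δ y = Real.exp (R ^ 2 / (2 * δ) + -(y ^ 2) / (2 * δ)) := by
        rw [hC, gaussDensity, Real.exp_add]; field_simp
      rw [this, Real.one_le_exp_iff, ← add_div]
      exact div_nonneg (by linarith) (by positivity)
    nlinarith [sq_nonneg (h' y - m), mul_le_mul_of_nonneg_left hCg (sq_nonneg (h' y))]
  rw [intervalIntegral.integral_sub ((hh'.1.const_mul _).intervalIntegrable _ _)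
    intervalIntegrable_const, intervalIntegral.integral_const_mul, hint,
    intervalIntegral.integral_const, smul_eq_mul, hmv, intervalIntegral.integral_const_mul] at h1
  have h2 : ∫ y in a..b, h' y ^ 2 * gaussDensity δ y ≤ gaussIntegral δ (fun y => h' y ^ 2) := by
    rw [intervalIntegral.integral_of_le hab]
    exact setIntegral_le_integral (hh'.sq.integrable hδ) (Filter.Eventually.of_forall fun y =>
      mul_nonneg (sq_nonneg _) (gaussDensity_nonneg δ y))
  have h3 : C ≤ 3 * Real.sqrt δ * Real.exp (R ^ 2 / (2 * δ)) := by
    rw [hC]; gcongr; exact sqrt_two_pi_mul_le hδ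
  calc (h b - h a) ^ 2 = (b - a) * (m ^ 2 * (b - a)) := by rw [hmv]; ring
    _ ≤ R * ((3 * Real.sqrt δ * Real.exp (R ^ 2 / (2 * δ))) *
        gaussIntegral δ (fun y => h' y ^ 2)) := by
        refine mul_le_mul hba ?_ (by positivity) hR
        calc m ^ 2 * (b - a) ≤ C * ∫ y in a..b, h' y ^ 2 * gaussDensity δ y := by linarith
          _ ≤ C * gaussIntegral δ (fun y => h' y ^ 2) := by gcongr
          _ ≤ _ := by gcongr
    _ = _ := by ring

theorem gaussIntegral_sq_sub_le (hδ : 0 < δ) (hh : PolyGrowth h) (hh' : PolyGrowth h')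
    (hd : ∀ y, HasDerivAt h (h' y) y) {R x : ℝ} (hx : |x| ≤ R) :
    gaussIntegral δ (fun y => (h y - h x) ^ 2) ≤
      (8 * δ + 6 * R * Real.sqrt δ * Real.exp (R ^ 2 / (2 * δ))) *
        gaussIntegral δ (fun y => h' y ^ 2) := by
  have hR : 0 ≤ R := (abs_nonneg x).trans hx
  have h1 := gaussIntegral_sq_le hδ (hh.sub (.const (h 0))) hh'
    (fun y => (hd y).sub_const (h 0)) (sub_self _)
  have h2 : (h 0 - h x) ^ 2 ≤ 3 * R * Real.sqrt δ * Real.exp (R ^ 2 / (2 * δ)) *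
      gaussIntegral δ (fun y => h' y ^ 2) := by
    rcases le_total x 0 with h0 | h0
    · exact sq_sub_le_gaussIntegral hδ hh' hd h0 (by linarith [neg_le_abs x]) hx (by simpa)
    · rw [← neg_sq, neg_sub]
      exact sq_sub_le_gaussIntegral hδ hh' hd h0 (by linarith [le_abs_self x]) (by simpa) hx
  have h3 := gaussIntegral_mono hδ (hh.sub (.const (h x))).sq
    (((PolyGrowth.const 2).mul (hh.sub (.const (h 0))).sq).add (.const (2 * (h 0 - h x) ^ 2)))
    fun y => by nlinarith [sq_nonneg ((h y - h 0) - (h 0 - h x))]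
  rw [gaussIntegral_add hδ ((PolyGrowth.const 2).mul (hh.sub (.const (h 0))).sq) (.const _),
    gaussIntegral_const_mul, gaussIntegral_const hδ] at h3
  linarith

end Gaussian

theorem gaussianMeasure_eq_gaussianReal {δ : ℝ} (hδ : 0 < δ) :
    gaussianMeasure δ = ProbabilityTheory.gaussianReal 0 δ.toNNReal := by
  rw [ProbabilityTheory.gaussianReal_of_var_ne_zero _ (Real.toNNReal_pos.2 hδ).ne',
    gaussianMeasure]
  congr with t
  simp [ProbabilityTheory.gaussianPDF, ProbabilityTheory.gaussianPDFReal,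
    Real.coe_toNNReal δ hδ.le]

theorem isProbabilityMeasure_gaussianMeasure {δ : ℝ} (hδ : 0 < δ) :
    IsProbabilityMeasure (gaussianMeasure δ) := by
  rw [gaussianMeasure_eq_gaussianReal hδ]; infer_instance

theorem integral_gaussianMeasure (δ : ℝ) (F : ℝ → ℝ) :
    ∫ y, F y ∂gaussianMeasure δ = gaussIntegral δ F := by
  unfold gaussianMeasure gaussIntegral
  rw [integral_withDensity_eq_integral_toReal_smul (by fun_prop)
    (Filter.Eventually.of_forall fun _ => ENNReal.ofReal_lt_top)]
  refine integral_congr_ae (Filter.Eventually.of_forall fun y => ?_)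
  simp only [smul_eq_mul]
  rw [ENNReal.toReal_ofReal (by positivity), mul_comm]
  rfl

/-- Bounded continuous functions. -/
def ContBdd (F : ℝ → ℝ) : Prop := Continuous F ∧ ∃ B, ∀ t, |F t| ≤ B

namespace ContBdd

variable {F G : ℝ → ℝ}

theorem polyGrowth (hF : ContBdd F) : PolyGrowth F := hF.2.elim fun _ hB => .of_bounded hF.1 hB

theorem shift (hF : ContBdd F) (s : ℝ) : ContBdd fun y => F (s + y) :=
  ⟨hF.1.comp (by fun_prop), hF.2.imp fun _ hB _ => hB _⟩

theorem integrable (hF : ContBdd F) (ν : Measure ℝ) [IsFiniteMeasure ν] : Integrable F ν :=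
  hF.2.elim fun B hB => Integrable.of_bound hF.1.aestronglyMeasurable B
    (Filter.Eventually.of_forall hB)

theorem of_hasCompactSupport {f ψ : ℝ → ℝ} (hf : Continuous f) (hs : HasCompactSupport f)
    (hψ : Continuous ψ) : ContBdd fun t => ψ (f t) := by
  obtain ⟨B, hB⟩ := ((hs.isCompact_range hf).image hψ).isBounded.exists_norm_le
  exact ⟨hψ.comp hf, B, fun t => hB _ ⟨f t, ⟨t, rfl⟩, rfl⟩⟩

end ContBdd

section Mixture

variable {μ : Measure ℝ} [IsProbabilityMeasure μ] {δ : ℝ}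

theorem isProbabilityMeasure_mconv_s1 (hδ : 0 < δ) :
    IsProbabilityMeasure (mconv μ (gaussianMeasure δ)) := by
  have := isProbabilityMeasure_gaussianMeasure hδ
  exact Measure.isProbabilityMeasure_map (by fun_prop)

theorem integrable_integral_mconv (hδ : 0 < δ) {F : ℝ → ℝ} (hF : ContBdd F) :
    Integrable (fun s => gaussIntegral δ fun y => F (s + y)) μ ∧
      ∫ t, F t ∂mconv μ (gaussianMeasure δ) = ∫ s, gaussIntegral δ (fun y => F (s + y)) ∂μ := by
  have := isProbabilityMeasure_gaussianMeasure hδ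
  have hi : Integrable (fun p : ℝ × ℝ => F (p.1 + p.2)) (μ.prod (gaussianMeasure δ)) :=
    hF.2.elim fun B hB => Integrable.of_bound
      (hF.1.comp (by fun_prop)).aestronglyMeasurable B (Filter.Eventually.of_forall fun _ => hB _)
  simp_rw [← integral_gaussianMeasure]
  refine ⟨hi.integral_prod_left, ?_⟩
  rw [mconv, integral_map (by fun_prop) hF.1.aestronglyMeasurable, integral_prod _ hi]

theorem integral_mconv_le (hδ : 0 < δ) {F G H : ℝ → ℝ} (hF : ContBdd F) (hG : ContBdd G)
    (hH : ContBdd H) {a b : ℝ}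
    (h : ∀ᵐ s ∂μ, gaussIntegral δ (fun y => F (s + y)) ≤
      a * gaussIntegral δ (fun y => G (s + y)) + b * gaussIntegral δ (fun y => H (s + y))) :
    ∫ t, F t ∂mconv μ (gaussianMeasure δ) ≤ a * ∫ t, G t ∂mconv μ (gaussianMeasure δ) +
      b * ∫ t, H t ∂mconv μ (gaussianMeasure δ) := by
  obtain ⟨iF, eF⟩ := integrable_integral_mconv (μ := μ) hδ hF
  obtain ⟨iG, eG⟩ := integrable_integral_mconv (μ := μ) hδ hG
  obtain ⟨iH, eH⟩ := integrable_integral_mconv (μ := μ) hδ hH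
  rw [eF, eG, eH, ← integral_const_mul, ← integral_const_mul,
    ← integral_add (iG.const_mul a) (iH.const_mul b)]
  exact integral_mono_ae iF ((iG.const_mul a).add (iH.const_mul b)) h

end Mixture

theorem log_add_sq_div_sq_le {m h : ℝ} (hm : m ≠ 0) :
    Real.log ((m ^ 2 + h ^ 2) / m ^ 2) ≤ 2 * (|h| / |m|) := by
  have hm' : 0 < |m| := abs_pos.2 hm
  have e : (m ^ 2 + h ^ 2) / m ^ 2 ≤ (1 + |h| / |m|) ^ 2 := by
    rw [← sq_abs m, ← sq_abs h, add_div, div_self (by positivity), ← div_pow]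
    nlinarith [show 0 ≤ |h| / |m| by positivity]
  calc _ ≤ Real.log ((1 + |h| / |m|) ^ 2) := Real.log_le_log (by positivity) e
    _ = 2 * Real.log (1 + |h| / |m|) := by rw [Real.log_pow]; norm_num
    _ ≤ 2 * (|h| / |m|) := by
      gcongr
      have := Real.log_le_sub_one_of_pos (show 0 < 1 + |h| / |m| by positivity)
      linarith

/-- A pointwise form of Rothaus' lemma. -/
theorem sq_mul_log_le {m h v : ℝ} (hm : m ≠ 0) (hv : 0 < v) :
    (m + h) ^ 2 * Real.log ((m + h) ^ 2 / (m ^ 2 + v)) ≤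
      h ^ 2 * Real.log (h ^ 2 / v) + 2 * m * (Real.log (m ^ 2 / (m ^ 2 + v)) + 1) * h +
        8 * h ^ 2 := by
  have hm2 : 0 < m ^ 2 := by positivity
  set c := m ^ 2 + v with hc
  have hc0 : 0 < c := by positivity
  set A := m ^ 2 + h ^ 2 with hA
  have hA0 : 0 < A := by positivity
  have h1 : (m + h) ^ 2 * Real.log ((m + h) ^ 2 / c) ≤
      (m + h) ^ 2 * Real.log (A / c) + 2 * m * h + 4 * h ^ 2 := by
    have a2 : m ^ 2 * h ^ 2 / A ≤ h ^ 2 := by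
      rw [div_le_iff₀ hA0]; nlinarith [sq_nonneg (h ^ 2)]
    have a3 : (m + h) ^ 2 * ((m + h) ^ 2 / A - 1) = 2 * m * h + 4 * (m ^ 2 * h ^ 2 / A) := by
      field_simp; rw [hA]; ring
    rcases eq_or_ne (m + h) 0 with h0 | h0
    · rw [h0] at a3 ⊢
      simp at a3 ⊢
      linarith
    have hp : 0 < (m + h) ^ 2 := by positivity
    have a1 : Real.log ((m + h) ^ 2 / c) - Real.log (A / c) ≤ (m + h) ^ 2 / A - 1 := by
      rw [← Real.log_div (by positivity) (by positivity), div_div_div_cancel_right₀ hc0.ne']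
      exact Real.log_le_sub_one_of_pos (by positivity)
    nlinarith [mul_le_mul_of_nonneg_left a1 hp.le]
  have h2 : A * Real.log (A / c) ≤ h ^ 2 * Real.log (h ^ 2 / v) := by
    have b1 : m ^ 2 * Real.log (A / c) ≤ m ^ 2 * (A / c - 1) := by
      gcongr; exact Real.log_le_sub_one_of_pos (by positivity)
    have b2 : h ^ 2 * Real.log (A / c) ≤ h ^ 2 * Real.log (h ^ 2 / v) - m ^ 2 * (A / c - 1) := by
      rcases eq_or_ne h 0 with h0 | h0
      · have : A / c ≤ 1 := by
          rw [div_le_one hc0, hA, h0, hc]; nlinarith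
        rw [h0]
        nlinarith
      have hp : 0 < h ^ 2 := by positivity
      have a1 : Real.log (A / c) - Real.log (h ^ 2 / v) ≤ A / c / (h ^ 2 / v) - 1 := by
        rw [← Real.log_div (by positivity) (by positivity)]
        exact Real.log_le_sub_one_of_pos (by positivity)
      have a2 : h ^ 2 * (A / c / (h ^ 2 / v) - 1) = - (m ^ 2 * (A / c - 1)) := by
        field_simp; rw [hA, hc]; ring
      nlinarith [mul_le_mul_of_nonneg_left a1 hp.le]
    rw [show A * Real.log (A / c) = m ^ 2 * Real.log (A / c) + h ^ 2 * Real.log (A / c) by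
      rw [hA]; ring]
    linarith
  have h3 : Real.log (A / c) = Real.log (A / m ^ 2) + Real.log (m ^ 2 / c) := by
    rw [← Real.log_mul (by positivity) (by positivity), div_mul_div_cancel₀ hm2.ne']
  have h4 : 2 * m * h * Real.log (A / m ^ 2) ≤ 4 * h ^ 2 := by
    have hL : 0 ≤ Real.log (A / m ^ 2) :=
      Real.log_nonneg ((one_le_div hm2).2 (by rw [hA]; nlinarith [sq_nonneg h]))
    have hm' : 0 < |m| := abs_pos.2 hm
    calc 2 * m * h * Real.log (A / m ^ 2) ≤ 2 * (|m| * |h|) * (2 * (|h| / |m|)) := by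
          refine mul_le_mul ?_ (log_add_sq_div_sq_le hm) hL (by positivity)
          rw [← abs_mul]
          linarith [le_abs_self (m * h)]
      _ = 4 * |h| ^ 2 := by field_simp; ring
      _ = 4 * h ^ 2 := by rw [sq_abs]
  have h5 : (m + h) ^ 2 * Real.log (A / c) = A * Real.log (A / c) +
      2 * m * h * Real.log (A / m ^ 2) + 2 * m * h * Real.log (m ^ 2 / c) := by
    rw [show (m + h) ^ 2 = A + 2 * m * h by rw [hA]; ring, add_mul, add_assoc, ← mul_add, ← h3]
  linarith

theorem sq_mul_log_le_of_le_exp_mul {h v E S : ℝ} (hv : 0 < v) (hS : h ^ 2 ≤ Real.exp E * S) :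
    h ^ 2 * Real.log (h ^ 2 / v) ≤ h ^ 2 * (S / v + E) := by
  rcases eq_or_ne h 0 with rfl | h0
  · simp
  have hp : 0 < h ^ 2 := by positivity
  have hS0 : 0 < S := pos_of_mul_pos_right (hp.trans_le hS) (Real.exp_pos E).le
  gcongr
  calc Real.log (h ^ 2 / v) ≤ Real.log (S / v * Real.exp E) := by
        refine Real.log_le_log (by positivity) ?_
        rw [div_mul_eq_mul_div, mul_comm]
        gcongr
    _ = Real.log (S / v) + E := by
        rw [Real.log_mul (by positivity) (Real.exp_pos _).ne', Real.log_exp]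
    _ ≤ S / v + E := by
        have := Real.log_le_sub_one_of_pos (div_pos hS0 hv)
        linarith

theorem continuous_mul_log_div {v : ℝ} (hv : 0 ≤ v) :
    Continuous fun x : ℝ => x * Real.log (x / v) := by
  rcases hv.eq_or_lt with rfl | hv
  · simp only [div_zero, Real.log_zero, mul_zero]; fun_prop
  have : (fun x : ℝ => x * Real.log (x / v)) = fun x => v * (x / v * Real.log (x / v)) := by
    ext x; field_simp
  rw [this]
  exact continuous_const.mul (Real.continuous_mul_log.comp (continuous_id.div_const v))

theorem constant_bound {σ R : ℝ} (hσ : 0 < σ) (hR : σ ≤ R) :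
    (12 * (R ^ 2 / σ ^ 2) + 30) * (8 * σ ^ 2 + 6 * R * σ * Real.exp (R ^ 2 / (2 * σ ^ 2))) +
      67 * σ ^ 2 ≤ 7803 * (σ ^ 3 / R) * Real.exp (2 * R ^ 2 / σ ^ 2) := by
  obtain ⟨w, rfl⟩ : ∃ w, R = w * σ := ⟨R / σ, by field_simp⟩
  have hw : 1 ≤ w := by
    by_contra! h
    nlinarith
  have hw0 : 0 < w := by linarith
  set E := Real.exp (w ^ 2 / 2) with hE
  have e1 : (w * σ) ^ 2 / σ ^ 2 = w ^ 2 := by field_simp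
  have e2 : (w * σ) ^ 2 / (2 * σ ^ 2) = w ^ 2 / 2 := by field_simp
  have e3 : Real.exp (2 * (w * σ) ^ 2 / σ ^ 2) = E ^ 4 := by
    rw [hE, ← Real.exp_nat_mul]; congr 1; field_simp; norm_num
  have e4 : σ ^ 3 / (w * σ) = σ ^ 2 / w := by field_simp
  rw [e1, e2, e3, e4, ← hE]
  have hE1 : 1 + w ^ 2 / 2 ≤ E := by
    have := Real.add_one_le_exp (w ^ 2 / 2); linarith
  have hE0 : 1 ≤ E := by nlinarith
  have hwE : w ^ 4 ≤ 4 * E ^ 2 := by nlinarith [sq_nonneg w]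
  have hw2 : 1 ≤ w ^ 2 := by nlinarith
  have hwE1 : 1 ≤ w * E := one_le_mul_of_one_le_of_one_le hw hE0
  have k1 : (12 * w ^ 2 + 30) * (8 + 6 * (w * E)) + 67 ≤ 655 * (w ^ 3 * E) := by
    have : (12 * w ^ 2 + 30) * (8 + 6 * (w * E)) ≤ (42 * w ^ 2) * (14 * (w * E)) := by
      gcongr <;> linarith
    have h2 : 1 ≤ w ^ 2 * (w * E) := one_le_mul_of_one_le_of_one_le hw2 hwE1
    nlinarith
  have k2 : 655 * (w ^ 3 * E) ≤ 7803 * (E ^ 4 / w) := by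
    rw [mul_div_assoc', le_div_iff₀ hw0]
    have h3 : E ^ 3 ≤ E ^ 4 := pow_le_pow_right₀ hE0 (by norm_num)
    have h4 : w ^ 4 * E ≤ 4 * E ^ 2 * E := by gcongr
    have h5 : 0 ≤ E ^ 3 := by positivity
    nlinarith
  calc _ = σ ^ 2 * ((12 * w ^ 2 + 30) * (8 + 6 * (w * E)) + 67) := by ring
    _ ≤ σ ^ 2 * (7803 * (E ^ 4 / w)) := by gcongr; exact k1.trans k2
    _ = _ := by ring

section Convolution

variable {μ : Measure ℝ} [IsProbabilityMeasure μ] {R δ c : ℝ} {f : ℝ → ℝ}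

theorem contBdd_deriv_sq (hf : ContDiff ℝ 1 f) (hs : HasCompactSupport f) :
    ContBdd fun t => deriv f t ^ 2 :=
  .of_hasCompactSupport (ψ := fun x => x ^ 2) (hf.continuous_deriv le_rfl) hs.deriv (by fun_prop)

theorem contBdd_sub_const (hf : ContDiff ℝ 1 f) (hs : HasCompactSupport f) (m : ℝ) :
    ContBdd fun t => f t - m :=
  .of_hasCompactSupport (ψ := fun x => x - m) hf.continuous hs (by fun_prop)

theorem contBdd_sub_const_sq (hf : ContDiff ℝ 1 f) (hs : HasCompactSupport f) (m : ℝ) :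
    ContBdd fun t => (f t - m) ^ 2 :=
  .of_hasCompactSupport (ψ := fun x => (x - m) ^ 2) hf.continuous hs (by fun_prop)

theorem contBdd_mul_log (hf : ContDiff ℝ 1 f) (hs : HasCompactSupport f) (m : ℝ) {v : ℝ}
    (hv : 0 ≤ v) : ContBdd fun t => (f t - m) ^ 2 * Real.log ((f t - m) ^ 2 / v) :=
  .of_hasCompactSupport (ψ := fun x => (x - m) ^ 2 * Real.log ((x - m) ^ 2 / v)) hf.continuous hs
    ((continuous_mul_log_div hv).comp (by fun_prop : Continuous fun x : ℝ => (x - m) ^ 2))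

theorem contBdd_deriv (hf : ContDiff ℝ 1 f) (hs : HasCompactSupport f) : ContBdd (deriv f) :=
  .of_hasCompactSupport (ψ := fun x => x) (hf.continuous_deriv le_rfl) hs.deriv continuous_id

theorem hasDerivAt_shift_sub_const (hf : ContDiff ℝ 1 f) (s m y : ℝ) :
    HasDerivAt (fun y => f (s + y) - m) (deriv f (s + y)) y :=
  ((hf.differentiable one_ne_zero _).hasDerivAt.comp_const_add s y).sub_const m

theorem integral_sub_sq_le_mconv (hδ : 0 < δ) (hμ : ∀ᵐ s ∂μ, |s - c| ≤ R)
    (hf : ContDiff ℝ 1 f) (hs : HasCompactSupport f) :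
    ∫ t, (f t - f c) ^ 2 ∂mconv μ (gaussianMeasure δ) ≤
      (8 * δ + 6 * R * √δ * Real.exp (R ^ 2 / (2 * δ))) *
        ∫ t, deriv f t ^ 2 ∂mconv μ (gaussianMeasure δ) := by
  have key := integral_mconv_le (μ := μ) hδ (contBdd_sub_const_sq hf hs (f c))
    (contBdd_deriv_sq hf hs) (contBdd_deriv_sq hf hs)
    (a := 8 * δ + 6 * R * √δ * Real.exp (R ^ 2 / (2 * δ))) (b := 0) ?_
  · linarith
  filter_upwards [hμ] with s hsR
  have := gaussIntegral_sq_sub_le (x := c - s) (R := R) hδ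
    ((contBdd_sub_const hf hs 0).shift s).polyGrowth ((contBdd_deriv hf hs).shift s).polyGrowth
    (hasDerivAt_shift_sub_const hf s 0) (by rwa [abs_sub_comm])
  simpa using this

theorem sub_sq_le_exp_mul (hδ : 0 < δ) (hμ : ∀ᵐ s ∂μ, |s - c| ≤ R)
    (hf : ContDiff ℝ 1 f) (hs : HasCompactSupport f) (m t : ℝ) :
    (f t - m) ^ 2 ≤ Real.exp ((|t - c| + R) ^ 2 / (2 * δ)) *
      ((9 * (R ^ 2 / δ) + 33 / 2) * ∫ t, (f t - m) ^ 2 ∂mconv μ (gaussianMeasure δ) +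
        51 * δ * ∫ t, deriv f t ^ 2 ∂mconv μ (gaussianMeasure δ)) := by
  have := isProbabilityMeasure_mconv_s1 (μ := μ) hδ
  set E := Real.exp ((|t - c| + R) ^ 2 / (2 * δ)) with hE
  have key := integral_mconv_le (μ := μ) hδ (F := fun _ => (f t - m) ^ 2)
    ⟨continuous_const, _, fun _ => le_rfl⟩ (contBdd_sub_const_sq hf hs m)
    (contBdd_deriv_sq hf hs) (a := E * (9 * (R ^ 2 / δ) + 33 / 2)) (b := E * (51 * δ)) ?_
  · rw [integral_const, probReal_univ, one_smul] at key
    linarith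
  filter_upwards [hμ] with s hsR
  have := sq_le_exp_mul_gaussIntegral hδ
    ((contBdd_sub_const hf hs m).shift s).polyGrowth ((contBdd_deriv hf hs).shift s).polyGrowth
    (hasDerivAt_shift_sub_const hf s m) hsR (t - s)
  rw [gaussIntegral_const hδ]
  rw [add_sub_cancel, sub_add_sub_cancel, ← hE] at this
  linarith

theorem integral_mul_log_le_mconv (hδ : 0 < δ) (hμ : ∀ᵐ s ∂μ, |s - c| ≤ R)
    (hf : ContDiff ℝ 1 f) (hs : HasCompactSupport f) {m v : ℝ} (hv : 0 < v)
    (hvm : ∫ t, (f t - m) ^ 2 ∂mconv μ (gaussianMeasure δ) = v) :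
    ∫ t, (f t - m) ^ 2 * Real.log ((f t - m) ^ 2 / v) ∂mconv μ (gaussianMeasure δ) ≤
      (12 * (R ^ 2 / δ) + 41 / 2) * v +
        67 * δ * ∫ t, deriv f t ^ 2 ∂mconv μ (gaussianMeasure δ) := by
  have hpt := sub_sq_le_exp_mul hδ hμ hf hs m
  rw [hvm] at hpt
  set D := ∫ t, deriv f t ^ 2 ∂mconv μ (gaussianMeasure δ)
  set S := (9 * (R ^ 2 / δ) + 33 / 2) * v + 51 * δ * D with hS
  have key := integral_mconv_le (μ := μ) hδ (contBdd_mul_log hf hs m hv.le)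
    (contBdd_sub_const_sq hf hs m) (contBdd_deriv_sq hf hs)
    (a := S / v + (6 * R ^ 2 + 8 * δ) / (2 * δ)) (b := 16 * δ) ?_
  · rw [hvm] at key
    refine key.trans_eq ?_
    rw [hS]
    field_simp
    ring
  filter_upwards [hμ] with s hsR
  have hp := ((contBdd_sub_const hf hs m).shift s).polyGrowth
  have hp2 := hp.sq
  have hq : PolyGrowth fun y => (f (s + y) - m) ^ 2 * (|y + (s - c)| + R) ^ 2 :=
    hp2.mul ((PolyGrowth.id.add (.const _)).abs.add (.const R)).sq
  have b1 := gaussIntegral_sq_mul_le hδ hp ((contBdd_deriv hf hs).shift s).polyGrowth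
    (hasDerivAt_shift_sub_const hf s m) hsR
  have b2 : gaussIntegral δ (fun y => (f (s + y) - m) ^ 2 *
      Real.log ((f (s + y) - m) ^ 2 / v)) ≤ gaussIntegral δ (fun y =>
        S / v * (f (s + y) - m) ^ 2 +
          1 / (2 * δ) * ((f (s + y) - m) ^ 2 * (|y + (s - c)| + R) ^ 2)) := by
    refine gaussIntegral_mono hδ ((contBdd_mul_log hf hs m hv.le).shift s).polyGrowth
      (((PolyGrowth.const _).mul hp2).add ((PolyGrowth.const _).mul hq)) fun y => ?_
    refine (sq_mul_log_le_of_le_exp_mul hv (hpt (s + y))).trans_eq ?_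
    rw [show s + y - c = y + (s - c) by ring]
    ring
  rw [gaussIntegral_add hδ ((PolyGrowth.const _).mul hp2) ((PolyGrowth.const _).mul hq),
    gaussIntegral_const_mul, gaussIntegral_const_mul] at b2
  have b3 := mul_le_mul_of_nonneg_left b1 (show 0 ≤ 1 / (2 * δ) by positivity)
  refine (b2.trans (add_le_add_right b3 _)).trans_eq ?_
  field_simp
  ring

end Convolution

section Entropy

variable {ν : Measure ℝ} [IsProbabilityMeasure ν] {f : ℝ → ℝ}

theorem integral_sq_eq (hf : ContDiff ℝ 1 f) (hs : HasCompactSupport f) (a : ℝ) :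
    ∫ t, (f t - a) ^ 2 ∂ν = ∫ t, (f t - ∫ t, f t ∂ν) ^ 2 ∂ν + ((∫ t, f t ∂ν) - a) ^ 2 := by
  set m := ∫ t, f t ∂ν with hm
  have i0 : Integrable f ν := by simpa using (contBdd_sub_const hf hs 0).integrable ν
  have i1 := (contBdd_sub_const_sq hf hs m).integrable ν
  have i2 := (contBdd_sub_const hf hs m).integrable ν
  have e : ∫ t, (f t - m) ∂ν = 0 := by
    rw [integral_sub i0 (integrable_const _)]; simp [hm]
  calc ∫ t, (f t - a) ^ 2 ∂ν
      = ∫ t, ((f t - m) ^ 2 + (2 * (m - a)) * (f t - m) + (m - a) ^ 2) ∂ν := by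
        congr with t; ring
    _ = _ := by
        rw [integral_add (i1.fun_add (i2.const_mul _)) (integrable_const _),
          integral_add i1 (i2.const_mul _), integral_const_mul, e]
        simp

theorem ent_sq_le (hf : ContDiff ℝ 1 f) (hs : HasCompactSupport f) {m v : ℝ}
    (hm : ∫ t, f t ∂ν = m) (hv : ∫ t, (f t - m) ^ 2 ∂ν = v) (hv0 : 0 < v) :
    Ent ν (fun t => f t ^ 2) ≤
      ∫ t, (f t - m) ^ 2 * Real.log ((f t - m) ^ 2 / v) ∂ν + 8 * v := by
  have e := integral_sq_eq (ν := ν) hf hs 0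
  simp only [sub_zero, hm, hv] at e
  unfold Ent
  rw [e, add_comm v]
  rcases eq_or_ne m 0 with rfl | hm0
  · simp [hv0.le]
  have i0 : Integrable f ν := by simpa using (contBdd_sub_const hf hs 0).integrable ν
  have i1 := (contBdd_sub_const_sq hf hs m).integrable ν
  have i2 := (contBdd_sub_const hf hs m).integrable ν
  have i3 := (contBdd_mul_log hf hs m hv0.le).integrable ν
  have i4 := (contBdd_mul_log hf hs 0 (v := m ^ 2 + v) (by positivity)).integrable ν
  simp only [sub_zero] at i4
  set L := 2 * m * (Real.log (m ^ 2 / (m ^ 2 + v)) + 1)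
  have hc : ∫ t, (f t - m) ∂ν = 0 := by
    rw [integral_sub i0 (integrable_const _)]; simp [hm]
  calc _ ≤ ∫ t, ((f t - m) ^ 2 * Real.log ((f t - m) ^ 2 / v) + L * (f t - m) +
        8 * (f t - m) ^ 2) ∂ν := by
        refine integral_mono i4 ((i3.add (i2.const_mul _)).add (i1.const_mul _)) fun t => ?_
        simpa using sq_mul_log_le (h := f t - m) hm0 hv0
    _ = _ := by
        rw [integral_add (i3.fun_add (i2.const_mul _)) (i1.const_mul _),
          integral_add i3 (i2.const_mul _), integral_const_mul, integral_const_mul, hc, hv]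
        simp

theorem ent_sq_eq_zero (hf : ContDiff ℝ 1 f) (hs : HasCompactSupport f)
    (hv : ∫ t, (f t - ∫ t, f t ∂ν) ^ 2 ∂ν = 0) : Ent ν (fun t => f t ^ 2) = 0 := by
  have e := integral_sq_eq (ν := ν) hf hs 0
  rw [hv] at e
  simp only [sub_zero, zero_add] at e
  unfold Ent
  rw [e]
  set m := ∫ t, f t ∂ν
  have h0 := (integral_eq_zero_iff_of_nonneg (fun t => sq_nonneg (f t - m))
    ((contBdd_sub_const_sq hf hs m).integrable ν)).1 hv
  refine integral_eq_zero_of_ae ?_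
  filter_upwards [h0] with t ht
  have : f t = m := by simpa [sub_eq_zero] using ht
  rcases eq_or_ne m 0 with h | h <;> simp [this, h]

end Entropy

theorem stmt1 (R δ : ℝ) (hR : 0 < R) (hδpos : 0 < δ) (hδ : δ ≤ R ^ 2)
    (μ : Measure ℝ) [IsProbabilityMeasure μ]
    (hsupp : ∃ a : ℝ, μ (Set.Icc a (a + 2 * R))ᶜ = 0) :
    SatisfiesLSI (mconv μ (gaussianMeasure δ))
      (7803 * (δ ^ ((3 : ℝ) / 2) / R) * Real.exp (2 * R ^ 2 / δ)) := by
  intro f hfs hs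
  obtain ⟨a, ha⟩ := hsupp
  have hf : ContDiff ℝ 1 f := hfs.of_le (by exact_mod_cast le_top)
  have hμ : ∀ᵐ s ∂μ, |s - (a + R)| ≤ R := by
    filter_upwards [measure_eq_zero_iff_ae_notMem.1 ha] with s hs
    rw [Set.notMem_compl_iff] at hs
    rw [abs_le]
    constructor <;> linarith [hs.1, hs.2]
  have := isProbabilityMeasure_mconv_s1 (μ := μ) hδpos
  have hvar := integral_sub_sq_le_mconv hδpos hμ hf hs
  rw [integral_sq_eq hf hs] at hvar
  obtain ⟨m, hm⟩ : ∃ m, ∫ t, f t ∂mconv μ (gaussianMeasure δ) = m := ⟨_, rfl⟩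
  obtain ⟨v, hv⟩ : ∃ v, ∫ t, (f t - m) ^ 2 ∂mconv μ (gaussianMeasure δ) = v := ⟨_, rfl⟩
  have hD : 0 ≤ ∫ t, deriv f t ^ 2 ∂mconv μ (gaussianMeasure δ) :=
    integral_nonneg fun t => sq_nonneg _
  have hv0 : 0 ≤ v := hv ▸ integral_nonneg fun t => sq_nonneg _
  rcases hv0.eq_or_lt with rfl | hvpos
  · rw [ent_sq_eq_zero hf hs (by rw [hm, hv])]
    positivity
  have hent := ent_sq_le hf hs hm hv hvpos
  have hlog := integral_mul_log_le_mconv hδpos hμ hf hs hvpos hv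
  rw [hm, hv] at hvar
  set D := ∫ t, deriv f t ^ 2 ∂mconv μ (gaussianMeasure δ)
  have hσ : 0 < √δ := Real.sqrt_pos.2 hδpos
  have hσ2 : √δ ^ 2 = δ := Real.sq_sqrt hδpos.le
  have hσ3 : √δ ^ 3 = δ ^ ((3 : ℝ) / 2) := by
    rw [Real.sqrt_eq_rpow, ← Real.rpow_natCast, ← Real.rpow_mul hδpos.le]
    norm_num
  have hc := constant_bound hσ (Real.sqrt_le_iff.2 ⟨hR.le, hδ⟩)
  rw [hσ2, hσ3] at hc
  have hu : 0 ≤ R ^ 2 / δ := by positivity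
  have hvar' := hvar.trans' (le_add_of_nonneg_right (sq_nonneg _))
  calc Ent (mconv μ (gaussianMeasure δ)) (fun t => f t ^ 2)
      ≤ (12 * (R ^ 2 / δ) + 30) * v + 67 * δ * D := by linarith
    _ ≤ (12 * (R ^ 2 / δ) + 30) *
        ((8 * δ + 6 * R * √δ * Real.exp (R ^ 2 / (2 * δ))) * D) + 67 * δ * D := by gcongr
    _ = ((12 * (R ^ 2 / δ) + 30) * (8 * δ + 6 * R * √δ * Real.exp (R ^ 2 / (2 * δ))) +
        67 * δ) * D := by ring
    _ ≤ _ := by gcongr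
end

section
/- Let n ≥ 1, R > 0, let μ be a probability measure on ℝⁿ whose support is contained in a closed ball of radius R, and let 0 < δ ≤ R². Then the convolution μ_δ = μ * γ_δ satisfies a logarithmic Sobolev inequality with constant c(δ) ≤ 289 · R² · exp(20n + 5R²/δ). -/
open MeasureTheory Real

/-- Centered Gaussian measure on ℝⁿ of variance δ. -/
noncomputable def gaussianRn (n : ℕ) (δ : ℝ) : Measure (EuclideanSpace ℝ (Fin n)) :=
  volume.withDensity fun x =>
    ENNReal.ofReal ((2 * π * δ) ^ (-(n : ℝ) / 2) * Real.exp (-‖x‖ ^ 2 / (2 * δ)))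

/-- Convolution of two measures on ℝⁿ. -/
noncomputable def mconvn {n : ℕ} (μ ν : Measure (EuclideanSpace ℝ (Fin n))) :
    Measure (EuclideanSpace ℝ (Fin n)) :=
  (μ.prod ν).map fun p => p.1 + p.2

/-- ν satisfies a logarithmic Sobolev inequality on ℝⁿ with constant c:
Ent_ν(f²) ≤ c ∫ |∇f|² dν for all smooth compactly supported f : ℝⁿ → ℝ. -/
def SatisfiesLSIn {n : ℕ} (ν : Measure (EuclideanSpace ℝ (Fin n))) (c : ℝ) : Prop :=
  ∀ f : EuclideanSpace ℝ (Fin n) → ℝ, ContDiff ℝ (⊤ : ℕ∞) f → HasCompactSupport f →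
    Ent ν (fun x => f x ^ 2) ≤ c * ∫ x, ‖gradient f x‖ ^ 2 ∂ν

/-- A measurable real function with bounded range. -/
def BddMeas {α : Type*} [MeasurableSpace α] (f : α → ℝ) : Prop :=
  Measurable f ∧ ∃ C, ∀ x, |f x| ≤ C

namespace BddMeas

variable {α β : Type*} [MeasurableSpace α] [MeasurableSpace β] {f g : α → ℝ}

lemma integrable (hf : BddMeas f) (ν : Measure α) [IsFiniteMeasure ν] : Integrable f ν := by
  obtain ⟨hm, C, hC⟩ := hf
  exact Integrable.of_bound hm.aestronglyMeasurable C (.of_forall fun x => by simpa using hC x)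

lemma const (c : ℝ) : BddMeas (fun _ : α => c) := ⟨measurable_const, |c|, fun _ => le_rfl⟩

lemma comp_measurable (hf : BddMeas f) {u : β → α} (hu : Measurable u) :
    BddMeas (fun y => f (u y)) :=
  ⟨hf.1.comp hu, hf.2.choose, fun y => hf.2.choose_spec (u y)⟩

lemma comp_continuous (hf : BddMeas f) {u : ℝ → ℝ} (hu : Continuous u) :
    BddMeas (fun x => u (f x)) := by
  obtain ⟨hm, C, hC⟩ := hf
  obtain ⟨D, hD⟩ := (isCompact_Icc (a := -C) (b := C)).exists_bound_of_continuousOn hu.continuousOn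
  exact ⟨hu.measurable.comp hm, D, fun x => hD _ (abs_le.mp (hC x))⟩

lemma add (hf : BddMeas f) (hg : BddMeas g) : BddMeas (fun x => f x + g x) := by
  obtain ⟨hm, C, hC⟩ := hf
  obtain ⟨hm', D, hD⟩ := hg
  exact ⟨hm.add hm', C + D, fun x => (abs_add_le _ _).trans (add_le_add (hC x) (hD x))⟩

lemma mul (hf : BddMeas f) (hg : BddMeas g) : BddMeas (fun x => f x * g x) := by
  obtain ⟨hm, C, hC⟩ := hf
  obtain ⟨hm', D, hD⟩ := hg
  refine ⟨hm.mul hm', C * D, fun x => ?_⟩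
  rw [abs_mul]
  exact mul_le_mul (hC x) (hD x) (abs_nonneg _) ((abs_nonneg _).trans (hC x))

lemma sub (hf : BddMeas f) (hg : BddMeas g) : BddMeas (fun x => f x - g x) := by
  simpa [sub_eq_add_neg] using hf.add (hg.comp_continuous continuous_neg)

lemma sq (hf : BddMeas f) : BddMeas (fun x => f x ^ 2) :=
  hf.comp_continuous (continuous_pow 2)

lemma mul_log (hf : BddMeas f) : BddMeas (fun x => f x * log (f x)) :=
  hf.comp_continuous continuous_mul_log

lemma integral_right {F : α × β → ℝ} (hF : BddMeas F) (ν : Measure β) [IsProbabilityMeasure ν] :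
    BddMeas (fun x => ∫ y, F (x, y) ∂ν) := by
  obtain ⟨hm, C, hC⟩ := hF
  refine ⟨hm.stronglyMeasurable.integral_prod_right'.measurable, C, fun x => ?_⟩
  simpa using norm_integral_le_of_norm_le_const (μ := ν) (f := fun y => F (x, y))
    (.of_forall fun y => hC (x, y))

end BddMeas

section Entropy

variable {α β : Type*} [MeasurableSpace α] [MeasurableSpace β]

/-- The entropy functional in the form `∫ g log g - (∫ g) log (∫ g)`. -/
noncomputable def entropy (ν : Measure α) (g : α → ℝ) : ℝ :=
  ∫ x, g x * log (g x) ∂ν - (∫ x, g x ∂ν) * log (∫ x, g x ∂ν)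

variable {ν : Measure α} [IsProbabilityMeasure ν] {f g w : α → ℝ}

lemma Ent_eq_entropy (hg : BddMeas g) (h0 : ∀ x, 0 ≤ g x) : Ent ν g = entropy ν g := by
  unfold Ent entropy
  rcases (integral_nonneg h0 : 0 ≤ ∫ x, g x ∂ν).eq_or_lt with h | h
  · rw [← h]
    have := (integral_eq_zero_iff_of_nonneg h0 (hg.integrable ν)).mp h.symm
    rw [integral_eq_zero_of_ae, integral_eq_zero_of_ae]
    · simp
    · filter_upwards [this] with x hx
      simp [show g x = 0 from hx]
    · filter_upwards [this] with x hx
      simp [show g x = 0 from hx]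
  · rw [← integral_mul_const, ← integral_sub (hg.mul_log.integrable ν)
      ((hg.integrable ν).mul_const _)]
    refine integral_congr_ae (.of_forall fun x => ?_)
    rcases (h0 x).eq_or_lt with h' | h'
    · simp [← h']
    · simp only
      rw [log_div h'.ne' h.ne']
      ring

/-- The Gibbs variational inequality for the entropy. -/
lemma integral_mul_log_le (hg : BddMeas g) (h0 : ∀ x, 0 ≤ g x) (hw : Integrable w ν)
    (hgw : Integrable (fun x => g x * log (w x)) ν) (hw0 : ∀ x, 0 ≤ w x)
    (hwg : ∀ x, w x = 0 → g x = 0) (hW : 0 < ∫ x, w x ∂ν) :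
    ∫ x, g x * log (w x) ∂ν ≤ entropy ν g + (∫ x, g x ∂ν) * log (∫ x, w x ∂ν) := by
  unfold entropy
  rcases (integral_nonneg h0 : 0 ≤ ∫ x, g x ∂ν).eq_or_lt with h | h
  · rw [← h]
    have := (integral_eq_zero_iff_of_nonneg h0 (hg.integrable ν)).mp h.symm
    rw [integral_eq_zero_of_ae, integral_eq_zero_of_ae]
    · simp
    · filter_upwards [this] with x hx
      simp [show g x = 0 from hx]
    · filter_upwards [this] with x hx
      simp [show g x = 0 from hx]
  · set G := ∫ x, g x ∂ν
    set W := ∫ x, w x ∂ν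
    have key : ∀ x, g x * log (w x) ≤
        g x * log (g x) + g x * (log W - log G - 1) + w x * (G / W) := by
      intro x
      rcases (h0 x).eq_or_lt with h' | h'
      · rw [← h']
        have := mul_nonneg (hw0 x) (div_pos h hW).le
        simpa using this
      · have hwx : 0 < w x := (hw0 x).lt_of_ne fun e => h'.ne' (hwg x e.symm)
        have h1 := log_le_sub_one_of_pos (show 0 < w x * G / (g x * W) by positivity)
        rw [log_div (by positivity) (by positivity), log_mul hwx.ne' h.ne',
          log_mul h'.ne' hW.ne'] at h1
        have h2 := mul_le_mul_of_nonneg_left h1 h'.le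
        have h3 : g x * (w x * G / (g x * W) - 1) = w x * (G / W) - g x := by field_simp
        rw [h3] at h2
        linarith
    have i1 := hg.mul_log.integrable ν
    have i2 := (hg.integrable ν).mul_const (log W - log G - 1)
    have i3 := hw.mul_const (G / W)
    refine (integral_mono hgw ((i1.add i2).add i3) key).trans ?_
    have e : ∫ x, (((fun x => g x * log (g x)) + fun x => g x * (log W - log G - 1)) +
        fun x => w x * (G / W)) x ∂ν =
        ∫ x, g x * log (g x) ∂ν + G * (log W - log G - 1) + W * (G / W) := by
      rw [integral_add' (i1.add i2) i3, integral_add' i1 i2, integral_mul_const, integral_mul_const]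
    refine le_of_eq (e.trans ?_)
    field_simp
    ring

lemma entropy_le_integral_sq_div {a : ℝ} (ha : 0 < a) (hg : BddMeas g) (h0 : ∀ x, 0 < g x) :
    entropy ν g ≤ ∫ x, (g x - a) ^ 2 / a ∂ν := by
  have hle : ∀ x, g x * log (g x) ≤ (g x - a) ^ 2 / a + g x * (log a + 1) - a := by
    intro x
    have h1 := mul_le_mul_of_nonneg_left
      (log_le_sub_one_of_pos (show 0 < g x / a by have := h0 x; positivity)) (h0 x).le
    rw [log_div (h0 x).ne' ha.ne'] at h1
    have : g x * (g x / a - 1) = (g x - a) ^ 2 / a + g x - a := by field_simp; ring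
    linarith
  have i1 := (((hg.sub (.const a)).sq).mul (.const a⁻¹)).integrable ν
  have i2 := (hg.integrable ν).mul_const (log a + 1)
  have h3 : ∫ x, g x * log (g x) ∂ν ≤
      ∫ x, (g x - a) ^ 2 / a ∂ν + (∫ x, g x ∂ν) * (log a + 1) - a := by
    refine (integral_mono (hg.mul_log.integrable ν) ((i1.add i2).sub (integrable_const a))
      hle).trans (le_of_eq ?_)
    rw [integral_sub' (i1.add i2) (integrable_const a), integral_add' i1 i2,
      integral_mul_const (log a + 1)]
    simp only [div_eq_mul_inv, integral_const, probReal_univ, smul_eq_mul, one_mul]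
  have hG : 0 ≤ ∫ x, g x ∂ν := integral_nonneg fun x => (h0 x).le
  unfold entropy
  rcases hG.eq_or_lt with h | h
  · rw [← h] at h3 ⊢
    linarith
  · have h1 := mul_le_mul_of_nonneg_left
      (log_le_sub_one_of_pos (show 0 < a / ∫ x, g x ∂ν by positivity)) h.le
    rw [log_div ha.ne' h.ne'] at h1
    have : (∫ x, g x ∂ν) * (a / (∫ x, g x ∂ν) - 1) = a - ∫ x, g x ∂ν := by field_simp
    linarith

/-- The variance of a nonnegative function is at most the entropy of its square. -/
lemma variance_le_entropy_sq (hf : BddMeas f) (h0 : ∀ x, 0 ≤ f x) :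
    ∫ x, f x ^ 2 ∂ν - (∫ x, f x ∂ν) ^ 2 ≤ entropy ν (fun x => f x ^ 2) := by
  unfold entropy
  set A := ∫ x, f x ^ 2 ∂ν with hA
  have hA0 : 0 ≤ A := integral_nonneg fun x => sq_nonneg _
  rcases hA0.eq_or_lt with h | h
  · have := (integral_eq_zero_iff_of_nonneg (fun x => sq_nonneg (f x))
      (hf.sq.integrable ν)).mp (hA ▸ h.symm)
    rw [← h, integral_eq_zero_of_ae (f := fun x => f x ^ 2 * log (f x ^ 2))]
    · nlinarith [sq_nonneg (∫ x, f x ∂ν)]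
    · filter_upwards [this] with x hx
      simp [show f x ^ 2 = 0 from hx]
  · set s := √A
    have hs : 0 < s := sqrt_pos.mpr h
    have hsA : s ^ 2 = A := sq_sqrt hA0
    have hle : ∀ x, f x ^ 2 * (log A + 2) - f x * (2 * s) ≤ f x ^ 2 * log (f x ^ 2) := by
      intro x
      rcases (h0 x).eq_or_lt with h' | h'
      · simp [← h']
      · have h1 := mul_le_mul_of_nonneg_left
          (log_le_sub_one_of_pos (show 0 < s / f x by positivity)) (sq_nonneg (f x))
        rw [log_div hs.ne' h'.ne'] at h1
        have e : f x ^ 2 * (s / f x - 1) = f x * s - f x ^ 2 := by field_simp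
        rw [← hsA, log_pow, log_pow]
        push_cast
        linarith
    have i1 := (hf.sq.integrable ν).mul_const (log A + 2)
    have i2 := (hf.integrable ν).mul_const (2 * s)
    have h3 := integral_mono (i1.sub i2) (hf.sq.mul_log.integrable ν) hle
    rw [integral_sub' i1 i2, integral_mul_const, integral_mul_const] at h3
    nlinarith [sq_nonneg (s - ∫ x, f x ∂ν)]

lemma one_add_sq_mul_log_le (h : ℝ) :
    (1 + h) ^ 2 * log ((1 + h) ^ 2) ≤ 2 * h + 9 * h ^ 2 + h ^ 2 * log (1 + h ^ 2) := by
  have hlog : 0 ≤ log (1 + h ^ 2) := log_nonneg (by nlinarith)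
  have hlog' : log (1 + h ^ 2) ≤ h ^ 2 := by
    linarith [log_le_sub_one_of_pos (show 0 < 1 + h ^ 2 by positivity)]
  rcases eq_or_ne (1 + h) 0 with h0 | h0
  · have : h = -1 := by linarith
    subst this
    norm_num
    have := log_nonneg (show (1 : ℝ) ≤ 2 by norm_num)
    norm_num at hlog
    linarith
  by_cases h1 : |h| ≤ 1
  · have hh := abs_le.mp h1
    have hp : 0 < 1 + h := lt_of_le_of_ne (by linarith) (Ne.symm h0)
    have := log_le_sub_one_of_pos hp
    rw [log_pow]
    push_cast
    have h2 := mul_le_mul_of_nonneg_left this (sq_nonneg (1 + h))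
    nlinarith [sq_nonneg h, mul_nonneg (sq_nonneg h) hlog]
  · push Not at h1
    have h1' : 1 < h ^ 2 := by nlinarith [sq_abs h]
    have hq : log ((1 + h) ^ 2) ≤ log 2 + log (1 + h ^ 2) := by
      rw [← log_mul (by norm_num) (by positivity)]
      exact log_le_log (by positivity) (by nlinarith [sq_nonneg (1 - h)])
    have hl2 : log 2 ≤ 0.7 := by linarith [log_two_lt_d9]
    have hla : log (1 + h ^ 2) ≤ |h| := by
      rw [← sq_abs h]
      have hx : 0 ≤ |h| := abs_nonneg h
      refine (log_le_iff_le_exp (by positivity)).mpr ?_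
      have h3 : 1 + |h| + |h| ^ 2 / 2 + |h| ^ 3 / 6 ≤ exp |h| := by
        have := Real.sum_le_exp_of_nonneg hx 4
        norm_num [Finset.sum_range_succ, Nat.factorial] at this
        simpa using this
      nlinarith [mul_nonneg hx (sq_nonneg (|h| - 3/2))]
    have h2 : (1 + h) ^ 2 * log ((1 + h) ^ 2) ≤
        (1 + h) ^ 2 * (log 2 + log (1 + h ^ 2)) :=
      mul_le_mul_of_nonneg_left hq (sq_nonneg _)
    have h3 : (1 + 2 * h) * log (1 + h ^ 2) ≤ 3 * |h| * |h| := by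
      have : (1 + 2 * h) ≤ 3 * |h| := by linarith [le_abs_self h]
      exact mul_le_mul this hla hlog (by positivity)
    have h4 : (1 + h) ^ 2 * log 2 ≤ (1 + h) ^ 2 * 0.7 :=
      mul_le_mul_of_nonneg_left hl2 (sq_nonneg _)
    have h5 : |h| * |h| = h ^ 2 := by rw [← sq, sq_abs]
    nlinarith [sq_nonneg (h - 1), sq_nonneg (h + 1)]

/-- A weak form of the Rothaus lemma. -/
lemma entropy_sq_le_entropy_sq_sub_mean (hf : BddMeas f) :
    entropy ν (fun x => f x ^ 2) ≤
      entropy ν (fun x => (f x - ∫ y, f y ∂ν) ^ 2) +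
        10 * ∫ x, (f x - ∫ y, f y ∂ν) ^ 2 ∂ν := by
  set m := ∫ y, f y ∂ν with hm
  have hh : BddMeas (fun x => f x - m) := hf.sub (.const m)
  have hs0 : 0 ≤ ∫ x, (f x - m) ^ 2 ∂ν := integral_nonneg fun x => sq_nonneg _
  rcases eq_or_ne m 0 with h0 | h0
  · simp only [h0, sub_zero] at hs0 ⊢
    linarith
  set S := ∫ x, (f x - m) ^ 2 ∂ν with hS
  have hm2 : 0 < m ^ 2 := by positivity
  have hinteg : ∫ x, (f x - m) ∂ν = 0 := by
    rw [integral_sub (hf.integrable ν) (integrable_const m)]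
    simp [← hm]
  have hfS : ∫ x, f x ^ 2 ∂ν = m ^ 2 + S := by
    have e : ∀ x, f x ^ 2 = (f x - m) ^ 2 + (2 * m) * (f x - m) + m ^ 2 := fun x => by ring
    have i1 := hh.sq.integrable ν
    have i2 := (hh.integrable ν).const_mul (2 * m)
    have h1 := integral_add' (i1.add i2) (integrable_const (μ := ν) (m ^ 2))
    rw [integral_add' i1 i2, integral_const_mul, hinteg, ← hS] at h1
    rw [integral_congr_ae (.of_forall e)]
    refine h1.trans ?_
    simp [add_comm]
  rcases hs0.eq_or_lt with hS0 | hS0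
  · have hz := (integral_eq_zero_iff_of_nonneg (fun x => sq_nonneg (f x - m))
      (hh.sq.integrable ν)).mp hS0.symm
    have hfm : f =ᵐ[ν] fun _ => m := by
      filter_upwards [hz] with x hx
      have : (f x - m) ^ 2 = 0 := hx
      nlinarith
    have e1 : entropy ν (fun x => f x ^ 2) = 0 := by
      unfold entropy
      rw [integral_congr_ae (g := fun _ => m ^ 2 * log (m ^ 2)), hfS, ← hS0]
      · simp
      · filter_upwards [hfm] with x hx
        simp [hx]
    have e2 : entropy ν (fun x => (f x - m) ^ 2) = 0 := by
      unfold entropy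
      rw [integral_congr_ae (g := fun _ => 0), ← hS, ← hS0]
      · simp
      · filter_upwards [hfm] with x hx
        simp [hx]
    rw [e1, e2, ← hS0]
    simp
  have key : ∀ x, f x ^ 2 * log (f x ^ 2) ≤
      (f x - m) ^ 2 * log ((f x - m) ^ 2) + f x ^ 2 * log (m ^ 2)
        + (2 * m) * (f x - m) + 9 * (f x - m) ^ 2
        + (f x - m) ^ 2 * (log (m ^ 2 + S) - log (m ^ 2) - log S) + S := by
    intro x
    set k := f x - m with hk
    have hfx : f x = m * (1 + k / m) := by field_simp; rw [hk]; ring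
    have h1 := mul_le_mul_of_nonneg_left (one_add_sq_mul_log_le (k / m)) hm2.le
    have e1 : f x ^ 2 * log (f x ^ 2) = m ^ 2 * ((1 + k / m) ^ 2 * log ((1 + k / m) ^ 2))
        + f x ^ 2 * log (m ^ 2) := by
      rcases eq_or_ne (f x) 0 with hf0 | hf0
      · have : 1 + k / m = 0 := by
          rcases mul_eq_zero.mp (hfx ▸ hf0) with h | h
          · exact absurd h h0
          · exact h
        simp [hf0, this]
      · have : 1 + k / m ≠ 0 := fun h => hf0 (by rw [hfx, h, mul_zero])
        rw [hfx, mul_pow, log_mul (by positivity) (by positivity)]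
        ring
    have e2 : m ^ 2 * (2 * (k / m) + 9 * (k / m) ^ 2 + (k / m) ^ 2 * log (1 + (k / m) ^ 2)) =
        (2 * m) * k + 9 * k ^ 2 + k ^ 2 * (log (m ^ 2 + k ^ 2) - log (m ^ 2)) := by
      have : 1 + (k / m) ^ 2 = (m ^ 2 + k ^ 2) / m ^ 2 := by field_simp
      rw [this, log_div (by positivity) (by positivity)]
      field_simp
    have h2 : k ^ 2 * log (m ^ 2 + k ^ 2) ≤
        k ^ 2 * log (k ^ 2) + k ^ 2 * (log (m ^ 2 + S) - log S) + S := by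
      rcases eq_or_ne k 0 with hk0 | hk0
      · simp [hk0, hS0.le]
      have hk2 : 0 < k ^ 2 := by positivity
      by_cases hkS : S ≤ k ^ 2
      · have : log (m ^ 2 + k ^ 2) + log S ≤ log (k ^ 2) + log (m ^ 2 + S) := by
          rw [← log_mul (by positivity) hS0.ne', ← log_mul hk2.ne' (by positivity)]
          exact log_le_log (by positivity) (by nlinarith)
        nlinarith
      · push Not at hkS
        have a1 : log (m ^ 2 + k ^ 2) ≤ log (m ^ 2 + S) :=
          log_le_log (by positivity) (by linarith)
        have a2 := mul_le_mul_of_nonneg_left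
          (log_le_sub_one_of_pos (show 0 < S / k ^ 2 by positivity)) hk2.le
        rw [log_div hS0.ne' hk2.ne'] at a2
        have a3 : k ^ 2 * (S / k ^ 2 - 1) = S - k ^ 2 := by field_simp
        nlinarith
    rw [e1]
    linarith
  have i1 := hh.sq.mul_log.integrable ν
  have i2 := (hf.sq.integrable ν).mul_const (log (m ^ 2))
  have i3 := (hh.integrable ν).const_mul (2 * m)
  have i4 := (hh.sq.integrable ν).const_mul 9
  have i5 := (hh.sq.integrable ν).mul_const (log (m ^ 2 + S) - log (m ^ 2) - log S)
  have h3 := integral_mono (hf.sq.mul_log.integrable ν)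
    (((((i1.add i2).add i3).add i4).add i5).add (integrable_const S)) key
  rw [integral_add' ((((i1.add i2).add i3).add i4).add i5) (integrable_const S),
    integral_add' (((i1.add i2).add i3).add i4) i5,
    integral_add' ((i1.add i2).add i3) i4, integral_add' (i1.add i2) i3, integral_add' i1 i2,
    integral_mul_const, integral_mul_const, integral_const_mul, integral_const_mul, hinteg, hfS,
    ← hS] at h3
  simp only [integral_const, probReal_univ, smul_eq_mul, one_mul, mul_zero, add_zero] at h3
  unfold entropy
  rw [hfS, ← hS]
  have : log (m ^ 2) ≤ log (m ^ 2 + S) := log_le_log hm2 (by linarith)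
  nlinarith

/-- The entropy is convex: the entropy of an average is at most the average of the entropies. -/
lemma entropy_integral_le {ρ : Measure β} [IsProbabilityMeasure ρ] {F : α × β → ℝ}
    (hF : BddMeas F) {ε : ℝ} (hε : 0 < ε) (h0 : ∀ p, ε ≤ F p) :
    entropy ν (fun x => ∫ y, F (x, y) ∂ρ) ≤ ∫ y, entropy ν (fun x => F (x, y)) ∂ρ := by
  have hu : BddMeas (fun x => ∫ y, F (x, y) ∂ρ) := hF.integral_right ρ
  have hFy : ∀ y, BddMeas (fun x => F (x, y)) := fun y => hF.comp_measurable (by fun_prop)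
  have hFx : ∀ x, BddMeas (fun y => F (x, y)) := fun y => hF.comp_measurable (by fun_prop)
  have hsw : BddMeas (fun p : β × α => F p.swap) := hF.comp_measurable measurable_swap
  have hG : BddMeas (fun y => ∫ x, F (x, y) ∂ν) := hsw.integral_right ν
  have hGlog : BddMeas (fun y => ∫ x, F (x, y) * log (F (x, y)) ∂ν) :=
    hsw.mul_log.integral_right ν
  set u := fun x => ∫ y, F (x, y) ∂ρ with hudef
  have hupos : ∀ x, ε ≤ u x := fun x => by
    have := integral_mono (μ := ρ) (integrable_const ε) ((hFx x).integrable ρ) fun y => h0 (x, y)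
    simpa using this
  have hulog : BddMeas (fun x => log (u x)) := by
    obtain ⟨hm, C, hC⟩ := hu
    refine ⟨measurable_log.comp hm, max |log ε| |log C|, fun x => ?_⟩
    exact abs_le_max_abs_abs (log_le_log hε (hupos x))
      (log_le_log (hε.trans_le (hupos x)) ((le_abs_self _).trans (hC x)))
  have hum : 0 < ∫ x, u x ∂ν := by
    have := integral_mono (μ := ν) (integrable_const ε) (hu.integrable ν) hupos
    simp at this
    linarith
  have hgibbs : ∀ y, ∫ x, F (x, y) * log (u x) ∂ν ≤
      entropy ν (fun x => F (x, y)) + (∫ x, F (x, y) ∂ν) * log (∫ x, u x ∂ν) := fun y =>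
    integral_mul_log_le (hFy y) (fun x => hε.le.trans (h0 _)) (hu.integrable ν)
      (((hFy y).mul hulog).integrable ν) (fun x => hε.le.trans (hupos x))
      (fun x hx => by linarith [hupos x]) hum
  have hFl : BddMeas (fun p : α × β => F p * log (u p.1)) :=
    hF.mul (hulog.comp_measurable measurable_fst)
  have hent : BddMeas (fun y => entropy ν (fun x => F (x, y))) := hGlog.sub hG.mul_log
  have h1 := integral_mono (μ := ρ)
    ((BddMeas.integral_right (F := fun p : β × α => F p.swap * log (u p.2))
      (hFl.comp_measurable measurable_swap) ν).integrable ρ)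
    ((hent.integrable ρ).add ((hG.integrable ρ).mul_const (log (∫ x, u x ∂ν)))) hgibbs
  rw [integral_add' (hent.integrable ρ) ((hG.integrable ρ).mul_const _), integral_mul_const] at h1
  have s1 : ∫ y, ∫ x, F (x, y) ∂ν ∂ρ = ∫ x, u x ∂ν :=
    (integral_integral_swap (f := fun x y => F (x, y)) (hF.integrable (ν.prod ρ))).symm
  have s2 : ∫ y, ∫ x, F (x, y) * log (u x) ∂ν ∂ρ = ∫ x, u x * log (u x) ∂ν := by
    rw [← integral_integral_swap (f := fun x y => F (x, y) * log (u x))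
      (hFl.integrable (ν.prod ρ))]
    refine integral_congr_ae (.of_forall fun x => ?_)
    simp only [integral_mul_const]
    rfl
  unfold entropy at h1 ⊢
  simp only [Prod.swap_prod_mk] at h1
  rw [s1] at h1
  linarith [h1, s2]

end Entropy

section Gaussian

open scoped RealInnerProductSpace

variable {n : ℕ} {t s : ℝ}

lemma integral_gaussianRn {F : Type*} [NormedAddCommGroup F] [NormedSpace ℝ F] (ht : 0 < t)
    (f : EuclideanSpace ℝ (Fin n) → F) :
    ∫ x, f x ∂gaussianRn n t =
      (2 * π * t) ^ (-(n : ℝ) / 2) • ∫ x, exp (-‖x‖ ^ 2 / (2 * t)) • f x := by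
  unfold gaussianRn
  rw [integral_withDensity_eq_integral_toReal_smul (by fun_prop) (by simp), ← integral_smul]
  refine integral_congr_ae (.of_forall fun x => ?_)
  simp only
  rw [ENNReal.toReal_ofReal (by positivity), smul_smul]

lemma integral_cexp_inner_gaussianRn (ht : 0 < t) (c : ℂ) (w : EuclideanSpace ℝ (Fin n)) :
    ∫ x, Complex.exp (c * (⟪w, x⟫ : ℝ)) ∂gaussianRn n t =
      Complex.exp (c ^ 2 * ‖w‖ ^ 2 * t / 2) := by
  have hb : 0 < ((1 / (2 * t) : ℝ) : ℂ).re := by rw [Complex.ofReal_re]; positivity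
  have h := GaussianFourier.integral_cexp_neg_mul_sq_norm_add hb c w
  have e : ∀ x : EuclideanSpace ℝ (Fin n),
      exp (-‖x‖ ^ 2 / (2 * t)) • Complex.exp (c * (⟪w, x⟫ : ℝ)) =
      Complex.exp (-((1 / (2 * t) : ℝ) : ℂ) * ‖x‖ ^ 2 + c * (⟪w, x⟫ : ℝ)) := by
    intro x
    rw [Complex.real_smul, Complex.ofReal_exp, ← Complex.exp_add]
    congr 1
    push_cast
    ring
  rw [integral_gaussianRn ht]
  simp_rw [e]
  rw [h, finrank_euclideanSpace_fin]
  have e2 : ((π : ℂ) / ((1 / (2 * t) : ℝ) : ℂ)) ^ ((n : ℂ) / 2) =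
      (((2 * π * t) ^ ((n : ℝ) / 2) : ℝ) : ℂ) := by
    rw [Complex.ofReal_cpow (by positivity)]
    push_cast
    congr 1
    field_simp
  rw [e2, Complex.real_smul, ← mul_assoc, ← Complex.ofReal_mul, ← rpow_add (by positivity)]
  have : -(n : ℝ) / 2 + n / 2 = 0 := by ring
  rw [this, rpow_zero, Complex.ofReal_one, one_mul]
  congr 1
  have : (t : ℂ) ≠ 0 := by exact_mod_cast ht.ne'
  push_cast
  field_simp
  ring

lemma isProbabilityMeasure_gaussianRn (ht : 0 < t) : IsProbabilityMeasure (gaussianRn n t) := by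
  have h := integral_cexp_inner_gaussianRn (n := n) ht 0 0
  simp only [zero_mul, Complex.exp_zero, integral_const, Complex.real_smul, mul_one, ne_eq,
    OfNat.ofNat_ne_zero, not_false_eq_true, zero_pow, zero_div] at h
  have h' : (gaussianRn n t).real Set.univ = 1 := by exact_mod_cast h
  exact ⟨by simpa [measureReal_def, ENNReal.toReal_eq_one_iff] using h'⟩

lemma integral_exp_inner_gaussianRn (ht : 0 < t) (w : EuclideanSpace ℝ (Fin n)) :
    ∫ x, exp ⟪w, x⟫ ∂gaussianRn n t = exp (‖w‖ ^ 2 * t / 2) := by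
  have h := integral_cexp_inner_gaussianRn ht 1 w
  have e : ∀ x : EuclideanSpace ℝ (Fin n), Complex.exp (1 * (⟪w, x⟫ : ℝ)) = (exp ⟪w, x⟫ : ℝ) :=
    fun x => by push_cast; simp
  simp_rw [e] at h
  rw [integral_complex_ofReal] at h
  apply_fun Complex.re at h
  simp only [one_pow, one_mul, Complex.ofReal_re] at h
  rw [h, ← Complex.ofReal_re (exp (‖w‖ ^ 2 * t / 2))]
  push_cast
  rfl

lemma integrable_exp_inner_gaussianRn (ht : 0 < t) (w : EuclideanSpace ℝ (Fin n)) :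
    Integrable (fun x => exp ⟪w, x⟫) (gaussianRn n t) := by
  by_contra h
  have := integral_undef h
  rw [integral_exp_inner_gaussianRn ht] at this
  exact (exp_pos _).ne' this

lemma integral_exp_sq_gaussianRn (ht : 0 < t) :
    ∫ x, exp (‖x‖ ^ 2 / (4 * t)) ∂gaussianRn n t = 2 ^ ((n : ℝ) / 2) := by
  rw [integral_gaussianRn ht]
  have e : ∀ x : EuclideanSpace ℝ (Fin n),
      exp (-‖x‖ ^ 2 / (2 * t)) • exp (‖x‖ ^ 2 / (4 * t)) = exp (-(1 / (4 * t)) * ‖x‖ ^ 2) := by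
    intro x
    rw [smul_eq_mul, ← exp_add]
    congr 1
    field_simp
    ring
  simp_rw [e]
  rw [GaussianFourier.integral_rexp_neg_mul_sq_norm (by positivity), finrank_euclideanSpace_fin,
    smul_eq_mul]
  have : π / (1 / (4 * t)) = 2 * (2 * π * t) := by field_simp; norm_num
  rw [this, mul_rpow (x := 2) (y := 2 * π * t) (by norm_num) (by positivity), mul_left_comm,
    ← rpow_add (by positivity)]
  have : -(n : ℝ) / 2 + n / 2 = 0 := by ring
  rw [this, rpow_zero, mul_one]

lemma integrable_exp_sq_gaussianRn (ht : 0 < t) :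
    Integrable (fun x => exp (‖x‖ ^ 2 / (4 * t))) (gaussianRn n t) := by
  by_contra h
  have := integral_undef h
  rw [integral_exp_sq_gaussianRn ht] at this
  exact (rpow_pos_of_pos (by norm_num : (0 : ℝ) < 2) _).ne' this

lemma integrable_sq_gaussianRn (ht : 0 < t) :
    Integrable (fun x => ‖x‖ ^ 2) (gaussianRn n t) := by
  refine ((integrable_exp_sq_gaussianRn ht).const_mul (4 * t)).mono' (by fun_prop)
    (.of_forall fun x => ?_)
  have := add_one_le_exp (‖x‖ ^ 2 / (4 * t))
  rw [norm_of_nonneg (by positivity)]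
  have h2 := mul_le_mul_of_nonneg_left this (show 0 ≤ 4 * t by positivity)
  have h3 : 4 * t * (‖x‖ ^ 2 / (4 * t) + 1) = ‖x‖ ^ 2 + 4 * t := by field_simp
  linarith

lemma integral_sq_gaussianRn_le (ht : 0 < t) :
    ∫ x, ‖x‖ ^ 2 ∂gaussianRn n t ≤ 4 * t * 2 ^ ((n : ℝ) / 2) := by
  rw [← integral_exp_sq_gaussianRn ht, ← integral_const_mul]
  refine integral_mono (integrable_sq_gaussianRn ht)
    ((integrable_exp_sq_gaussianRn ht).const_mul (4 * t)) fun x => ?_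
  have := add_one_le_exp (‖x‖ ^ 2 / (4 * t))
  have h2 := mul_le_mul_of_nonneg_left this (show 0 ≤ 4 * t by positivity)
  have h3 : 4 * t * (‖x‖ ^ 2 / (4 * t) + 1) = ‖x‖ ^ 2 + 4 * t := by field_simp
  simp only
  linarith

lemma norm_pow_four_le (ht : 0 < t) (x : EuclideanSpace ℝ (Fin n)) :
    ‖x‖ ^ 4 ≤ 32 * t ^ 2 * exp (‖x‖ ^ 2 / (4 * t)) := by
  have := quadratic_le_exp_of_nonneg (show 0 ≤ ‖x‖ ^ 2 / (4 * t) by positivity)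
  have h2 := mul_le_mul_of_nonneg_left this (show 0 ≤ 32 * t ^ 2 by positivity)
  have h3 : 32 * t ^ 2 * (1 + ‖x‖ ^ 2 / (4 * t) + (‖x‖ ^ 2 / (4 * t)) ^ 2 / 2) =
    ‖x‖ ^ 4 + (32 * t ^ 2 + 8 * t * ‖x‖ ^ 2) := by field_simp; ring
  have : 0 ≤ 32 * t ^ 2 + 8 * t * ‖x‖ ^ 2 := by positivity
  linarith

lemma integrable_pow_four_gaussianRn (ht : 0 < t) :
    Integrable (fun x => ‖x‖ ^ 4) (gaussianRn n t) := by
  refine ((integrable_exp_sq_gaussianRn ht).const_mul (32 * t ^ 2)).mono' (by fun_prop)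
    (.of_forall fun x => ?_)
  rw [norm_of_nonneg (by positivity)]
  exact norm_pow_four_le ht x

lemma integral_pow_four_gaussianRn_le (ht : 0 < t) :
    ∫ x, ‖x‖ ^ 4 ∂gaussianRn n t ≤ 32 * t ^ 2 * 2 ^ ((n : ℝ) / 2) := by
  rw [← integral_exp_sq_gaussianRn ht, ← integral_const_mul]
  exact integral_mono (integrable_pow_four_gaussianRn ht)
    ((integrable_exp_sq_gaussianRn ht).const_mul _) (norm_pow_four_le ht)

lemma charFun_gaussianRn (ht : 0 < t) (w : EuclideanSpace ℝ (Fin n)) :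
    charFun (gaussianRn n t) w = Complex.exp (-(‖w‖ ^ 2 * t / 2)) := by
  have h := integral_cexp_inner_gaussianRn ht Complex.I w
  rw [charFun_apply]
  simp_rw [real_inner_comm w, mul_comm _ Complex.I]
  rw [h, Complex.I_sq]
  congr 1
  ring

lemma mconvn_gaussianRn (ht : 0 < t) (hs : 0 < s) :
    mconvn (gaussianRn n t) (gaussianRn n s) = gaussianRn n (t + s) := by
  have := isProbabilityMeasure_gaussianRn (n := n) ht
  have := isProbabilityMeasure_gaussianRn (n := n) hs
  have := isProbabilityMeasure_gaussianRn (n := n) (add_pos ht hs)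
  change (gaussianRn n t).conv (gaussianRn n s) = _
  refine Measure.ext_of_charFun ?_
  ext w
  rw [charFun_conv, charFun_gaussianRn ht, charFun_gaussianRn hs,
    charFun_gaussianRn (add_pos ht hs), ← Complex.exp_add]
  congr 1
  push_cast
  ring

lemma integral_mconvn {ν ρ : Measure (EuclideanSpace ℝ (Fin n))} [IsProbabilityMeasure ν]
    [IsProbabilityMeasure ρ] {F : EuclideanSpace ℝ (Fin n) → ℝ} (hF : BddMeas F) :
    ∫ x, F x ∂mconvn ν ρ = ∫ x, ∫ y, F (x + y) ∂ρ ∂ν := by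
  unfold mconvn
  rw [integral_map (by fun_prop) hF.1.aestronglyMeasurable]
  exact integral_prod _ ((hF.comp_measurable (by fun_prop)).integrable (ν.prod ρ))

lemma isProbabilityMeasure_mconvn {ν ρ : Measure (EuclideanSpace ℝ (Fin n))}
    [IsProbabilityMeasure ν] [IsProbabilityMeasure ρ] : IsProbabilityMeasure (mconvn ν ρ) :=
  Measure.isProbabilityMeasure_map (by fun_prop)

/-- The density of the translate of a Gaussian measure by `d`. -/
noncomputable def shiftDensity (t : ℝ) (d z : EuclideanSpace ℝ (Fin n)) : ℝ :=
  exp (⟪d, z⟫ / t - ‖d‖ ^ 2 / (2 * t))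

lemma integral_add_gaussianRn (ht : 0 < t) (F : EuclideanSpace ℝ (Fin n) → ℝ)
    (d : EuclideanSpace ℝ (Fin n)) :
    ∫ z, F (z + d) ∂gaussianRn n t = ∫ z, F z * shiftDensity t d z ∂gaussianRn n t := by
  rw [integral_gaussianRn ht, integral_gaussianRn ht]
  congr 1
  rw [← integral_add_right_eq_self
    (fun z => exp (-‖z‖ ^ 2 / (2 * t)) • (F z * shiftDensity t d z)) d]
  refine integral_congr_ae (.of_forall fun z => ?_)
  simp only [smul_eq_mul, shiftDensity]
  rw [mul_left_comm, ← exp_add, mul_comm]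
  congr 2
  rw [norm_add_sq_real, inner_add_right, real_inner_self_eq_norm_sq, real_inner_comm]
  field_simp
  ring

lemma integrable_shiftDensity (ht : 0 < t) (d : EuclideanSpace ℝ (Fin n)) :
    Integrable (shiftDensity t d) (gaussianRn n t) := by
  have := (integrable_exp_inner_gaussianRn ht (t⁻¹ • d)).mul_const (exp (-(‖d‖ ^ 2 / (2 * t))))
  refine this.congr (.of_forall fun z => ?_)
  simp only [shiftDensity]
  rw [← exp_add, real_inner_smul_left]
  congr 1
  ring

lemma integral_shiftDensity (ht : 0 < t) (d : EuclideanSpace ℝ (Fin n)) :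
    ∫ z, shiftDensity t d z ∂gaussianRn n t = 1 := by
  have := isProbabilityMeasure_gaussianRn (n := n) ht
  have h := integral_add_gaussianRn ht (fun _ => 1) d
  simpa using h.symm

lemma shiftDensity_sq (ht : 0 < t) (d z : EuclideanSpace ℝ (Fin n)) :
    shiftDensity t d z ^ 2 = exp ⟪(2 / t) • d, z⟫ * exp (-(‖d‖ ^ 2 / t)) := by
  simp only [shiftDensity]
  rw [← exp_nat_mul, ← exp_add, real_inner_smul_left]
  congr 1
  field_simp
  push_cast
  ring

lemma integrable_shiftDensity_sq (ht : 0 < t) (d : EuclideanSpace ℝ (Fin n)) :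
    Integrable (fun z => shiftDensity t d z ^ 2) (gaussianRn n t) := by
  simp_rw [shiftDensity_sq ht]
  exact (integrable_exp_inner_gaussianRn ht _).mul_const _

lemma integral_shiftDensity_sq (ht : 0 < t) (d : EuclideanSpace ℝ (Fin n)) :
    ∫ z, shiftDensity t d z ^ 2 ∂gaussianRn n t = exp (‖d‖ ^ 2 / t) := by
  simp_rw [shiftDensity_sq ht]
  rw [integral_mul_const, integral_exp_inner_gaussianRn ht, ← exp_add, norm_smul]
  congr 1
  rw [norm_of_nonneg (by positivity)]
  field_simp
  ring

end Gaussian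

section GaussianLogSobolev

lemma entropy_le_of_forall_entropy_add_le {α : Type*} [MeasurableSpace α] {ν : Measure α}
    [IsProbabilityMeasure ν] {g : α → ℝ} (hg : BddMeas g) {c : ℝ}
    (h : ∀ ε > 0, entropy ν (fun x => g x + ε) ≤ c) : entropy ν g ≤ c := by
  obtain ⟨hm, C, hC⟩ := hg
  have hlim := tendsto_one_div_add_atTop_nhds_zero_nat (𝕜 := ℝ)
  have hcont : Continuous fun u : ℝ => u * log u := continuous_mul_log
  obtain ⟨D, hD⟩ := (isCompact_Icc (a := -(C + 1)) (b := C + 1)).exists_bound_of_continuousOn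
    hcont.continuousOn
  have hb : ∀ (k : ℕ) x, |g x + 1 / ((k : ℝ) + 1)| ≤ C + 1 := fun k x => by
    have h1 : 1 / ((k : ℝ) + 1) ≤ 1 := by
      rw [div_le_one (by positivity)]; linarith [k.cast_nonneg (α := ℝ)]
    have h2 : 0 ≤ 1 / ((k : ℝ) + 1) := by positivity
    refine (abs_add_le _ _).trans (add_le_add (hC x) ?_)
    rwa [abs_of_nonneg h2]
  have hpt : ∀ x, Filter.Tendsto (fun k : ℕ => g x + 1 / ((k : ℝ) + 1)) Filter.atTop
      (nhds (g x)) := fun x => by simpa using hlim.const_add (g x)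
  have t1 : Filter.Tendsto (fun k : ℕ => ∫ x, (g x + 1 / ((k : ℝ) + 1)) ∂ν) Filter.atTop
      (nhds (∫ x, g x ∂ν)) :=
    tendsto_integral_of_dominated_convergence (fun _ => C + 1)
      (fun k => (hm.add_const _).aestronglyMeasurable) (integrable_const _)
      (fun k => .of_forall fun x => hb k x) (.of_forall hpt)
  have t2 : Filter.Tendsto (fun k : ℕ => ∫ x, (g x + 1 / ((k : ℝ) + 1)) *
      log (g x + 1 / ((k : ℝ) + 1)) ∂ν) Filter.atTop (nhds (∫ x, g x * log (g x) ∂ν)) :=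
    tendsto_integral_of_dominated_convergence (fun _ => D)
      (fun k => (hcont.measurable.comp (hm.add_const _)).aestronglyMeasurable)
      (integrable_const _)
      (fun k => .of_forall fun x => hD _ (abs_le.mp (hb k x)))
      (.of_forall fun x => (hcont.tendsto (g x)).comp (hpt x))
  exact le_of_tendsto (t2.sub ((hcont.tendsto _).comp t1))
    (.of_forall fun k => h _ (by positivity))

variable {n : ℕ} {t h : ℝ}

lemma integral_gaussianRn_add (ht : 0 < t) (hh : 0 < h) {F : EuclideanSpace ℝ (Fin n) → ℝ}
    (hF : BddMeas F) (x : EuclideanSpace ℝ (Fin n)) :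
    ∫ w, F (x + w) ∂gaussianRn n (t + h) =
      ∫ y, ∫ z, F (x + y + z) ∂gaussianRn n h ∂gaussianRn n t := by
  have := isProbabilityMeasure_gaussianRn (n := n) ht
  have := isProbabilityMeasure_gaussianRn (n := n) hh
  rw [← mconvn_gaussianRn ht hh, integral_mconvn (F := fun w => F (x + w))
    (hF.comp_measurable (by fun_prop))]
  simp_rw [add_assoc]

lemma bddMeas_integral_add {ν : Measure (EuclideanSpace ℝ (Fin n))} [IsProbabilityMeasure ν]
    {F : EuclideanSpace ℝ (Fin n) → ℝ} (hF : BddMeas F) :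
    BddMeas (fun x => ∫ z, F (x + z) ∂ν) :=
  BddMeas.integral_right (F := fun p : _ × _ => F (p.1 + p.2))
    (hF.comp_measurable (by fun_prop)) ν

lemma bddMeas_entropy_add {ν : Measure (EuclideanSpace ℝ (Fin n))} [IsProbabilityMeasure ν]
    {g : EuclideanSpace ℝ (Fin n) → ℝ} (hg : BddMeas g) :
    BddMeas (fun x => entropy ν (fun z => g (x + z))) :=
  (bddMeas_integral_add hg.mul_log).sub (bddMeas_integral_add hg).mul_log

lemma entropy_gaussianRn_add_le (ht : 0 < t) (hh : 0 < h) {g : EuclideanSpace ℝ (Fin n) → ℝ}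
    (hg : BddMeas g) {ε : ℝ} (hε : 0 < ε) (h0 : ∀ x, ε ≤ g x) (x : EuclideanSpace ℝ (Fin n)) :
    entropy (gaussianRn n (t + h)) (fun w => g (x + w)) ≤
      ∫ y, entropy (gaussianRn n h) (fun z => g (x + y + z)) ∂gaussianRn n t +
      ∫ z, entropy (gaussianRn n t) (fun y => g (x + z + y)) ∂gaussianRn n h := by
  have := isProbabilityMeasure_gaussianRn (n := n) ht
  have := isProbabilityMeasure_gaussianRn (n := n) hh
  have key := entropy_integral_le (ν := gaussianRn n t) (ρ := gaussianRn n h)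
    (F := fun p : _ × _ => g (x + p.1 + p.2)) (hg.comp_measurable (by fun_prop)) hε
    (fun p => h0 _)
  have e : ∀ y z, x + y + z = x + z + y := fun y z => by abel
  have e' : ∀ z, entropy (gaussianRn n t) (fun y => g (x + z + y)) =
      entropy (gaussianRn n t) (fun y => g (x + y + z)) := fun z => by simp_rw [e z]
  simp_rw [e']
  refine le_trans ?_ (add_le_add le_rfl key)
  have b1 : BddMeas (fun y => ∫ z, g (x + y + z) * log (g (x + y + z)) ∂gaussianRn n h) :=
    (bddMeas_integral_add hg.mul_log).comp_measurable (u := fun y => x + y) (by fun_prop)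
  have b2 : BddMeas (fun y => ∫ z, g (x + y + z) ∂gaussianRn n h) :=
    (bddMeas_integral_add hg).comp_measurable (u := fun y => x + y) (by fun_prop)
  unfold entropy
  rw [integral_gaussianRn_add ht hh hg.mul_log, integral_gaussianRn_add ht hh hg,
    integral_sub (b1.integrable _) (b2.mul_log.integrable _)]
  linarith

/-- A bounded Lipschitz function `f` with a first order Taylor estimate, in which the function
`D` plays the role of the norm of the gradient. -/
structure TaylorBound (f D : EuclideanSpace ℝ (Fin n) → ℝ) (L K : ℝ) : Prop where
  bddMeas : BddMeas f
  measurable_slope : Measurable D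
  slope_nonneg : ∀ x, 0 ≤ D x
  slope_le : ∀ x, D x ≤ L
  lipschitz : ∀ x z, |f (x + z) - f x| ≤ L * ‖z‖
  taylor : ∀ x z, |f (x + z) - f x| ≤ D x * ‖z‖ + K * ‖z‖ ^ 2
  slope_lipschitz : ∀ x z, D x ≤ D (x + z) + K * ‖z‖
  nonneg : 0 ≤ K

namespace TaylorBound

variable {f D : EuclideanSpace ℝ (Fin n) → ℝ} {L K : ℝ}

lemma add_const (hf : TaylorBound f D L K) (c : ℝ) : TaylorBound (fun x => f x + c) D L K where
  bddMeas := hf.bddMeas.add (.const c)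
  measurable_slope := hf.measurable_slope
  slope_nonneg := hf.slope_nonneg
  slope_le := hf.slope_le
  lipschitz x z := by simpa using hf.lipschitz x z
  taylor x z := by simpa using hf.taylor x z
  slope_lipschitz := hf.slope_lipschitz
  nonneg := hf.nonneg

lemma bddMeas_slope (hf : TaylorBound f D L K) : BddMeas D :=
  ⟨hf.measurable_slope, L, fun x => by rw [abs_of_nonneg (hf.slope_nonneg x)]; exact hf.slope_le x⟩

/-- The log-Sobolev inequality for a Gaussian of small variance, up to a second order error. -/
lemma entropy_sq_add_le (hf : TaylorBound f D L K) (hh : 0 < h) {ε : ℝ} (hε : 0 < ε)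
    (x : EuclideanSpace ℝ (Fin n)) :
    entropy (gaussianRn n h) (fun z => f (x + z) ^ 2 + ε) ≤
      128 * h * 2 ^ ((n : ℝ) / 2) * ∫ z, D (x + z) ^ 2 ∂gaussianRn n h +
      (512 * K ^ 2 * (2 ^ ((n : ℝ) / 2)) ^ 2 +
        (16 * K ^ 2 + 2 * L ^ 4 / ε) * (32 * 2 ^ ((n : ℝ) / 2))) * h ^ 2 := by
  have := isProbabilityMeasure_gaussianRn (n := n) hh
  set M : ℝ := 2 ^ ((n : ℝ) / 2)
  have hM : 0 < M := rpow_pos_of_pos (by norm_num) _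
  have hfx : BddMeas (fun z => f (x + z)) := hf.bddMeas.comp_measurable (by fun_prop)
  have hDx : BddMeas (fun z => D (x + z)) := hf.bddMeas_slope.comp_measurable (by fun_prop)
  have m2 := integrable_sq_gaussianRn (n := n) hh
  have m4 := integrable_pow_four_gaussianRn (n := n) hh
  have m2' := integral_sq_gaussianRn_le (n := n) hh
  have m4' := integral_pow_four_gaussianRn_le (n := n) hh
  have hK := hf.nonneg
  have ha : 0 < f x ^ 2 + ε := by positivity
  have hg : BddMeas (fun z => f (x + z) ^ 2 + ε) := hfx.sq.add (.const ε)
  have hpt : ∀ z, (f (x + z) ^ 2 + ε - (f x ^ 2 + ε)) ^ 2 / (f x ^ 2 + ε) ≤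
      16 * D x ^ 2 * ‖z‖ ^ 2 + (16 * K ^ 2 + 2 * L ^ 4 / ε) * ‖z‖ ^ 4 := by
    intro z
    set e := f (x + z) - f x with he
    have hz := norm_nonneg z
    have e1 : e ^ 2 ≤ 2 * D x ^ 2 * ‖z‖ ^ 2 + 2 * K ^ 2 * ‖z‖ ^ 4 := by
      have h1 := pow_le_pow_left₀ (abs_nonneg _) (hf.taylor x z) 2
      rw [sq_abs] at h1
      nlinarith [sq_nonneg (D x * ‖z‖ - K * ‖z‖ ^ 2)]
    have e2 : e ^ 4 ≤ L ^ 4 * ‖z‖ ^ 4 := by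
      have h1 := pow_le_pow_left₀ (abs_nonneg _) (hf.lipschitz x z) 4
      rwa [Even.pow_abs (by decide), mul_pow] at h1
    have e3 : (f (x + z) ^ 2 + ε - (f x ^ 2 + ε)) ^ 2 / (f x ^ 2 + ε) ≤
        8 * e ^ 2 + 2 * e ^ 4 / ε := by
      rw [div_le_iff₀ ha]
      have : f (x + z) = f x + e := by rw [he]; ring
      rw [this]
      have h4 : 2 * e ^ 4 / ε * (f x ^ 2 + ε) = 2 * e ^ 4 + 2 * e ^ 4 / ε * f x ^ 2 := by
        field_simp
        ring
      have h5 : 0 ≤ 2 * e ^ 4 / ε * f x ^ 2 := by positivity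
      rw [add_mul, h4]
      nlinarith [sq_nonneg (2 * f x * e - e ^ 2), mul_nonneg hε.le (sq_nonneg e)]
    have e4 : 2 * e ^ 4 / ε ≤ 2 * L ^ 4 / ε * ‖z‖ ^ 4 := by
      rw [div_mul_eq_mul_div]
      exact div_le_div_of_nonneg_right (by linarith) hε.le
    linarith
  have h1 := entropy_le_integral_sq_div (ν := gaussianRn n h) ha hg
    (fun z => by positivity)
  have i1 : Integrable (fun z => (f (x + z) ^ 2 + ε - (f x ^ 2 + ε)) ^ 2 / (f x ^ 2 + ε))
      (gaussianRn n h) := ((hg.sub (.const _)).sq.integrable _).div_const _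
  have h2 := integral_mono i1 ((m2.const_mul (16 * D x ^ 2)).add
    (m4.const_mul (16 * K ^ 2 + 2 * L ^ 4 / ε))) hpt
  rw [integral_add' (m2.const_mul _) (m4.const_mul _), integral_const_mul, integral_const_mul]
    at h2
  have h3 : D x ^ 2 ≤ 2 * ∫ z, D (x + z) ^ 2 ∂gaussianRn n h + 2 * K ^ 2 * (4 * h * M) := by
    have hpt' : ∀ z, D x ^ 2 ≤ 2 * D (x + z) ^ 2 + 2 * K ^ 2 * ‖z‖ ^ 2 := fun z => by
      have h1 := pow_le_pow_left₀ (hf.slope_nonneg x) (hf.slope_lipschitz x z) 2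
      nlinarith [sq_nonneg (D (x + z) - K * ‖z‖)]
    have i2 := (hDx.sq.integrable (gaussianRn n h)).const_mul 2
    have h4 := integral_mono (integrable_const _) (i2.add (m2.const_mul (2 * K ^ 2))) hpt'
    rw [integral_add' i2 (m2.const_mul _), integral_const_mul, integral_const_mul] at h4
    simp only [integral_const, probReal_univ, smul_eq_mul, one_mul] at h4
    nlinarith [sq_nonneg K]
  have hc : 0 ≤ 16 * K ^ 2 + 2 * L ^ 4 / ε := by positivity
  have h5 := mul_le_mul_of_nonneg_left m4' hc
  have h6 := mul_le_mul_of_nonneg_left m2' (show 0 ≤ 16 * D x ^ 2 by positivity)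
  have h7 := mul_le_mul_of_nonneg_right h3 (show 0 ≤ 64 * h * M by positivity)
  nlinarith

lemma entropy_sq_add_le_of_pos (hf : TaylorBound f D L K) (ht : 0 < t) {ε : ℝ} (hε : 0 < ε)
    (x : EuclideanSpace ℝ (Fin n)) :
    entropy (gaussianRn n t) (fun z => f (x + z) ^ 2 + ε) ≤
      128 * t * 2 ^ ((n : ℝ) / 2) * ∫ z, D (x + z) ^ 2 ∂gaussianRn n t := by
  obtain ⟨A, hA⟩ : ∃ A, A = 512 * K ^ 2 * (2 ^ ((n : ℝ) / 2)) ^ 2 +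
    (16 * K ^ 2 + 2 * L ^ 4 / ε) * (32 * 2 ^ ((n : ℝ) / 2)) := ⟨_, rfl⟩
  set M : ℝ := 2 ^ ((n : ℝ) / 2) with hM
  have hg : BddMeas (fun x => f x ^ 2 + ε) := hf.bddMeas.sq.add (.const ε)
  have hD := hf.bddMeas_slope.sq
  have key : ∀ h > 0, ∀ (k : ℕ) x, entropy (gaussianRn n ((k + 1) * h))
      (fun z => f (x + z) ^ 2 + ε) ≤ (k + 1) *
        (128 * h * M * ∫ z, D (x + z) ^ 2 ∂gaussianRn n ((k + 1) * h) + A * h ^ 2) := by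
    intro h hh k
    induction k with
    | zero =>
      intro x
      simp only [Nat.cast_zero, zero_add, one_mul]
      rw [hA, hM]
      exact hf.entropy_sq_add_le hh hε x
    | succ k ih =>
      intro x
      have hk : 0 < ((k : ℝ) + 1) * h := by positivity
      have := isProbabilityMeasure_gaussianRn (n := n) hh
      have := isProbabilityMeasure_gaussianRn (n := n) hk
      have e : (((k + 1 : ℕ) : ℝ) + 1) * h = (k + 1) * h + h := by push_cast; ring
      have e' : h + (k + 1) * h = (k + 1) * h + h := by ring
      rw [e]
      set T := ((k : ℝ) + 1) * h
      have h1 := entropy_gaussianRn_add_le hk hh hg hε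
        (fun x => le_add_of_nonneg_left (sq_nonneg (f x))) x
      have bD : ∀ ν : Measure (EuclideanSpace ℝ (Fin n)), IsProbabilityMeasure ν →
          BddMeas (fun y => ∫ z, D (x + y + z) ^ 2 ∂ν) := fun ν _ =>
        (bddMeas_integral_add hD).comp_measurable (u := fun y => x + y) (by fun_prop)
      have bE : ∀ ν : Measure (EuclideanSpace ℝ (Fin n)), IsProbabilityMeasure ν →
          BddMeas (fun y => entropy ν (fun z => f (x + y + z) ^ 2 + ε)) := fun ν _ =>
        (bddMeas_entropy_add hg).comp_measurable (u := fun y => x + y) (by fun_prop)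
      have h2 : ∫ y, entropy (gaussianRn n h) (fun z => f (x + y + z) ^ 2 + ε) ∂gaussianRn n T ≤
          128 * h * M * ∫ z, D (x + z) ^ 2 ∂gaussianRn n (T + h) + A * h ^ 2 := by
        rw [integral_gaussianRn_add hk hh hD x]
        have i := ((bD (gaussianRn n h) ‹_›).integrable (gaussianRn n T)).const_mul (128 * h * M)
        have h3 := integral_mono ((bE (gaussianRn n h) ‹_›).integrable (gaussianRn n T))
          (i.add (integrable_const (A * h ^ 2)))
          (fun y => by rw [hA, hM]; exact hf.entropy_sq_add_le hh hε (x + y))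
        rw [integral_add' i (integrable_const _), integral_const_mul] at h3
        simpa using h3
      have h3 : ∫ y, entropy (gaussianRn n T) (fun z => f (x + y + z) ^ 2 + ε) ∂gaussianRn n h ≤
          (k + 1) * (128 * h * M * ∫ z, D (x + z) ^ 2 ∂gaussianRn n (T + h) + A * h ^ 2) := by
        rw [← e', integral_gaussianRn_add hh hk hD x]
        have i := ((bD (gaussianRn n T) ‹_›).integrable (gaussianRn n h)).const_mul (128 * h * M)
        have h3 := integral_mono ((bE (gaussianRn n T) ‹_›).integrable (gaussianRn n h))
          ((i.add (integrable_const (A * h ^ 2))).const_mul ((k : ℝ) + 1))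
          (fun y => ih (x + y))
        rw [integral_const_mul, integral_add' i (integrable_const _), integral_const_mul] at h3
        simpa using h3
      push_cast
      linarith
  have hlim : Filter.Tendsto (fun k : ℕ => 128 * t * M * ∫ z, D (x + z) ^ 2 ∂gaussianRn n t +
      A * t ^ 2 * (1 / ((k : ℝ) + 1))) Filter.atTop
      (nhds (128 * t * M * ∫ z, D (x + z) ^ 2 ∂gaussianRn n t)) := by
    simpa using (tendsto_one_div_add_atTop_nhds_zero_nat (𝕜 := ℝ)).const_mul (A * t ^ 2)
      |>.const_add (128 * t * M * ∫ z, D (x + z) ^ 2 ∂gaussianRn n t)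
  refine ge_of_tendsto hlim (.of_forall fun k => ?_)
  have hk : (0 : ℝ) < k + 1 := by positivity
  have h1 := key (t / (k + 1)) (by positivity) k x
  rw [mul_div_cancel₀ _ hk.ne'] at h1
  refine h1.trans (le_of_eq ?_)
  field_simp

/-- The log-Sobolev inequality for the Gaussian measure of variance `t` centered at `x`. -/
lemma entropy_sq_le (hf : TaylorBound f D L K) (ht : 0 < t) (x : EuclideanSpace ℝ (Fin n)) :
    entropy (gaussianRn n t) (fun z => f (x + z) ^ 2) ≤
      128 * t * 2 ^ ((n : ℝ) / 2) * ∫ z, D (x + z) ^ 2 ∂gaussianRn n t := by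
  have := isProbabilityMeasure_gaussianRn (n := n) ht
  exact entropy_le_of_forall_entropy_add_le
    (hf.bddMeas.sq.comp_measurable (u := fun z => x + z) (by fun_prop))
    fun ε hε => hf.entropy_sq_add_le_of_pos ht hε x

end TaylorBound

end GaussianLogSobolev

section Mixture

open scoped RealInnerProductSpace

lemma sq_integral_mul_le {α : Type*} [MeasurableSpace α] {ν : Measure α} {a b : α → ℝ}
    (ha : Integrable (fun x => a x ^ 2) ν) (hb : Integrable (fun x => b x ^ 2) ν)
    (hab : Integrable (fun x => a x * b x) ν) :
    (∫ x, a x * b x ∂ν) ^ 2 ≤ (∫ x, a x ^ 2 ∂ν) * ∫ x, b x ^ 2 ∂ν := by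
  have h : ∀ s : ℝ, 0 ≤ (∫ x, a x ^ 2 ∂ν) * (s * s) + (2 * ∫ x, a x * b x ∂ν) * s +
      ∫ x, b x ^ 2 ∂ν := fun s => by
    have h1 : 0 ≤ ∫ x, (s * a x + b x) ^ 2 ∂ν := integral_nonneg fun x => sq_nonneg _
    have e : ∀ x, (s * a x + b x) ^ 2 =
        (((fun x => (s * s) * a x ^ 2) + fun x => (2 * s) * (a x * b x)) +
          fun x => b x ^ 2) x := fun x => by simp only [Pi.add_apply]; ring
    rw [integral_congr_ae (.of_forall e),
      integral_add' ((ha.const_mul _).add (hab.const_mul _)) hb,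
      integral_add' (ha.const_mul _) (hab.const_mul _), integral_const_mul,
      integral_const_mul] at h1
    linarith
  have := discrim_le_zero h
  unfold discrim at this
  linarith

lemma integral_add_mul_add {α : Type*} [MeasurableSpace α] {ν : Measure α}
    [IsProbabilityMeasure ν] {a b : α → ℝ} (ha : Integrable a ν) (hb : Integrable b ν) (q r : ℝ) :
    ∫ x, (a x + q * b x + r) ∂ν = ∫ x, a x ∂ν + q * ∫ x, b x ∂ν + r := by
  rw [integral_add (f := fun x => a x + q * b x) (ha.add (hb.const_mul q)) (integrable_const r),
    integral_add ha (hb.const_mul q), integral_const_mul]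
  simp

variable {n : ℕ} {t : ℝ} {f : EuclideanSpace ℝ (Fin n) → ℝ}

/-- The difference of the means of `f` under two translates of a Gaussian measure. -/
lemma sq_integral_add_sub_le (ht : 0 < t) (hf : BddMeas f) (d : EuclideanSpace ℝ (Fin n)) :
    (∫ z, f (z + d) ∂gaussianRn n t - ∫ z, f z ∂gaussianRn n t) ^ 2 ≤
      (∫ z, f z ^ 2 ∂gaussianRn n t - (∫ z, f z ∂gaussianRn n t) ^ 2) *
        (exp (‖d‖ ^ 2 / t) - 1) := by
  have := isProbabilityMeasure_gaussianRn (n := n) ht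
  set γ := gaussianRn n t
  set m := ∫ z, f z ∂γ with hm
  have hL := integrable_shiftDensity (n := n) ht d
  have hL2 := integrable_shiftDensity_sq (n := n) ht d
  have hfm : BddMeas (fun z => f z - m) := hf.sub (.const m)
  have iL1 : Integrable (fun z => shiftDensity t d z - 1) γ := hL.sub (integrable_const 1)
  have e2 : ∀ z, (shiftDensity t d z - 1) ^ 2 =
      shiftDensity t d z ^ 2 + (-2) * shiftDensity t d z + 1 := fun z => by ring
  have iL2 : Integrable (fun z => (shiftDensity t d z - 1) ^ 2) γ := by
    simp only [e2]
    exact (hL2.add (hL.const_mul (-2))).add (integrable_const 1)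
  have hinteg : ∀ {w : EuclideanSpace ℝ (Fin n) → ℝ} {F : EuclideanSpace ℝ (Fin n) → ℝ},
      BddMeas F → Integrable w γ → Integrable (fun z => F z * w z) γ := by
    rintro w F ⟨hFm, C, hC⟩ hw
    exact hw.bdd_mul hFm.aestronglyMeasurable (.of_forall hC)
  have h1 := sq_integral_mul_le (hfm.sq.integrable γ) iL2 (hinteg hfm iL1)
  have v1 : ∫ z, (f z - m) ^ 2 ∂γ = ∫ z, f z ^ 2 ∂γ - m ^ 2 := by
    have e : ∀ z, (f z - m) ^ 2 = f z ^ 2 + (-2 * m) * f z + m ^ 2 := fun z => by ring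
    simp only [e]
    rw [integral_add_mul_add (hf.sq.integrable γ) (hf.integrable γ), ← hm]
    ring
  have v2 : ∫ z, (shiftDensity t d z - 1) ^ 2 ∂γ = exp (‖d‖ ^ 2 / t) - 1 := by
    simp only [e2]
    rw [integral_add_mul_add hL2 hL, integral_shiftDensity ht, integral_shiftDensity_sq ht]
    ring
  have v3 : ∫ z, (f z - m) * (shiftDensity t d z - 1) ∂γ = ∫ z, f (z + d) ∂γ - m := by
    rw [integral_add_gaussianRn ht]
    have e : ∀ z, (f z - m) * (shiftDensity t d z - 1) =
        (f z * shiftDensity t d z - f z) + (-m) * shiftDensity t d z + m := fun z => by ring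
    simp only [e]
    rw [integral_add_mul_add (a := fun z => f z * shiftDensity t d z - f z)
      ((hinteg hf hL).sub (hf.integrable γ)) hL, integral_shiftDensity ht, integral_sub
      (hinteg hf hL) (hf.integrable γ), ← hm]
    ring
  rwa [v1, v2, v3] at h1

lemma integral_add_eq_zero (ht : 0 < t) (hf : BddMeas f) (h0 : ∀ x, 0 ≤ f x)
    (h : ∫ z, f z ∂gaussianRn n t = 0) (d : EuclideanSpace ℝ (Fin n)) :
    ∫ z, f (z + d) ∂gaussianRn n t = 0 := by
  have := isProbabilityMeasure_gaussianRn (n := n) ht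
  rw [integral_add_gaussianRn ht]
  refine integral_eq_zero_of_ae ?_
  filter_upwards [(integral_eq_zero_iff_of_nonneg h0 (hf.integrable _)).mp h] with z hz
  simp [show f z = 0 from hz]

/-- Comparison of the logarithms of the means of `g` under two translates of a Gaussian. -/
lemma integral_mul_log_sub_le (ht : 0 < t) {g : EuclideanSpace ℝ (Fin n) → ℝ} (hg : BddMeas g)
    (h0 : ∀ x, 0 ≤ g x) (d : EuclideanSpace ℝ (Fin n))
    (hpos : 0 < ∫ z, g (z + d) ∂gaussianRn n t) :
    ∫ z, g z * log (g z) ∂gaussianRn n t -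
        (∫ z, g z ∂gaussianRn n t) * log (∫ z, g (z + d) ∂gaussianRn n t) ≤
      3 * entropy (gaussianRn n t) g + (n + ‖d‖ ^ 2 / t) * ∫ z, g z ∂gaussianRn n t := by
  have := isProbabilityMeasure_gaussianRn (n := n) ht
  rw [integral_add_gaussianRn ht] at hpos ⊢
  set γ := gaussianRn n t
  set G := ∫ z, g z ∂γ with hG
  have hG0 : 0 ≤ G := integral_nonneg h0
  have hinteg : ∀ {w : EuclideanSpace ℝ (Fin n) → ℝ}, Integrable w γ →
      Integrable (fun z => g z * w z) γ := by
    obtain ⟨hm, C, hC⟩ := hg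
    exact fun hw => hw.bdd_mul hm.aestronglyMeasurable (.of_forall hC)
  have m2 := integrable_sq_gaussianRn (n := n) ht
  have iin : Integrable (fun z => ⟪d, z⟫ / t - ‖d‖ ^ 2 / (2 * t)) γ := by
    refine Integrable.sub (Integrable.div_const ?_ _) (integrable_const _)
    refine (m2.add (integrable_const (‖d‖ ^ 2))).mono' (by fun_prop) (.of_forall fun z => ?_)
    rw [norm_eq_abs]
    refine (abs_real_inner_le_norm d z).trans ?_
    simp only [Pi.add_apply]
    nlinarith [sq_nonneg (‖d‖ - ‖z‖), sq_nonneg (‖d‖ + ‖z‖)]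
  have e : ∀ z, g z * log (g z * shiftDensity t d z) =
      g z * log (g z) + g z * (⟪d, z⟫ / t - ‖d‖ ^ 2 / (2 * t)) := fun z => by
    rcases (h0 z).eq_or_lt with h | h
    · simp [← h]
    · rw [shiftDensity, log_mul h.ne' (exp_pos _).ne', log_exp]
      ring
  have i0 := hg.mul_log.integrable γ
  have h1 := integral_mul_log_le (w := fun z => g z * shiftDensity t d z) hg h0
    (hinteg (integrable_shiftDensity ht d))
    (by simp_rw [e]; exact i0.add (hinteg iin))
    (fun z => mul_nonneg (h0 z) (exp_pos _).le)
    (fun z hz => (mul_eq_zero.mp hz).resolve_right (exp_pos _).ne') hpos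
  simp_rw [e] at h1
  rw [integral_add i0 (hinteg iin), ← hG] at h1
  have i2 : Integrable (fun z => ‖z‖ ^ 2 / (4 * t)) γ := m2.div_const _
  have h2 := integral_mul_log_le (w := fun z => exp (‖z‖ ^ 2 / (4 * t))) hg h0
    (integrable_exp_sq_gaussianRn ht) (by simp_rw [log_exp]; exact hinteg i2)
    (fun z => (exp_pos _).le) (fun z hz => absurd hz (exp_pos _).ne')
    (by rw [integral_exp_sq_gaussianRn ht]; exact rpow_pos_of_pos (by norm_num) _)
  simp_rw [log_exp] at h2
  rw [integral_exp_sq_gaussianRn ht, log_rpow (by norm_num), ← hG] at h2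
  have h3 : -(2 * ∫ z, g z * (‖z‖ ^ 2 / (4 * t)) ∂γ + G * (‖d‖ ^ 2 / t)) ≤
      ∫ z, g z * (⟪d, z⟫ / t - ‖d‖ ^ 2 / (2 * t)) ∂γ := by
    rw [← integral_const_mul, hG, ← integral_mul_const,
      ← integral_add ((hinteg i2).const_mul 2) ((hg.integrable γ).mul_const _), ← integral_neg]
    refine integral_mono (((hinteg i2).const_mul 2).add ((hg.integrable γ).mul_const _)).neg
      (hinteg iin) fun z => ?_
    have h5 : -(‖z‖ ^ 2 / (2 * t) + ‖d‖ ^ 2 / t) ≤ ⟪d, z⟫ / t - ‖d‖ ^ 2 / (2 * t) := by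
      have h6 : -(‖d‖ * ‖z‖) ≤ ⟪d, z⟫ := (abs_le.mp (abs_real_inner_le_norm d z)).1
      have h7 : 0 ≤ (2 * ⟪d, z⟫ + ‖z‖ ^ 2 + ‖d‖ ^ 2) / (2 * t) := by
        refine div_nonneg ?_ (by positivity)
        nlinarith [sq_nonneg (‖d‖ - ‖z‖)]
      have h8 : (2 * ⟪d, z⟫ + ‖z‖ ^ 2 + ‖d‖ ^ 2) / (2 * t) =
        ⟪d, z⟫ / t - ‖d‖ ^ 2 / (2 * t) + (‖z‖ ^ 2 / (2 * t) + ‖d‖ ^ 2 / t) := by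
        field_simp
        ring
      linarith
    have h9 := mul_le_mul_of_nonneg_left h5 (h0 z)
    refine le_trans (le_of_eq ?_) h9
    field_simp
    ring
  have hl2 : G * (n / 2 * log 2) ≤ G * (n / 2) := by
    refine mul_le_mul_of_nonneg_left ?_ hG0
    have : log 2 ≤ 1 := by linarith [log_two_lt_d9]
    nlinarith [n.cast_nonneg (α := ℝ)]
  have hE : entropy γ g = ∫ z, g z * log (g z) ∂γ - G * log G := rfl
  linarith

variable {D : EuclideanSpace ℝ (Fin n) → ℝ} {L K : ℝ}

/-- The Poincaré inequality for a Gaussian measure. -/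
lemma TaylorBound.variance_le (hf : TaylorBound f D L K) (ht : 0 < t)
    (x : EuclideanSpace ℝ (Fin n)) :
    ∫ z, f (x + z) ^ 2 ∂gaussianRn n t - (∫ z, f (x + z) ∂gaussianRn n t) ^ 2 ≤
      128 * t * 2 ^ ((n : ℝ) / 2) * ∫ z, D (x + z) ^ 2 ∂gaussianRn n t := by
  have := isProbabilityMeasure_gaussianRn (n := n) ht
  obtain ⟨C, hC⟩ := hf.bddMeas.2
  have hfx : BddMeas (fun z => f (x + z)) := hf.bddMeas.comp_measurable (by fun_prop)
  have h1 := (variance_le_entropy_sq (ν := gaussianRn n t) (hfx.add (.const C))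
    fun z => by linarith [(abs_le.mp (hC (x + z))).1]).trans ((hf.add_const C).entropy_sq_le ht x)
  refine le_trans (le_of_eq ?_) h1
  have e : ∀ z, (f (x + z) + C) ^ 2 = f (x + z) ^ 2 + (2 * C) * f (x + z) + C ^ 2 :=
    fun z => by ring
  have i := hfx.integrable (gaussianRn n t)
  simp only [e]
  rw [integral_add_mul_add (hfx.sq.integrable _) i, integral_add i (integrable_const _)]
  simp
  ring

variable {μ : Measure (EuclideanSpace ℝ (Fin n))} [IsProbabilityMeasure μ]
  {x₀ : EuclideanSpace ℝ (Fin n)} {R : ℝ}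

/-- The Poincaré inequality for the convolution of `μ` with a Gaussian measure. -/
lemma TaylorBound.variance_mconvn_le (hf : TaylorBound f D L K) (ht : 0 < t)
    (hμ : ∀ᵐ x ∂μ, ‖x - x₀‖ ≤ R) :
    ∫ y, (f y - ∫ y, f y ∂mconvn μ (gaussianRn n t)) ^ 2 ∂mconvn μ (gaussianRn n t) ≤
      exp (R ^ 2 / t) * (128 * t * 2 ^ ((n : ℝ) / 2) *
        ∫ y, D y ^ 2 ∂mconvn μ (gaussianRn n t)) := by
  have := isProbabilityMeasure_gaussianRn (n := n) ht
  have := isProbabilityMeasure_mconvn (ν := μ) (ρ := gaussianRn n t)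
  set C := 128 * t * (2 : ℝ) ^ ((n : ℝ) / 2)
  set γ := gaussianRn n t
  set ν := mconvn μ γ
  set c := ∫ z, f (x₀ + z) ∂γ
  have hfB := hf.bddMeas
  have h1 : ∫ y, (f y - ∫ y, f y ∂ν) ^ 2 ∂ν ≤ ∫ y, (f y - c) ^ 2 ∂ν := by
    have e : ∀ b, ∫ y, (f y - b) ^ 2 ∂ν = ∫ y, f y ^ 2 ∂ν - 2 * b * ∫ y, f y ∂ν + b ^ 2 := by
      intro b
      have e : ∀ y, (f y - b) ^ 2 = f y ^ 2 + (-(2 * b)) * f y + b ^ 2 := fun y => by ring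
      simp only [e]
      rw [integral_add_mul_add (hfB.sq.integrable ν) (hfB.integrable ν)]
      ring
    rw [e, e]
    nlinarith [sq_nonneg (∫ y, f y ∂ν - c)]
  refine h1.trans ?_
  rw [integral_mconvn (hfB.sub (.const c)).sq, integral_mconvn hf.bddMeas_slope.sq,
    ← integral_const_mul, ← integral_const_mul]
  refine integral_mono_ae
    ((bddMeas_integral_add (hfB.sub (.const c)).sq).integrable μ)
    ((((bddMeas_integral_add hf.bddMeas_slope.sq).integrable μ).const_mul C).const_mul _) ?_
  filter_upwards [hμ] with x hx
  have hfx : BddMeas (fun z => f (x + z)) := hfB.comp_measurable (by fun_prop)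
  have h2 := sq_integral_add_sub_le ht hfx (x₀ - x)
  have e : ∀ z, x + (z + (x₀ - x)) = x₀ + z := fun z => by abel
  simp_rw [e] at h2
  have h3 : exp (‖x₀ - x‖ ^ 2 / t) ≤ exp (R ^ 2 / t) := by
    rw [norm_sub_rev]
    gcongr
  have h4 := hf.variance_le ht x
  have h5 : ∫ z, (f (x + z) - c) ^ 2 ∂γ =
      (∫ z, f (x + z) ^ 2 ∂γ - (∫ z, f (x + z) ∂γ) ^ 2) + (c - ∫ z, f (x + z) ∂γ) ^ 2 := by
    have e : ∀ z, (f (x + z) - c) ^ 2 = f (x + z) ^ 2 + (-(2 * c)) * f (x + z) + c ^ 2 :=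
      fun y => by ring
    simp only [e]
    rw [integral_add_mul_add (hfx.sq.integrable γ) (hfx.integrable γ)]
    ring
  have h6 : 0 ≤ ∫ z, f (x + z) ^ 2 ∂γ - (∫ z, f (x + z) ∂γ) ^ 2 := by
    have := sq_integral_mul_le (ν := γ) (a := fun z => f (x + z)) (b := fun _ => 1)
      (hfx.sq.integrable γ) (by simp) (by simpa using hfx.integrable γ)
    simp at this
    linarith
  rw [h5]
  nlinarith [exp_pos (R ^ 2 / t)]

/-- A defective log-Sobolev inequality for the convolution of `μ` with a Gaussian measure. -/
lemma TaylorBound.entropy_sq_mconvn_le (hf : TaylorBound f D L K) (ht : 0 < t)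
    (hμ : ∀ᵐ x ∂μ, ‖x - x₀‖ ≤ R) :
    entropy (mconvn μ (gaussianRn n t)) (fun y => f y ^ 2) ≤
      3 * (128 * t * 2 ^ ((n : ℝ) / 2) * ∫ y, D y ^ 2 ∂mconvn μ (gaussianRn n t)) +
      (n + 4 * R ^ 2 / t) * ∫ y, f y ^ 2 ∂mconvn μ (gaussianRn n t) := by
  have := isProbabilityMeasure_gaussianRn (n := n) ht
  have hfB := hf.bddMeas
  have hDB := hf.bddMeas_slope
  set C := 128 * t * (2 : ℝ) ^ ((n : ℝ) / 2) with hC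
  have hC0 : 0 < C := by positivity
  unfold entropy
  rw [integral_mconvn hfB.sq, integral_mconvn hfB.sq.mul_log, integral_mconvn hDB.sq]
  set γ := gaussianRn n t
  set A := n + 4 * R ^ 2 / t with hA
  set G := fun x => ∫ z, f (x + z) ^ 2 ∂γ with hGdef
  set H := fun x => ∫ z, D (x + z) ^ 2 ∂γ with hHdef
  set P := fun x => ∫ z, f (x + z) ^ 2 * log (f (x + z) ^ 2) ∂γ with hPdef
  have bG : BddMeas G := bddMeas_integral_add hfB.sq
  have bH : BddMeas H := bddMeas_integral_add hDB.sq
  have bP : BddMeas P := bddMeas_integral_add hfB.sq.mul_log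
  have hG0 : ∀ x, 0 ≤ G x := fun x => integral_nonneg fun z => sq_nonneg _
  have hfx : ∀ x, BddMeas (fun z => f (x + z) ^ 2) := fun x =>
    hfB.sq.comp_measurable (by fun_prop)
  have hpos : ∀ x, 0 < ∫ x, G x ∂μ → 0 < G x := by
    intro x hx
    refine (hG0 x).lt_of_ne fun h => hx.ne' (integral_eq_zero_of_ae (.of_forall fun x' => ?_))
    have h1 := integral_add_eq_zero ht (hfx x) (fun z => sq_nonneg _) h.symm (x' - x)
    have e : ∀ z, x + (z + (x' - x)) = x' + z := fun z => by abel
    simp only [e] at h1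
    exact h1
  change ∫ x, P x ∂μ - (∫ x, G x ∂μ) * log (∫ x, G x ∂μ) ≤
    3 * (C * ∫ x, H x ∂μ) + A * ∫ x, G x ∂μ
  have hH0 : ∀ x, 0 ≤ H x := fun x => integral_nonneg fun z => sq_nonneg _
  rcases (integral_nonneg hG0 : 0 ≤ ∫ x, G x ∂μ).eq_or_lt with h | h
  · have hz := (integral_eq_zero_iff_of_nonneg hG0 (bG.integrable μ)).mp h.symm
    have hP : ∫ x, P x ∂μ = 0 := by
      refine integral_eq_zero_of_ae ?_
      filter_upwards [hz] with x hx
      have h1 := (integral_eq_zero_iff_of_nonneg (fun z => sq_nonneg (f (x + z)))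
        ((hfx x).integrable γ)).mp hx
      refine integral_eq_zero_of_ae ?_
      filter_upwards [h1] with z hz
      have : f (x + z) ^ 2 = 0 := hz
      simp [this]
    rw [hP, ← h]
    have : 0 ≤ ∫ x, H x ∂μ := integral_nonneg hH0
    have : 0 ≤ C * ∫ x, H x ∂μ := by positivity
    linarith
  have key : ∀ᵐ x ∂μ, P x - G x * log (∫ x, G x ∂μ) ≤ 3 * (C * H x) + A * G x := by
    filter_upwards [hμ] with x hx
    have hGx := hpos x h
    have h1 : ∀ᵐ x' ∂μ, exp ((P x - (3 * (C * H x) + A * G x)) / G x) ≤ G x' := by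
      filter_upwards [hμ] with x' hx'
      have hGx' := hpos x' h
      rw [← le_log_iff_exp_le hGx', div_le_iff₀ hGx]
      have e : ∀ z, x + (z + (x' - x)) = x' + z := fun z => by abel
      have h2 := integral_mul_log_sub_le ht (hfx x) (fun z => sq_nonneg _) (x' - x)
        (by simp_rw [e]; exact hGx')
      simp_rw [e] at h2
      change P x - G x * log (G x') ≤ 3 * entropy γ (fun z => f (x + z) ^ 2) +
        (n + ‖x' - x‖ ^ 2 / t) * G x at h2
      have h3 : entropy γ (fun z => f (x + z) ^ 2) ≤ C * H x := hf.entropy_sq_le ht x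
      have h4 : ‖x' - x‖ ≤ 2 * R := by
        have : x' - x = (x' - x₀) - (x - x₀) := by abel
        rw [this]
        exact (norm_sub_le _ _).trans (by linarith)
      have h5 : ‖x' - x‖ ^ 2 / t ≤ 4 * R ^ 2 / t := by
        refine div_le_div_of_nonneg_right ?_ ht.le
        nlinarith [norm_nonneg (x' - x)]
      have h6 := mul_le_mul_of_nonneg_right h5 hGx.le
      nlinarith
    have h2 := integral_mono_ae (integrable_const _) (bG.integrable μ) h1
    simp only [integral_const, probReal_univ, smul_eq_mul, one_mul] at h2
    rw [← le_log_iff_exp_le h, div_le_iff₀ hGx] at h2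
    linarith
  have iH := ((bH.integrable μ).const_mul C).const_mul 3
  have iG := (bG.integrable μ).const_mul A
  have iGl := (bG.integrable μ).mul_const (log (∫ x, G x ∂μ))
  have h3 := integral_mono_ae ((bP.integrable μ).sub iGl) (iH.add iG) key
  rwa [integral_add' iH iG, integral_sub' (bP.integrable μ) iGl, integral_mul_const,
    integral_const_mul, integral_const_mul, integral_const_mul] at h3

/-- The log-Sobolev inequality for the convolution of `μ` with a Gaussian measure. -/
lemma TaylorBound.entropy_sq_mconvn_le_of_tight (hf : TaylorBound f D L K) (ht : 0 < t)
    (hμ : ∀ᵐ x ∂μ, ‖x - x₀‖ ≤ R) :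
    entropy (mconvn μ (gaussianRn n t)) (fun y => f y ^ 2) ≤
      (3 + (n + 4 * R ^ 2 / t + 10) * exp (R ^ 2 / t)) * (128 * t * 2 ^ ((n : ℝ) / 2)) *
        ∫ y, D y ^ 2 ∂mconvn μ (gaussianRn n t) := by
  have := isProbabilityMeasure_gaussianRn (n := n) ht
  have := isProbabilityMeasure_mconvn (ν := μ) (ρ := gaussianRn n t)
  have h1 := entropy_sq_le_entropy_sq_sub_mean (ν := mconvn μ (gaussianRn n t)) hf.bddMeas
  have h2 := (hf.add_const (-∫ y, f y ∂mconvn μ (gaussianRn n t))).entropy_sq_mconvn_le ht hμ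
  have h3 := hf.variance_mconvn_le ht hμ
  simp only [← sub_eq_add_neg] at h2
  have h4 : (0 : ℝ) ≤ n + 4 * R ^ 2 / t + 10 := by positivity
  have h5 := mul_le_mul_of_nonneg_left h3 h4
  linarith

end Mixture

section Main

variable {n : ℕ}

lemma exists_taylorBound {f : EuclideanSpace ℝ (Fin n) → ℝ} (hf : ContDiff ℝ (⊤ : ℕ∞) f)
    (hs : HasCompactSupport f) : ∃ L K, TaylorBound f (fun x => ‖gradient f x‖) L K := by
  have hgr : ∀ x, ‖gradient f x‖ = ‖fderiv ℝ f x‖ := fun x => by simp [gradient]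
  have hf1 : ContDiff ℝ 1 (fderiv ℝ f) := hf.fderiv_right (by norm_cast)
  have hs1 := hs.fderiv ℝ
  have hd : Differentiable ℝ f := hf.differentiable (by simp)
  obtain ⟨K, hK⟩ := hf1.lipschitzWith_of_hasCompactSupport hs1 (by simp)
  obtain ⟨L, hL⟩ := hs1.exists_bound_of_continuous hf1.continuous
  obtain ⟨B, hB⟩ := hs.exists_bound_of_continuous hf.continuous
  have hKz : ∀ x z, ‖fderiv ℝ f (x + z) - fderiv ℝ f x‖ ≤ K * ‖z‖ := fun x z => by
    simpa [dist_eq_norm] using hK.dist_le_mul (x + z) x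
  simp_rw [hgr]
  refine ⟨L, K, ⟨hf.continuous.measurable, B, hB⟩, hf1.continuous.norm.measurable,
    fun x => norm_nonneg _, hL, fun x z => ?_, fun x z => ?_, fun x z => ?_, K.2⟩
  · have := convex_univ.norm_image_sub_le_of_norm_fderiv_le (𝕜 := ℝ) (f := f) (C := L)
      (fun y _ => hd y) (fun y _ => hL y) (Set.mem_univ x) (Set.mem_univ (x + z))
    simpa using this
  · have := (convex_closedBall x ‖z‖).norm_image_sub_le_of_norm_fderiv_le (𝕜 := ℝ) (f := f)
      (C := ‖fderiv ℝ f x‖ + K * ‖z‖) (x := x) (y := x + z)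
      (fun y _ => hd y) (fun y hy => ?_) (by simp) (by simp)
    · rw [add_sub_cancel_left, norm_eq_abs] at this
      linarith
    · have h1 := hKz x (y - x)
      rw [add_sub_cancel] at h1
      have h2 : ‖y - x‖ ≤ ‖z‖ := by simpa [dist_eq_norm] using hy
      have h3 := mul_le_mul_of_nonneg_left h2 K.2
      have h4 := norm_le_norm_add_norm_sub' (fderiv ℝ f y) (fderiv ℝ f x)
      simp only [NNReal.val_eq_coe] at h3
      linarith
  · have h1 := hKz x z
    have h4 := norm_le_norm_add_norm_sub (fderiv ℝ f (x + z)) (fderiv ℝ f x)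
    linarith

lemma lsi_constant_le_s2 {R δ : ℝ} (hn : 1 ≤ n) (hδ0 : 0 < δ) (hδ : δ ≤ R ^ 2) :
    (3 + (n + 4 * R ^ 2 / δ + 10) * exp (R ^ 2 / δ)) * (128 * δ * 2 ^ ((n : ℝ) / 2)) ≤
      289 * R ^ 2 * exp (20 * n + 5 * R ^ 2 / δ) := by
  have hn' : (1 : ℝ) ≤ n := by exact_mod_cast hn
  have hr : 0 ≤ R ^ 2 / δ := by positivity
  rw [mul_div_assoc 4, mul_div_assoc 5]
  set r := R ^ 2 / δ
  have h1 : (2 : ℝ) ^ ((n : ℝ) / 2) ≤ exp n := by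
    rw [rpow_def_of_pos (by norm_num)]
    refine exp_le_exp.mpr ?_
    nlinarith [log_two_lt_d9]
  have h2 : (n : ℝ) + 13 + 4 * r ≤ 13 * (exp n * exp r) := by
    rw [← exp_add]
    linarith [add_one_le_exp ((n : ℝ) + r)]
  have h3 : 1 ≤ exp r := one_le_exp hr
  have h4 : 3 + (n + 4 * r + 10) * exp r ≤ 13 * exp n * exp r * exp r := by nlinarith
  have h5 : (19 : ℝ) ≤ exp (18 * n) := by linarith [add_one_le_exp (18 * (n : ℝ))]
  calc _ ≤ (13 * exp n * exp r * exp r) * (128 * R ^ 2 * exp n) := by gcongr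
    _ = 1664 * R ^ 2 * (exp n * exp n * exp r * exp r) := by ring
    _ ≤ 289 * R ^ 2 * (exp (18 * n) * (exp n * exp n * exp r * exp r)) := by
      have : 0 ≤ R ^ 2 * (exp n * exp n * exp r * exp r) := by positivity
      nlinarith [mul_le_mul_of_nonneg_right h5 this]
    _ ≤ 289 * R ^ 2 * exp (20 * n + 5 * r) := by
      gcongr
      rw [← exp_add, ← exp_add, ← exp_add, ← exp_add]
      refine exp_le_exp.mpr ?_
      linarith

end Main

theorem stmt2 (n : ℕ) (hn : 1 ≤ n) (R δ : ℝ) (hR : 0 < R) (hδpos : 0 < δ) (hδ : δ ≤ R ^ 2)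
    (μ : Measure (EuclideanSpace ℝ (Fin n))) [IsProbabilityMeasure μ]
    (hsupp : ∃ x₀ : EuclideanSpace ℝ (Fin n), μ (Metric.closedBall x₀ R)ᶜ = 0) :
    SatisfiesLSIn (mconvn μ (gaussianRn n δ))
      (289 * R ^ 2 * Real.exp (20 * n + 5 * R ^ 2 / δ)) := by
  obtain ⟨x₀, hx₀⟩ := hsupp
  have hμ : ∀ᵐ x ∂μ, ‖x - x₀‖ ≤ R := by
    refine measure_mono_null (fun x hx => ?_) hx₀
    simpa [dist_eq_norm] using hx
  intro f hf hs
  have := isProbabilityMeasure_gaussianRn (n := n) hδpos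
  have := isProbabilityMeasure_mconvn (ν := μ) (ρ := gaussianRn n δ)
  obtain ⟨L, K, hT⟩ := exists_taylorBound hf hs
  rw [Ent_eq_entropy hT.bddMeas.sq fun x => sq_nonneg _]
  refine (hT.entropy_sq_mconvn_le_of_tight hδpos hμ).trans ?_
  exact mul_le_mul_of_nonneg_right (lsi_constant_le_s2 hn hδpos hδ)
    (integral_nonneg fun x => sq_nonneg _)
end
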